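/- Let (G,σ) be a flow-admissible signed graph with |E⁻(G,σ)| = ε(G,σ), and let b(G) denote the number of bridges of G. Then there exists a family 𝓕 of signed-circuits of (G,σ) such that every edge in E(G) \ E(Ĝ⁺) lies in some member of 𝓕 and 2ℓ(𝓕) ≤ 4|E(G)| − |E(Ĝ⁺)| + 2b(G), where Ĝ⁺ is the maximal bridgeless subgraph of G⁺. -/

import Mathlib

open SimpleGraph Set

variable {V : Type*}

/-- `J` is a `T`-join of `G`: a set of edges of `G` such that a vertex has odd degree
in the spanning subgraph with edge set `J` iff it belongs to `T`. -/
def IsTJoin (G : SimpleGraph V) (T : Set V) (J : Set (Sym2 V)) : Prop :=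
  J ⊆ G.edgeSet ∧ ∀ v : V, (Odd {e ∈ J | v ∈ e}.ncard ↔ v ∈ T)

/-- The edge set of the maximal bridgeless subgraph of `G`: all non-bridge edges. -/
def nonBridgeEdges (G : SimpleGraph V) : Set (Sym2 V) :=
  {e ∈ G.edgeSet | ¬ G.IsBridge e}

/-- A graph is 2-edge-connected if it is connected, has at least two vertices,
and has no bridge. -/
def TwoEdgeConnected (G : SimpleGraph V) : Prop :=
  G.Connected ∧ Nontrivial V ∧ ∀ e, ¬ G.IsBridge e

/-- `H` is the edge set of an even subgraph of `G`: every vertex has even degree. -/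
def IsEvenEdgeSet (G : SimpleGraph V) (H : Set (Sym2 V)) : Prop :=
  H ⊆ G.edgeSet ∧ ∀ v : V, Even {e ∈ H | v ∈ e}.ncard

/-! Signed graphs: a signature is `σ : Sym2 V → Bool`, `σ e = true` meaning `e` is negative. -/

/-- The set of negative edges of `(G, σ)`. -/
def negEdgeSet (G : SimpleGraph V) (σ : Sym2 V → Bool) : Set (Sym2 V) :=
  {e ∈ G.edgeSet | σ e = true}

/-- The set of positive edges of `(G, σ)`. -/
def posEdgeSet (G : SimpleGraph V) (σ : Sym2 V → Bool) : Set (Sym2 V) :=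
  {e ∈ G.edgeSet | σ e = false}

/-- `G⁺`: the spanning subgraph of `G` on the positive edges. -/
def gplus (G : SimpleGraph V) (σ : Sym2 V → Bool) : SimpleGraph V :=
  G.deleteEdges {e | σ e = true}

/-- `C` is the edge set and `S` the vertex set of a cycle of `G`. -/
def IsCycleSet (G : SimpleGraph V) (C : Set (Sym2 V)) (S : Set V) : Prop :=
  ∃ (v : V) (w : G.Walk v v), w.IsCycle ∧ C = {e | e ∈ w.edges} ∧ S = {x | x ∈ w.support}

/-- `C` (with vertex set `S`) is a negative cycle: it has an odd number of negative edges. -/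
def IsNegCycle (G : SimpleGraph V) (σ : Sym2 V → Bool) (C : Set (Sym2 V)) (S : Set V) : Prop :=
  IsCycleSet G C S ∧ Odd {e ∈ C | σ e = true}.ncard

/-- `C` is (the edge set of) a positive cycle: it has an even number of negative edges. -/
def IsPosCycle (G : SimpleGraph V) (σ : Sym2 V → Bool) (C : Set (Sym2 V)) : Prop :=
  (∃ S, IsCycleSet G C S) ∧ Even {e ∈ C | σ e = true}.ncard

/-- `B` is a short barbell whose two negative cycles have edge sets `C₁` and `C₂`:
the two negative cycles meet in exactly one vertex. -/
def IsShortBarbellWith (G : SimpleGraph V) (σ : Sym2 V → Bool)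
    (B C₁ C₂ : Set (Sym2 V)) : Prop :=
  ∃ S₁ S₂, IsNegCycle G σ C₁ S₁ ∧ IsNegCycle G σ C₂ S₂ ∧
    (∃ v, S₁ ∩ S₂ = {v}) ∧ B = C₁ ∪ C₂

/-- `B` is a long barbell whose two negative cycles have edge sets `C₁` and `C₂`:
two vertex-disjoint negative cycles joined by a path meeting them only in its endpoints. -/
def IsLongBarbellWith (G : SimpleGraph V) (σ : Sym2 V → Bool)
    (B C₁ C₂ : Set (Sym2 V)) : Prop :=
  ∃ (S₁ S₂ : Set V) (u v : V) (p : G.Walk u v), IsNegCycle G σ C₁ S₁ ∧ IsNegCycle G σ C₂ S₂ ∧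
    Disjoint S₁ S₂ ∧ p.IsPath ∧ u ∈ S₁ ∧ v ∈ S₂ ∧
    {x | x ∈ p.support} ∩ S₁ = {u} ∧ {x | x ∈ p.support} ∩ S₂ = {v} ∧
    B = C₁ ∪ C₂ ∪ {e | e ∈ p.edges}

/-- `B` is a barbell whose two negative cycles have edge sets `C₁` and `C₂`. -/
def IsBarbellWith (G : SimpleGraph V) (σ : Sym2 V → Bool) (B C₁ C₂ : Set (Sym2 V)) : Prop :=
  IsShortBarbellWith G σ B C₁ C₂ ∨ IsLongBarbellWith G σ B C₁ C₂

/-- `B` is (the edge set of) a barbell of `(G, σ)`. -/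
def IsBarbell (G : SimpleGraph V) (σ : Sym2 V → Bool) (B : Set (Sym2 V)) : Prop :=
  ∃ C₁ C₂, IsBarbellWith G σ B C₁ C₂

/-- A signed-circuit is a positive cycle or a barbell. -/
def IsSignedCircuit (G : SimpleGraph V) (σ : Sym2 V → Bool) (D : Set (Sym2 V)) : Prop :=
  IsPosCycle G σ D ∨ IsBarbell G σ D

open Classical in
/-- `τ(G,σ)`: `|E(G)|` if there is no barbell, otherwise the minimum over all barbells of
the total number of edges of its two negative cycles. -/
noncomputable def tau (G : SimpleGraph V) (σ : Sym2 V → Bool) : ℕ :=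
  if ∃ B, IsBarbell G σ B then
    sInf {n | ∃ B C₁ C₂, IsBarbellWith G σ B C₁ C₂ ∧ n = C₁.ncard + C₂.ncard}
  else G.edgeSet.ncard

/-- The length of a family of signed-circuits (counted with multiplicity). -/
noncomputable def circuitLength (𝓕 : Multiset (Set (Sym2 V))) : ℕ := (𝓕.map Set.ncard).sum

/-- `𝓕` is a signed-circuit cover of `(G, σ)`. -/
def IsSignedCircuitCover (G : SimpleGraph V) (σ : Sym2 V → Bool)
    (𝓕 : Multiset (Set (Sym2 V))) : Prop :=
  (∀ C ∈ 𝓕, IsSignedCircuit G σ C) ∧ ∀ e ∈ G.edgeSet, ∃ C ∈ 𝓕, e ∈ C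

/-- `e` has exactly one endpoint in `U`. -/
def Crosses (U : Set V) (e : Sym2 V) : Prop :=
  ∃ x y, e = s(x, y) ∧ x ∈ U ∧ y ∉ U

open Classical in
/-- The signature obtained from `σ` by switching at the vertex set `U`. -/
noncomputable def switchSign (σ : Sym2 V → Bool) (U : Set V) : Sym2 V → Bool :=
  fun e => if Crosses U e then !(σ e) else σ e

/-- Two signatures are equivalent if one is obtained from the other by switching. -/
def EquivSign (σ σ' : Sym2 V → Bool) : Prop := ∃ U : Set V, σ' = switchSign σ U

/-- The minimum number of negative edges lying entirely inside `W`, over all signatures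
equivalent to `σ` (the negativeness of the signed subgraph induced on `W`). -/
noncomputable def negOn (G : SimpleGraph V) (σ : Sym2 V → Bool) (W : Set V) : ℕ :=
  sInf {n | ∃ U : Set V,
    n = {e | e ∈ G.edgeSet ∧ (∀ x ∈ e, x ∈ W) ∧ switchSign σ U e = true}.ncard}

/-- The negativeness `ε(G,σ)`. -/
noncomputable def negativeness (G : SimpleGraph V) (σ : Sym2 V → Bool) : ℕ :=
  negOn G σ Set.univ

/-- The signed subgraph induced on `W` is balanced. -/
def BalancedOn (G : SimpleGraph V) (σ : Sym2 V → Bool) (W : Set V) : Prop :=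
  negOn G σ W = 0

/-- `(G, σ)` is flow-admissible: each connected component has negativeness ≠ 1, and
for every bridge, neither of the two components obtained by deleting it is balanced. -/
def FlowAdmissible (G : SimpleGraph V) (σ : Sym2 V → Bool) : Prop :=
  ∀ x : V,
    negOn G σ {y | G.Reachable x y} ≠ 1 ∧
    ∀ e ∈ G.edgeSet, G.IsBridge e → (∀ z ∈ e, G.Reachable x z) →
      ∀ z ∈ e, ¬ BalancedOn G σ {y | (G.deleteEdges {e}).Reachable z y}

/-- `{e, f}` is a 2-edge-cut of `G`. -/
def IsTwoEdgeCut (G : SimpleGraph V) (e f : Sym2 V) : Prop :=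
  e ∈ G.edgeSet ∧ f ∈ G.edgeSet ∧ e ≠ f ∧ ¬ G.IsBridge e ∧ ¬ G.IsBridge f ∧
    ¬ (G.deleteEdges {e, f}).Connected

set_option linter.unusedSectionVars false


section Alg
open Classical

theorem sum_symmDiff_two {α M : Type*} [DecidableEq α] [AddCommGroup M] (h2 : ∀ m : M, m + m = 0)
    (c : α → M) (A B : Finset α) :
    ∑ e ∈ symmDiff A B, c e = ∑ e ∈ A, c e + ∑ e ∈ B, c e := by
  have hd : Disjoint (A \ B) (B \ A) := disjoint_sdiff_sdiff
  have : symmDiff A B = (A \ B) ∪ (B \ A) := rfl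
  rw [this, Finset.sum_union hd, ← Finset.sum_inter_add_sum_sdiff A B,
    ← Finset.sum_inter_add_sum_sdiff B A, Finset.inter_comm B A]
  have := h2 (∑ e ∈ A ∩ B, c e)
  rw [add_add_add_comm, this, zero_add]

/-- averaging -/
theorem averaging {α M : Type*} [DecidableEq α] [AddCommGroup M] (h2 : ∀ m : M, m + m = 0)
    (c : α → M) (S D : Finset α) (_hDS : D ⊆ S) (τ : M)
    (hne : ∃ J ⊆ S, ∑ e ∈ J, c e = τ)
    (hD : ∀ e ∈ D, ∃ Z ⊆ S, e ∈ Z ∧ ∑ e ∈ Z, c e = 0) :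
    ∃ J ⊆ S, ∑ e ∈ J, c e = τ ∧ 2 * (J ∩ D).card ≤ D.card := by
  set F : Finset (Finset α) := S.powerset.filter (fun J => ∑ e ∈ J, c e = τ) with hF
  have hFne : F.Nonempty := by
    obtain ⟨J, h1, h3⟩ := hne
    exact ⟨J, by simp [hF, h1, h3]⟩
  by_contra hcon
  push Not at hcon
  have hlt : F.card * D.card < ∑ J ∈ F, 2 * (J ∩ D).card := by
    rw [← smul_eq_mul, ← Finset.sum_const]
    apply Finset.sum_lt_sum_of_nonempty hFne
    intro J hJ
    simp [hF] at hJ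
    exact hcon J hJ.1 hJ.2
  have hcount : ∀ e ∈ D, 2 * (F.filter (fun J => e ∈ J)).card = F.card := by
    intro e he
    obtain ⟨Z, hZ, heZ, hZ0⟩ := hD e he
    have hinv : (F.filter (fun J => e ∈ J)).card = (F.filter (fun J => ¬ e ∈ J)).card := by
      apply Finset.card_bij' (fun J _ => symmDiff J Z) (fun J _ => symmDiff J Z)
      · intro J hJ
        simp only [hF, Finset.mem_filter, Finset.mem_powerset] at hJ ⊢
        refine ⟨⟨?_, ?_⟩, ?_⟩
        · exact (symmDiff_le_sup : symmDiff J Z ≤ J ⊔ Z).trans (sup_le hJ.1.1 hZ)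
        · rw [sum_symmDiff_two h2, hZ0, hJ.1.2, add_zero]
        · simp [Finset.mem_symmDiff, hJ.2, heZ]
      · intro J hJ
        simp only [hF, Finset.mem_filter, Finset.mem_powerset] at hJ ⊢
        refine ⟨⟨?_, ?_⟩, ?_⟩
        · exact (symmDiff_le_sup : symmDiff J Z ≤ J ⊔ Z).trans (sup_le hJ.1.1 hZ)
        · rw [sum_symmDiff_two h2, hZ0, hJ.1.2, add_zero]
        · simp [Finset.mem_symmDiff, hJ.2, heZ]
      · intro J _; simp
      · intro J _; simp
    have := Finset.card_filter_add_card_filter_not (s := F) (fun J => e ∈ J)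
    omega
  have : ∑ J ∈ F, 2 * (J ∩ D).card = F.card * D.card := by
    have h1 : ∀ J ∈ F, 2 * (J ∩ D).card = ∑ e ∈ D, if e ∈ J then 2 else 0 := by
      intro J _
      rw [← Finset.sum_filter, Finset.sum_const, smul_eq_mul, mul_comm, Finset.inter_comm,
        Finset.filter_mem_eq_inter]
    rw [Finset.sum_congr rfl h1, Finset.sum_comm]
    have h3 : ∀ e ∈ D, (∑ J ∈ F, if e ∈ J then 2 else 0) = F.card := by
      intro e he
      rw [← Finset.sum_filter, Finset.sum_const, smul_eq_mul, mul_comm, hcount e he]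
    rw [Finset.sum_congr rfl h3, Finset.sum_const, smul_eq_mul, mul_comm]
  omega

theorem zt (a : ZMod 2) : a + a = 0 := CharTwo.add_self_eq_zero a

theorem zt01 (a : ZMod 2) : a = 0 ∨ a = 1 := by
  revert a; decide

theorem zt1 {a : ZMod 2} (h : a ≠ 0) : a = 1 := (zt01 a).resolve_left h

/-- indicator of a vertex -/
noncomputable def dl (x : V) : V → ZMod 2 := Pi.single x 1

theorem ztf (f : V → ZMod 2) : f + f = 0 := by
  funext v; exact zt _

theorem dl_self (x : V) : dl x x = 1 := by simp [dl]
theorem dl_ne {x y : V} (h : y ≠ x) : dl x y = 0 := by simp [dl, h]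
theorem dl_apply (x y : V) : dl x y = if y = x then 1 else 0 := by
  by_cases h : y = x <;> simp [dl, h]

noncomputable def inc (e : Sym2 V) : V → ZMod 2 :=
  Sym2.lift ⟨fun x y => dl x + dl y, fun _ _ => add_comm _ _⟩ e

theorem inc_mk (x y : V) : inc s(x, y) = dl x + dl y := rfl

noncomputable def bd (J : Finset (Sym2 V)) : V → ZMod 2 := ∑ e ∈ J, inc e

noncomputable def sg (σ : Sym2 V → Bool) (J : Finset (Sym2 V)) : ZMod 2 :=
  ∑ e ∈ J, if σ e = true then 1 else 0

@[simp] theorem bd_empty : bd (∅ : Finset (Sym2 V)) = 0 := by simp [bd]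
@[simp] theorem sg_empty (σ : Sym2 V → Bool) : sg σ ∅ = 0 := by simp [sg]

theorem bd_single (x y : V) : bd {s(x, y)} = dl x + dl y := by simp [bd, inc_mk]

theorem bd_symm (A B : Finset (Sym2 V)) : bd (symmDiff A B) = bd A + bd B :=
  sum_symmDiff_two ztf inc A B

theorem sg_symm (σ : Sym2 V → Bool) (A B : Finset (Sym2 V)) :
    sg σ (symmDiff A B) = sg σ A + sg σ B :=
  sum_symmDiff_two zt (fun e => if σ e = true then 1 else 0) A B

theorem bd_union {A B : Finset (Sym2 V)} (h : Disjoint A B) : bd (A ∪ B) = bd A + bd B :=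
  Finset.sum_union h
theorem sg_union (σ : Sym2 V → Bool) {A B : Finset (Sym2 V)} (h : Disjoint A B) :
    sg σ (A ∪ B) = sg σ A + sg σ B :=
  Finset.sum_union h

theorem bd_sdiff {A B : Finset (Sym2 V)} (h : A ⊆ B) : bd (B \ A) = bd B + bd A := by
  have := Finset.sum_sdiff (f := inc) h
  have h3 : bd (B \ A) + bd A = bd B := this
  rw [← h3, add_assoc, ztf, add_zero]
theorem sg_sdiff (σ : Sym2 V → Bool) {A B : Finset (Sym2 V)} (h : A ⊆ B) :
    sg σ (B \ A) = sg σ B + sg σ A := by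
  have h3 : sg σ (B \ A) + sg σ A = sg σ B := Finset.sum_sdiff h
  rw [← h3, add_assoc, zt, add_zero]

theorem exists_mem_of_bd_ne {A : Finset (Sym2 V)} {x : V} (h : bd A x ≠ 0) :
    ∃ e ∈ A, x ∈ e := by
  by_contra hc
  push Not at hc
  apply h
  rw [bd, Finset.sum_apply]
  apply Finset.sum_eq_zero
  intro e he
  have := hc e he
  induction e with | _ a b =>
  simp only [Sym2.mem_iff, not_or] at this
  rw [inc_mk, Pi.add_apply, dl_ne this.1, dl_ne this.2, add_zero]

/-- crossing indicator -/
noncomputable def cr (U : Set V) (e : Sym2 V) : ZMod 2 := if Crosses U e then 1 else 0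

theorem crosses_mk (U : Set V) (x y : V) :
    Crosses U s(x, y) ↔ ((x ∈ U ∧ y ∉ U) ∨ (y ∈ U ∧ x ∉ U)) := by
  constructor
  · rintro ⟨a, b, h, ha, hb⟩
    rw [Sym2.eq_iff] at h
    rcases h with ⟨rfl, rfl⟩ | ⟨rfl, rfl⟩
    · exact Or.inl ⟨ha, hb⟩
    · exact Or.inr ⟨ha, hb⟩
  · rintro (⟨ha, hb⟩ | ⟨ha, hb⟩)
    · exact ⟨x, y, rfl, ha, hb⟩
    · exact ⟨y, x, Sym2.eq_swap, ha, hb⟩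

theorem cr_mk (U : Set V) (x y : V) :
    cr U s(x, y) = (if x ∈ U then 1 else 0) + (if y ∈ U then 1 else 0) := by
  unfold cr
  rw [crosses_mk]
  by_cases hx : x ∈ U <;> by_cases hy : y ∈ U <;> simp [hx, hy, zt]

variable [Fintype V]

/-- sum of a function over a vertex set -/
noncomputable def us (U : Set V) (f : V → ZMod 2) : ZMod 2 := ∑ v, if v ∈ U then f v else 0

theorem us_add (U : Set V) (f g : V → ZMod 2) : us U (f + g) = us U f + us U g := by
  unfold us
  rw [← Finset.sum_add_distrib]
  apply Finset.sum_congr rfl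
  intro v _
  split_ifs <;> simp

theorem us_sum {ι : Type*} (U : Set V) (s : Finset ι) (f : ι → V → ZMod 2) :
    us U (∑ i ∈ s, f i) = ∑ i ∈ s, us U (f i) := by
  induction s using Finset.induction_on with
  | empty => simp [us]
  | insert a s ha ih => rw [Finset.sum_insert ha, Finset.sum_insert ha, us_add, ih]

theorem us_dl (U : Set V) (x : V) : us U (dl x) = if x ∈ U then 1 else 0 := by
  unfold us
  rw [Finset.sum_eq_single x]
  · simp [dl_self]
  · intro b _ hb; simp [dl_ne hb]
  · simp

/-- cut parity -/
theorem us_bd (U : Set V) (J : Finset (Sym2 V)) : us U (bd J) = ∑ e ∈ J, cr U e := by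
  rw [bd, us_sum]
  apply Finset.sum_congr rfl
  intro e _
  induction e with | _ a b =>
  rw [inc_mk, us_add, us_dl, us_dl, cr_mk]

theorem us_bd_nocross {U : Set V} {J : Finset (Sym2 V)} (h : ∀ e ∈ J, ¬ Crosses U e) :
    us U (bd J) = 0 := by
  rw [us_bd]; apply Finset.sum_eq_zero; intro e he; simp [cr, h e he]

theorem us_bd_single {U : Set V} {J : Finset (Sym2 V)} {f : Sym2 V}
    (h : ∀ e ∈ J, e ≠ f → ¬ Crosses U e) (hf : Crosses U f) :
    us U (bd J) = if f ∈ J then 1 else 0 := by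
  rw [us_bd]
  have : ∀ e ∈ J, cr U e = if e = f then 1 else 0 := by
    intro e he
    by_cases hef : e = f
    · subst hef; simp [cr, hf]
    · simp [cr, h e he hef, hef]
  rw [Finset.sum_congr rfl this, Finset.sum_ite_eq']

theorem us_exists {U : Set V} {f : V → ZMod 2} (h : us U f ≠ 0) : ∃ v ∈ U, f v ≠ 0 := by
  by_contra hc
  push Not at hc
  apply h
  apply Finset.sum_eq_zero
  intro v _
  split_ifs with hv
  · exact hc v hv
  · rfl

/-- algebraic connectivity -/
def conn (K : Finset (Sym2 V)) (x y : V) : Prop := ∃ A ⊆ K, bd A = dl x + dl y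

end Alg


section Conn
open Classical
variable [Fintype V]

theorem conn_refl (K : Finset (Sym2 V)) (x : V) : conn K x x :=
  ⟨∅, by simp, by rw [ztf]; simp⟩

theorem conn_symm {K : Finset (Sym2 V)} {x y : V} (h : conn K x y) : conn K y x := by
  obtain ⟨A, h1, h2⟩ := h
  exact ⟨A, h1, by rw [h2, add_comm]⟩

theorem symm_sub {A B K : Finset (Sym2 V)} (h1 : A ⊆ K) (h2 : B ⊆ K) : symmDiff A B ⊆ K :=
  (symmDiff_le_sup : symmDiff A B ≤ A ⊔ B).trans (sup_le h1 h2)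

theorem conn_trans {K : Finset (Sym2 V)} {x y z : V} (h : conn K x y) (h' : conn K y z) :
    conn K x z := by
  obtain ⟨A, h1, h2⟩ := h
  obtain ⟨B, h3, h4⟩ := h'
  refine ⟨symmDiff A B, symm_sub h1 h3, ?_⟩
  rw [bd_symm, h2, h4]
  have := ztf (dl y)
  calc dl x + dl y + (dl y + dl z) = dl x + (dl y + dl y) + dl z := by abel
    _ = _ := by rw [this, add_zero]

theorem conn_mono {K K' : Finset (Sym2 V)} (hK : K ⊆ K') {x y : V} (h : conn K x y) :
    conn K' x y := by
  obtain ⟨A, h1, h2⟩ := h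
  exact ⟨A, h1.trans hK, h2⟩

theorem conn_edge {K : Finset (Sym2 V)} {x y : V} (h : s(x, y) ∈ K) : conn K x y :=
  ⟨{s(x, y)}, by simpa using h, bd_single x y⟩

theorem conn_nocross {K : Finset (Sym2 V)} {x y : V} (h : conn K x y) {U : Set V}
    (hU : ∀ e ∈ K, ¬ Crosses U e) (hx : x ∈ U) : y ∈ U := by
  obtain ⟨A, h1, h2⟩ := h
  have h3 : us U (bd A) = 0 := us_bd_nocross (fun e he => hU e (h1 he))
  rw [h2, us_add, us_dl, us_dl] at h3
  by_contra hy
  simp [hx, hy] at h3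

def comp (K : Finset (Sym2 V)) (x : V) : Set V := {y | conn K x y}

theorem comp_nocross (K : Finset (Sym2 V)) (x : V) : ∀ e ∈ K, ¬ Crosses (comp K x) e := by
  rintro e he ⟨a, b, rfl, ha, hb⟩
  exact hb (conn_trans ha (conn_edge he))

theorem mem_comp_self (K : Finset (Sym2 V)) (x : V) : x ∈ comp K x := conn_refl K x

theorem comp_mem_of_sub {K K' : Finset (Sym2 V)} (h : K' ⊆ K) {x y z : V}
    (hy : y ∈ comp K x) (hz : conn K' y z) : z ∈ comp K x :=
  conn_trans hy (conn_mono h hz)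

theorem walk_out {J : Finset (Sym2 V)} {x : V} (h : bd J x ≠ 0) :
    ∃ y, y ≠ x ∧ bd J y ≠ 0 ∧ conn J x y := by
  have h0 : us (comp J x) (bd J) = 0 := us_bd_nocross (comp_nocross J x)
  have h1 : us (comp J x) (bd J + dl x) ≠ 0 := by
    rw [us_add, h0, us_dl, if_pos (mem_comp_self J x)]; decide
  obtain ⟨y, hy, hy0⟩ := us_exists h1
  have hyx : y ≠ x := by
    rintro rfl
    rw [Pi.add_apply, zt1 h, dl_self] at hy0
    exact hy0 (zt 1)
  refine ⟨y, hyx, ?_, hy⟩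
  rwa [Pi.add_apply, dl_ne hyx, add_zero] at hy0

theorem tjoin (E : Finset (Sym2 V)) : ∀ (n : ℕ) (τ : V → ZMod 2),
    (Finset.univ.filter (fun v => τ v ≠ 0)).card ≤ n →
    (∀ x, us (comp E x) τ = 0) → ∃ J ⊆ E, bd J = τ := by
  intro n
  induction n with
  | zero =>
    intro τ hn _
    refine ⟨∅, by simp, ?_⟩
    rw [Nat.le_zero, Finset.card_eq_zero, Finset.filter_eq_empty_iff] at hn
    funext v
    have := hn (Finset.mem_univ v)
    push Not at this
    simp [this]
  | succ n ih =>
    intro τ hn h0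
    by_cases hz : ∃ x, τ x ≠ 0
    · obtain ⟨x, hx⟩ := hz
      have h1 : us (comp E x) (τ + dl x) ≠ 0 := by
        rw [us_add, h0, us_dl, if_pos (mem_comp_self E x)]; decide
      obtain ⟨y, hy, hy0⟩ := us_exists h1
      have hyx : y ≠ x := by
        rintro rfl
        rw [Pi.add_apply, zt1 hx, dl_self] at hy0
        exact hy0 (zt 1)
      have hyt : τ y ≠ 0 := by rwa [Pi.add_apply, dl_ne hyx, add_zero] at hy0
      obtain ⟨A, hA, hAb⟩ := hy
      have k1 : (Finset.univ.filter (fun v => (τ + (dl x + dl y)) v ≠ 0)).card ≤ n := by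
        have : (Finset.univ.filter (fun v => (τ + (dl x + dl y)) v ≠ 0)) ⊂
            (Finset.univ.filter (fun v => τ v ≠ 0)) := by
          rw [Finset.ssubset_iff_of_subset]
          · refine ⟨x, by simp [hx], ?_⟩
            simp only [Finset.mem_filter, Finset.mem_univ, true_and, not_not]
            rw [Pi.add_apply, Pi.add_apply, dl_self, dl_ne hyx.symm, zt1 hx]; decide
          · intro v hv
            simp only [Finset.mem_filter, Finset.mem_univ, true_and] at hv ⊢
            by_cases hvx : v = x
            · rw [hvx]; exact hx
            by_cases hvy : v = y
            · rw [hvy]; exact hyt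
            rwa [Pi.add_apply, Pi.add_apply, dl_ne hvx, dl_ne hvy, add_zero, add_zero] at hv
        have := Finset.card_lt_card this
        omega
      have k2 : ∀ z, us (comp E z) (τ + (dl x + dl y)) = 0 := by
        intro z
        rw [us_add, h0, us_add, us_dl, us_dl]
        have : x ∈ comp E z ↔ y ∈ comp E z :=
          ⟨fun h => conn_trans h ⟨A, hA, hAb⟩, fun h => conn_trans h (conn_symm ⟨A, hA, hAb⟩)⟩
        by_cases hx' : x ∈ comp E z
        · simp [hx', this.1 hx', zt]
        · have : y ∉ comp E z := fun h => hx' (this.2 h)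
          simp [hx', this]
      obtain ⟨J, hJ, hJb⟩ := ih _ k1 k2
      refine ⟨symmDiff J A, symm_sub hJ hA, ?_⟩
      rw [bd_symm, hJb, hAb, add_assoc, ztf, add_zero]
    · push Not at hz
      exact ⟨∅, by simp, by funext v; simp [hz]⟩

theorem tjoin' (E : Finset (Sym2 V)) (τ : V → ZMod 2)
    (h : ∀ x, us (comp E x) τ = 0) : ∃ J ⊆ E, bd J = τ :=
  tjoin E _ τ le_rfl h

/-- `e` lies in an even subset of `K`. -/
def cyc (K : Finset (Sym2 V)) (e : Sym2 V) : Prop := ∃ Z ⊆ K, e ∈ Z ∧ bd Z = 0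

theorem cyc_of_conn {K : Finset (Sym2 V)} {x y : V} (he : s(x, y) ∈ K)
    (h : conn (K.erase s(x, y)) x y) : cyc K s(x, y) := by
  obtain ⟨A, hA, hb⟩ := h
  have hn : s(x, y) ∉ A := fun h => by simpa using hA h
  refine ⟨insert s(x, y) A, ?_, by simp, ?_⟩
  · intro f hf
    rw [Finset.mem_insert] at hf
    rcases hf with rfl | hf
    · exact he
    · exact Finset.mem_of_mem_erase (hA hf)
  · rw [bd, Finset.sum_insert hn, inc_mk]
    change _ + bd A = 0
    rw [hb, ztf]

/-- side of a bridge -/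
def side (K : Finset (Sym2 V)) (e : Sym2 V) (z : V) : Set V := comp (K.erase e) z

theorem side_cross_only {K : Finset (Sym2 V)} {e : Sym2 V} {z : V} :
    ∀ f ∈ K, f ≠ e → ¬ Crosses (side K e z) f := fun f hf hfe =>
  comp_nocross _ _ f (Finset.mem_erase.2 ⟨hfe, hf⟩)

theorem side_crosses {K : Finset (Sym2 V)} {x y : V} (he : s(x, y) ∈ K)
    (hb : ¬ cyc K s(x, y)) : Crosses (side K s(x, y) x) s(x, y) :=
  ⟨x, y, rfl, mem_comp_self _ _, fun h => hb (cyc_of_conn he h)⟩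

theorem side_crosses' {K : Finset (Sym2 V)} {e : Sym2 V} {z : V} (he : e ∈ K)
    (hb : ¬ cyc K e) (hz : z ∈ e) : Crosses (side K e z) e := by
  obtain ⟨y, rfl⟩ := Sym2.mem_iff_exists.1 hz
  exact side_crosses he hb

theorem even_cross {K Z : Finset (Sym2 V)} {U : Set V} {f : Sym2 V} (hZ : Z ⊆ K) (hb : bd Z = 0)
    (h : ∀ e ∈ K, e ≠ f → ¬ Crosses U e) (hf : Crosses U f) : f ∉ Z := by
  intro hfZ
  have := us_bd_single (J := Z) (fun e he => h e (hZ he)) hf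
  rw [hb, if_pos hfZ] at this
  simp [us] at this

theorem not_cyc_of_cross {K : Finset (Sym2 V)} {U : Set V} {f : Sym2 V}
    (h : ∀ e ∈ K, e ≠ f → ¬ Crosses U e) (hf : Crosses U f) : ¬ cyc K f := by
  rintro ⟨Z, hZ, hfZ, hb⟩
  exact even_cross hZ hb h hf hfZ

theorem pairing {ι : Type*} (p : ι → V) : ∀ (n : ℕ) (T : Finset ι) (J : Finset (Sym2 V)),
    T.card = n → bd J = ∑ t ∈ T, dl (p t) →
    ∃ L : List (ι × ι × Finset (Sym2 V)),
      (∀ q ∈ L, q.1 ≠ q.2.1 ∧ q.1 ∈ T ∧ q.2.1 ∈ T ∧ q.2.2 ⊆ J ∧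
        bd q.2.2 = dl (p q.1) + dl (p q.2.1)) ∧
      (∀ t ∈ T, ∃ q ∈ L, t = q.1 ∨ t = q.2.1) ∧
      (∀ e ∈ J, (∃ q ∈ L, e ∈ q.2.2) ∨ cyc J e) ∧
      (∀ w : ι → ℕ, (L.map (fun q => w q.1 + w q.2.1 + q.2.2.card)).sum
        ≤ ∑ t ∈ T, w t + J.card) := by
  intro n
  induction n using Nat.strong_induction_on with | _ n ih =>
  intro T J hTn hJ
  rcases T.eq_empty_or_nonempty with rfl | ⟨t, ht⟩
  · refine ⟨[], by simp, by simp, ?_, by simp⟩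
    intro e he
    exact Or.inr ⟨J, subset_rfl, he, by simpa using hJ⟩
  have key : ∃ t' ∈ T, t' ≠ t ∧ conn J (p t) (p t') := by
    by_cases hco : ∃ t' ∈ T, t' ≠ t ∧ p t' = p t
    · obtain ⟨t', h1, h2, h3⟩ := hco
      exact ⟨t', h1, h2, by rw [h3]; exact conn_refl _ _⟩
    · push Not at hco
      have h1 : bd J (p t) ≠ 0 := by
        rw [hJ, Finset.sum_apply, Finset.sum_eq_single t]
        · rw [dl_self]; decide
        · intro b hb hbt
          exact dl_ne (fun h => hco b hb hbt h.symm)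
        · exact fun h => absurd ht h
      obtain ⟨y, hy, hy0, hc⟩ := walk_out h1
      rw [hJ, Finset.sum_apply] at hy0
      obtain ⟨t', ht', h2⟩ := Finset.exists_ne_zero_of_sum_ne_zero hy0
      have : y = p t' := by
        by_contra hne; exact h2 (dl_ne hne)
      subst this
      exact ⟨t', ht', fun h => hy (by rw [h]), hc⟩
  obtain ⟨t', ht', htt, A, hA, hAb⟩ := key
  set T' := (T.erase t).erase t' with hT'
  have hmem : t' ∈ T.erase t := Finset.mem_erase.2 ⟨htt, ht'⟩
  have hsum : ∀ (f : ι → V → ZMod 2),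
      ∑ s ∈ T, f s = f t + (f t' + ∑ s ∈ T', f s) := by
    intro f
    rw [hT', Finset.add_sum_erase _ _ hmem, Finset.add_sum_erase _ _ ht]
  have hsum' : ∀ (f : ι → ℕ),
      ∑ s ∈ T, f s = f t + (f t' + ∑ s ∈ T', f s) := by
    intro f
    rw [hT', Finset.add_sum_erase _ _ hmem, Finset.add_sum_erase _ _ ht]
  have hc : T'.card + 2 = T.card := by
    rw [hT', Finset.card_erase_of_mem hmem, Finset.card_erase_of_mem ht]
    have : 0 < (T.erase t).card := Finset.card_pos.2 ⟨t', hmem⟩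
    rw [Finset.card_erase_of_mem ht] at this
    omega
  obtain ⟨L, h1, h2, h3, h4⟩ := ih T'.card (by omega) T' (J \ A) rfl (by
    rw [bd_sdiff hA, hJ, hAb, hsum]
    have e1 := ztf (dl (p t))
    have e2 := ztf (dl (p t'))
    calc _ = (dl (p t) + dl (p t)) + (dl (p t') + dl (p t')) + ∑ s ∈ T', dl (p s) := by abel
      _ = _ := by rw [e1, e2, add_zero, zero_add])
  refine ⟨(t, t', A) :: L, ?_, ?_, ?_, ?_⟩
  · intro q hq
    rw [List.mem_cons] at hq
    rcases hq with rfl | hq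
    · exact ⟨htt.symm, ht, ht', hA, hAb⟩
    · obtain ⟨a1, a2, a3, a4, a5⟩ := h1 q hq
      refine ⟨a1, ?_, ?_, a4.trans Finset.sdiff_subset, a5⟩
      · exact Finset.mem_of_mem_erase (Finset.mem_of_mem_erase a2)
      · exact Finset.mem_of_mem_erase (Finset.mem_of_mem_erase a3)
  · intro s hs
    by_cases hst : s = t
    · exact ⟨_, List.mem_cons_self, Or.inl hst⟩
    by_cases hst' : s = t'
    · exact ⟨_, List.mem_cons_self, Or.inr hst'⟩
    obtain ⟨q, hq, hq'⟩ := h2 s (by simp [hT', hst, hst', hs])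
    exact ⟨q, List.mem_cons_of_mem _ hq, hq'⟩
  · intro e he
    by_cases heA : e ∈ A
    · exact Or.inl ⟨_, List.mem_cons_self, heA⟩
    · rcases h3 e (Finset.mem_sdiff.2 ⟨he, heA⟩) with ⟨q, hq, hq'⟩ | ⟨Z, hZ, hZ'⟩
      · exact Or.inl ⟨q, List.mem_cons_of_mem _ hq, hq'⟩
      · exact Or.inr ⟨Z, hZ.trans Finset.sdiff_subset, hZ'⟩
  · intro w
    rw [List.map_cons, List.sum_cons, hsum']
    have := h4 w
    have h5 : (J \ A).card + A.card = J.card := Finset.card_sdiff_add_card_eq_card hA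
    simp only
    omega

end Conn


section Circs
open Classical
variable [Fintype V]

def Circ (C : Finset (Sym2 V)) : Prop :=
  C.Nonempty ∧ bd C = 0 ∧ ∀ Z ⊆ C, bd Z = 0 → Z = ∅ ∨ Z = C

def VS (C : Finset (Sym2 V)) : Set V := {x | ∃ e ∈ C, x ∈ e}

theorem inc_eq_zero {e : Sym2 V} {v : V} (h : v ∉ e) : inc e v = 0 := by
  induction e with | _ a b =>
  simp only [Sym2.mem_iff, not_or] at h
  rw [inc_mk, Pi.add_apply, dl_ne h.1, dl_ne h.2, add_zero]

theorem not_crosses_mem {U : Set V} {e : Sym2 V} (h : ¬ Crosses U e) {x y : V} (hx : x ∈ e)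
    (hy : y ∈ e) (hxU : x ∈ U) : y ∈ U := by
  by_contra hyU
  apply h
  by_cases hxy : x = y
  · subst hxy; exact absurd hxU hyU
  exact ⟨x, y, (Sym2.mem_and_mem_iff hxy).1 ⟨hx, hy⟩, hxU, hyU⟩

/-- edges touching `U` -/
noncomputable def res (C : Finset (Sym2 V)) (U : Set V) : Finset (Sym2 V) :=
  C.filter (fun e => ∃ x ∈ e, x ∈ U)

theorem res_sub (C : Finset (Sym2 V)) (U : Set V) : res C U ⊆ C := Finset.filter_subset _ _

theorem bd_res {C : Finset (Sym2 V)} {U : Set V} (hU : ∀ e ∈ C, ¬ Crosses U e) (v : V) :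
    bd (res C U) v = if v ∈ U then bd C v else 0 := by
  rw [bd, Finset.sum_apply, bd, Finset.sum_apply, res, Finset.sum_filter]
  split_ifs with hv
  · apply Finset.sum_congr rfl
    intro e _
    split_ifs with h
    · rfl
    · rw [inc_eq_zero]; intro hve; exact h ⟨v, hve, hv⟩
  · apply Finset.sum_eq_zero
    intro e he
    split_ifs with h
    · obtain ⟨x, hx, hxU⟩ := h
      exact inc_eq_zero (fun hve => hv (not_crosses_mem (hU e he) hx hve hxU))
    · rfl

theorem circ_nocross {C : Finset (Sym2 V)} (hC : Circ C) {U : Set V}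
    (hU : ∀ e ∈ C, ¬ Crosses U e) {x y : V} (hx : x ∈ VS C) (hy : y ∈ VS C) (hxU : x ∈ U) :
    y ∈ U := by
  have h1 : bd (res C U) = 0 := by
    funext v; rw [bd_res hU, hC.2.1]; simp
  obtain ⟨e, he, hxe⟩ := hx
  obtain ⟨f, hf, hyf⟩ := hy
  rcases hC.2.2 _ (res_sub C U) h1 with h | h
  · exfalso
    have : e ∈ res C U := Finset.mem_filter.2 ⟨he, x, hxe, hxU⟩
    rw [h] at this; simp at this
  · rw [← h] at hf
    obtain ⟨hf, z, hz, hzU⟩ := Finset.mem_filter.1 hf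
    exact not_crosses_mem (hU f hf) hz hyf hzU

theorem circ_conn {C : Finset (Sym2 V)} (hC : Circ C) {x y : V} (hx : x ∈ VS C)
    (hy : y ∈ VS C) : conn C x y :=
  circ_nocross hC (comp_nocross C x) hx hy (mem_comp_self C x)

theorem exists_circ {Z : Finset (Sym2 V)} (hZ : bd Z = 0) {e : Sym2 V} (he : e ∈ Z) :
    ∃ C ⊆ Z, e ∈ C ∧ Circ C := by
  obtain ⟨C, hC, hmin⟩ := Finset.exists_min_image
    (Z.powerset.filter (fun C => e ∈ C ∧ bd C = 0)) Finset.card ⟨Z, by simp [he, hZ]⟩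
  simp only [Finset.mem_filter, Finset.mem_powerset] at hC hmin
  refine ⟨C, hC.1, hC.2.1, ⟨e, hC.2.1⟩, hC.2.2, ?_⟩
  intro Z' hZ' hb
  by_cases h : e ∈ Z'
  · right
    exact Finset.eq_of_subset_of_card_le hZ' (hmin Z' ⟨hZ'.trans hC.1, h, hb⟩)
  · left
    have h1 := hmin (C \ Z') ⟨Finset.sdiff_subset.trans hC.1, by simp [h, hC.2.1],
      by rw [bd_sdiff hZ', hC.2.2, hb, add_zero]⟩
    have := Finset.card_sdiff_add_card_eq_card hZ'
    rw [← Finset.card_eq_zero]; omega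

theorem walk_of_bd (G : SimpleGraph V) : ∀ (n : ℕ) (A : Finset (Sym2 V)) (x y : V), A.card = n →
    (∀ e ∈ A, e ∈ G.edgeSet) → bd A = dl x + dl y →
    ∃ w : G.Walk x y, (∀ e ∈ w.edges, e ∈ A) ∧ w.length ≤ A.card := by
  intro n
  induction n using Nat.strong_induction_on with | _ n ih =>
  intro A x y hn hA hb
  by_cases hxy : x = y
  · subst hxy; exact ⟨Walk.nil, by simp, by simp⟩
  have h1 : bd A x ≠ 0 := by
    rw [hb, Pi.add_apply, dl_self, dl_ne hxy]; decide
  obtain ⟨e, he, hxe⟩ := exists_mem_of_bd_ne h1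
  obtain ⟨z, rfl⟩ := Sym2.mem_iff_exists.1 hxe
  have hc := Finset.card_erase_of_mem he
  have hp : 0 < A.card := Finset.card_pos.2 ⟨_, he⟩
  have hbe : bd (A.erase s(x, z)) = dl z + dl y := by
    have h2 := bd_sdiff (A := {s(x,z)}) (B := A) (by simpa using he)
    rw [Finset.sdiff_singleton_eq_erase, hb, bd_single] at h2
    rw [h2]
    have := ztf (dl x)
    calc _ = (dl x + dl x) + (dl z + dl y) := by abel
      _ = _ := by rw [this, zero_add]
  obtain ⟨w, hw, hl⟩ := ih (A.card - 1) (by omega) (A.erase s(x, z)) z y hc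
    (fun e h => hA e (Finset.mem_of_mem_erase h)) hbe
  have hadj : G.Adj x z := G.mem_edgeSet.1 (hA _ he)
  refine ⟨Walk.cons hadj w, ?_, ?_⟩
  · intro e h
    rw [Walk.edges_cons, List.mem_cons] at h
    rcases h with rfl | h
    · exact he
    · exact Finset.mem_of_mem_erase (hw e h)
  · rw [Walk.length_cons]; omega

theorem walk_sum_inc {G : SimpleGraph V} {x y : V} (w : G.Walk x y) :
    (w.edges.map inc).sum = dl x + dl y := by
  induction w with
  | nil => rw [ztf]; simp
  | cons h p ih =>
    rw [Walk.edges_cons, List.map_cons, List.sum_cons, ih, inc_mk]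
    rename_i u v w
    have := ztf (dl v)
    calc _ = dl u + (dl v + dl v) + dl w := by abel
      _ = _ := by rw [this, add_zero]

theorem trail_bd {G : SimpleGraph V} {x y : V} (w : G.Walk x y) (hw : w.IsTrail) :
    bd w.edges.toFinset = dl x + dl y := by
  rw [bd, List.sum_toFinset _ hw.edges_nodup, walk_sum_inc]

theorem circ_cycleSet {G : SimpleGraph V} {C : Finset (Sym2 V)} (hC : Circ C)
    (hG : ∀ e ∈ C, e ∈ G.edgeSet) : IsCycleSet G (C : Set (Sym2 V)) (VS C) := by
  obtain ⟨e, he⟩ := hC.1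
  induction e with | _ x y =>
  have hb : bd (C.erase s(x, y)) = dl x + dl y := by
    have h2 := bd_sdiff (A := {s(x,y)}) (B := C) (by simpa using he)
    rw [Finset.sdiff_singleton_eq_erase, hC.2.1, bd_single, zero_add] at h2
    exact h2
  obtain ⟨w, hw, _⟩ := walk_of_bd G _ _ x y rfl
    (fun e h => hG e (Finset.mem_of_mem_erase h)) hb
  have hadj : G.Adj y x := (G.mem_edgeSet.1 (hG _ he)).symm
  have hp := w.bypass_isPath
  have hsub := w.edges_bypass_subset_edges
  have hne : s(y, x) ∉ w.bypass.edges := by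
    intro h
    have := hw _ (hsub h)
    rw [Sym2.eq_swap] at this
    simp at this
  have hcyc : (Walk.cons hadj w.bypass).IsCycle := (Walk.cons_isCycle_iff _ _).2 ⟨hp, hne⟩
  have hsubC : (Walk.cons hadj w.bypass).edges.toFinset ⊆ C := by
    intro e h
    rw [List.mem_toFinset, Walk.edges_cons, List.mem_cons] at h
    rcases h with rfl | h
    · rw [Sym2.eq_swap]; exact he
    · exact Finset.mem_of_mem_erase (hw e (hsub h))
  have hb0 := trail_bd _ hcyc.isTrail
  rw [ztf] at hb0
  have heq : (Walk.cons hadj w.bypass).edges.toFinset = C := by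
    rcases hC.2.2 _ hsubC hb0 with h | h
    · exfalso
      have : s(y, x) ∈ (Walk.cons hadj w.bypass).edges.toFinset := by simp
      rw [h] at this; simp at this
    · exact h
  refine ⟨y, Walk.cons hadj w.bypass, hcyc, ?_, ?_⟩
  · ext f; rw [← heq]; simp
  · ext v
    simp only [VS, Set.mem_ofPred_eq]
    rw [← heq, Walk.mem_support_iff_exists_mem_edges]
    simp
    intro h
    exact Or.inl (Or.inl h)

theorem sg_card (σ : Sym2 V → Bool) (C : Finset (Sym2 V)) :
    sg σ C = (({e ∈ (C : Set (Sym2 V)) | σ e = true}.ncard : ℕ) : ZMod 2) := by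
  have : {e ∈ (C : Set (Sym2 V)) | σ e = true} = ((C.filter (fun e => σ e = true) : Finset _) : Set _) := by
    ext e; simp
  rw [this, Set.ncard_coe_finset, sg, Finset.sum_boole]

theorem circ_neg {G : SimpleGraph V} {σ : Sym2 V → Bool} {C : Finset (Sym2 V)} (hC : Circ C)
    (hG : ∀ e ∈ C, e ∈ G.edgeSet) (hs : sg σ C = 1) :
    IsNegCycle G σ (C : Set (Sym2 V)) (VS C) := by
  refine ⟨circ_cycleSet hC hG, ?_⟩
  rw [sg_card] at hs
  exact ZMod.natCast_eq_one_iff_odd.1 hs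

theorem circ_pos {G : SimpleGraph V} {σ : Sym2 V → Bool} {C : Finset (Sym2 V)} (hC : Circ C)
    (hG : ∀ e ∈ C, e ∈ G.edgeSet) (hs : sg σ C = 0) :
    IsSignedCircuit G σ (C : Set (Sym2 V)) := by
  refine Or.inl ⟨⟨_, circ_cycleSet hC hG⟩, ?_⟩
  rw [sg_card] at hs
  exact ZMod.natCast_eq_zero_iff_even.1 hs

theorem circ_not_mem_bridge {E C : Finset (Sym2 V)} (hC : bd C = 0) (h : C ⊆ E) {e : Sym2 V}
    (he : ¬ cyc E e) : e ∉ C := fun h' => he ⟨C, h, h', hC⟩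

theorem barbell {G : SimpleGraph V} {σ : Sym2 V → Bool} {E C₁ C₂ A : Finset (Sym2 V)}
    (hG : ∀ e ∈ E, e ∈ G.edgeSet) (h1 : Circ C₁) (h2 : Circ C₂) (h1E : C₁ ⊆ E) (h2E : C₂ ⊆ E)
    (s1 : sg σ C₁ = 1) (s2 : sg σ C₂ = 1)
    (hss : (VS C₁ ∩ VS C₂).Subsingleton) (hA : A ⊆ E) {x y : V} (hx : x ∈ VS C₁)
    (hy : y ∈ VS C₂) (hb : bd A = dl x + dl y) :
    ∃ D : Finset (Sym2 V), IsSignedCircuit G σ (D : Set (Sym2 V)) ∧ C₁ ⊆ D ∧ C₂ ⊆ D ∧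
      D.card ≤ C₁.card + C₂.card + A.card ∧ ∀ e ∈ A, ¬ cyc E e → e ∈ D := by
  let P : ℕ → Prop := fun n => ∃ (u v : V) (w : G.Walk u v), u ∈ VS C₁ ∧ v ∈ VS C₂ ∧
    (∀ e ∈ w.edges, e ∈ A) ∧ w.length = n
  obtain ⟨w0, hw0, hl0⟩ := walk_of_bd G _ A x y rfl (fun e he => hG e (hA he)) hb
  have hP : ∃ n, P n := ⟨_, x, y, w0, hx, hy, hw0, rfl⟩
  have hle : Nat.find hP ≤ A.card :=
    (Nat.find_min' hP ⟨x, y, w0, hx, hy, hw0, rfl⟩).trans hl0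
  obtain ⟨u, v, w, hu, hv, hw, hwl⟩ := Nat.find_spec hP
  have hmin : ∀ (u' v' : V) (w' : G.Walk u' v'), u' ∈ VS C₁ → v' ∈ VS C₂ →
      (∀ e ∈ w'.edges, e ∈ A) → w.length ≤ w'.length := by
    intro u' v' w' a b c
    rw [hwl]; exact Nat.find_min' hP ⟨u', v', w', a, b, c, rfl⟩
  have hpath := w.bypass_isPath
  have hpE : ∀ e ∈ w.bypass.edges, e ∈ A := fun e he => hw e (w.edges_bypass_subset_edges he)
  have hpl : w.bypass.length ≤ w.length := w.length_bypass_le_length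
  generalize w.bypass = p at hpath hpE hpl
  have hpcard : p.edges.toFinset.card ≤ p.length :=
    (List.toFinset_card_le _).trans (by rw [Walk.length_edges])
  refine ⟨C₁ ∪ C₂ ∪ p.edges.toFinset, ?_, ?_, ?_, ?_, ?_⟩
  · right
    refine ⟨C₁, C₂, ?_⟩
    have n1 := circ_neg (G := G) h1 (fun e he => hG e (h1E he)) s1
    have n2 := circ_neg (G := G) h2 (fun e he => hG e (h2E he)) s2
    by_cases hI : (VS C₁ ∩ VS C₂).Nonempty
    · left
      obtain ⟨z, hz⟩ := hI
      have := hmin z z Walk.nil hz.1 hz.2 (by simp)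
      have hp0 : p.length = 0 := by rw [Walk.length_nil] at this; omega
      have : p.edges = [] := by
        rw [← List.length_eq_zero_iff, Walk.length_edges, hp0]
      refine ⟨VS C₁, VS C₂, n1, n2, ⟨z, ?_⟩, by simp [this]⟩
      exact hss.eq_singleton_of_mem hz
    · right
      refine ⟨VS C₁, VS C₂, u, v, p, n1, n2, ?_, hpath, hu, hv, ?_, ?_, ?_⟩
      · rw [Set.disjoint_iff_inter_eq_empty]; exact Set.not_nonempty_iff_eq_empty.1 hI
      · ext z
        simp only [Set.mem_inter_iff, Set.mem_ofPred_eq, Set.mem_singleton_iff]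
        constructor
        · rintro ⟨hz, hz1⟩
          by_contra hzu
          have := hmin z v (p.dropUntil z hz) hz1 hv
            (fun e he => hpE e (p.edges_dropUntil_subset_edges hz he))
          have := Walk.length_dropUntil_lt_length hz hzu
          omega
        · rintro rfl; exact ⟨p.start_mem_support, hu⟩
      · ext z
        simp only [Set.mem_inter_iff, Set.mem_ofPred_eq, Set.mem_singleton_iff]
        constructor
        · rintro ⟨hz, hz1⟩
          by_contra hzu
          have := hmin u z (p.takeUntil z hz) hu hz1
            (fun e he => hpE e (p.edges_takeUntil_subset_edges hz he))
          have := Walk.length_takeUntil_lt_length hz hzu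
          omega
        · rintro rfl; exact ⟨p.end_mem_support, hv⟩
      · ext e; simp [or_assoc]
  · intro e he; simp [he]
  · intro e he; simp [he]
  · have a1 := Finset.card_union_le (C₁ ∪ C₂) p.edges.toFinset
    have a2 := Finset.card_union_le C₁ C₂
    omega
  · intro e heA hbr
    apply Finset.mem_union_right
    induction e with | _ a b =>
    have hcr := side_crosses (hA heA) hbr
    have honly := side_cross_only (K := E) (e := s(a, b)) (z := a)
    set U := side E s(a, b) a
    have k1 : ∀ {C : Finset (Sym2 V)}, Circ C → C ⊆ E → ∀ {x x' : V}, x ∈ VS C → x' ∈ VS C →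
        (x ∈ U ↔ x' ∈ U) := by
      intro C hC hCE x x' hx hx'
      have hnc : ∀ e ∈ C, ¬ Crosses U e := fun e he => honly e (hCE he) (by
        rintro rfl; exact circ_not_mem_bridge hC.2.1 hCE hbr he)
      exact ⟨circ_nocross hC hnc hx hx', circ_nocross hC hnc hx' hx⟩
    have e1 := us_bd_single (J := A) (fun e he => honly e (hA he)) hcr
    rw [hb, us_add, us_dl, us_dl, if_pos heA] at e1
    have hpA : p.edges.toFinset ⊆ A := fun e he => hpE e (by simpa using he)
    have e2 := us_bd_single (J := p.edges.toFinset) (fun e he => honly e (hA (hpA he))) hcr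
    rw [trail_bd p hpath.isTrail, us_add, us_dl, us_dl] at e2
    simp only [k1 h1 h1E hu hx, k1 h2 h2E hv hy] at e2
    rw [e1] at e2
    by_contra hcon
    rw [if_neg hcon] at e2
    exact absurd e2 (by decide)

theorem theta (σ : Sym2 V → Bool) {C₁ C₂ : Finset (Sym2 V)} (h1 : Circ C₁) (h2 : Circ C₂)
    (s1 : sg σ C₁ = 1) (hd : Disjoint C₁ C₂)
    (hss : ¬ (VS C₁ ∩ VS C₂).Subsingleton) :
    ∃ D ⊆ C₁ ∪ C₂, Circ D ∧ sg σ D = 0 := by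
  set Q : Finset (Sym2 V) → Prop := fun A => A ⊆ C₂ ∧ ∃ x y, x ≠ y ∧ x ∈ VS C₁ ∩ VS C₂ ∧
    y ∈ VS C₁ ∩ VS C₂ ∧ bd A = dl x + dl y with hQ
  have hne : (Finset.univ.filter Q).Nonempty := by
    rw [Set.not_subsingleton_iff] at hss
    obtain ⟨x, hx, y, hy, hxy⟩ := hss
    obtain ⟨A, hA, hb⟩ := circ_conn h2 hx.2 hy.2
    exact ⟨A, by simp only [Finset.mem_filter, Finset.mem_univ, true_and]; exact ⟨hA, x, y, hxy, hx, hy, hb⟩⟩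
  obtain ⟨A, hAQ, hmin⟩ := Finset.exists_min_image _ Finset.card hne
  simp only [Finset.mem_filter, Finset.mem_univ, true_and] at hAQ hmin
  obtain ⟨hA, x, y, hxy, hx, hy, hb⟩ := hAQ
  have hdl : (dl x + dl y : V → ZMod 2) ≠ 0 := by
    intro h
    have := congrFun h x
    rw [Pi.add_apply, dl_self, dl_ne hxy, Pi.zero_apply] at this
    exact absurd this (by decide)
  by_contra hcon
  push Not at hcon
  obtain ⟨B, hB, hBb, hBs⟩ : ∃ B ⊆ C₁, bd B = dl x + dl y ∧ sg σ (A ∪ B) = 0 := by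
    obtain ⟨B, hB, hBb⟩ := circ_conn h1 hx.1 hy.1
    have hdB : ∀ B ⊆ C₁, Disjoint A B := fun B hB =>
      (Finset.disjoint_of_subset_left hB (Finset.disjoint_of_subset_right hA hd)).symm
    rcases zt01 (sg σ (A ∪ B)) with h | h
    · exact ⟨B, hB, hBb, h⟩
    · refine ⟨C₁ \ B, Finset.sdiff_subset, by rw [bd_sdiff hB, h1.2.1, hBb, zero_add], ?_⟩
      rw [sg_union σ (hdB _ Finset.sdiff_subset), sg_sdiff σ hB, s1]
      rw [sg_union σ (hdB B hB)] at h
      calc _ = 1 + (sg σ A + sg σ B) := by ring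
        _ = _ := by rw [h]; decide
  have hdAB : Disjoint A B :=
    (Finset.disjoint_of_subset_left hB (Finset.disjoint_of_subset_right hA hd)).symm
  have hZb : bd (A ∪ B) = 0 := by rw [bd_union hdAB, hb, hBb, ztf]
  have hZsub : A ∪ B ⊆ C₁ ∪ C₂ :=
    Finset.union_subset (hA.trans Finset.subset_union_right) (hB.trans Finset.subset_union_left)
  have hBne : ∀ Z ⊆ B, bd Z = 0 → Z = ∅ := by
    intro Z hZ hZb
    rcases h1.2.2 Z (hZ.trans hB) hZb with h | h
    · exact h
    · exfalso
      have : B = C₁ := Finset.Subset.antisymm hB (h ▸ hZ)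
      rw [this, h1.2.1] at hBb
      exact hdl hBb.symm
  have hAne : A.Nonempty := by
    rw [Finset.nonempty_iff_ne_empty]; rintro rfl
    rw [bd_empty] at hb; exact hdl hb.symm
  obtain ⟨a, ha⟩ := hAne
  obtain ⟨D, hD, haD, hDc⟩ := exists_circ hZb (Finset.mem_union_left B ha)
  have hDne : D ≠ A ∪ B := by
    rintro rfl; exact hcon _ hZsub hDc hBs
  -- the complement
  have hcompl : bd ((A ∪ B) \ D) = 0 := by rw [bd_sdiff hD, hZb, hDc.2.1, zero_add]
  have hnsub : ¬ A ⊆ D := by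
    intro hAD
    have : (A ∪ B) \ D ⊆ B := by
      intro e he
      simp only [Finset.mem_sdiff, Finset.mem_union] at he
      rcases he.1 with h | h
      · exact absurd (hAD h) he.2
      · exact h
    have h0 := hBne _ this hcompl
    rw [Finset.sdiff_eq_empty_iff_subset] at h0
    exact hDne (Finset.Subset.antisymm hD h0)
  have hprop : D ∩ A ⊂ A := by
    rw [Finset.ssubset_iff_subset_ne]
    refine ⟨Finset.inter_subset_right, fun h => hnsub ?_⟩
    rw [← h]; exact Finset.inter_subset_left
  have hDA0 : bd (D ∩ A) ≠ 0 := by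
    intro h0
    rcases h2.2.2 (D ∩ A) (Finset.inter_subset_right.trans hA) h0 with h | h
    · have : a ∈ D ∩ A := by simp [ha, haD]
      rw [h] at this; simp at this
    · exact hprop.2 (h ▸ hA)
  have hsplit : bd (D ∩ A) = bd (D ∩ B) := by
    have e1 : D = (D ∩ A) ∪ (D ∩ B) := by
      rw [← Finset.inter_union_distrib_left]; exact (Finset.inter_eq_left.2 hD).symm
    have hdd : Disjoint (D ∩ A) (D ∩ B) :=
      Finset.disjoint_of_subset_left Finset.inter_subset_right
        (Finset.disjoint_of_subset_right Finset.inter_subset_right hdAB)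
    have e2 := bd_union hdd
    rw [← e1, hDc.2.1] at e2
    have := ztf (bd (D ∩ B))
    rw [← add_zero (bd (D ∩ A)), ← this, ← add_assoc, ← e2, zero_add]
  have hmemS : ∀ v, bd (D ∩ A) v ≠ 0 → v ∈ VS C₁ ∩ VS C₂ := by
    intro v hv
    constructor
    · rw [hsplit] at hv
      obtain ⟨e, he, hve⟩ := exists_mem_of_bd_ne hv
      exact ⟨e, hB (Finset.mem_inter.1 he).2, hve⟩
    · obtain ⟨e, he, hve⟩ := exists_mem_of_bd_ne hv
      exact ⟨e, hA (Finset.mem_inter.1 he).2, hve⟩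
  obtain ⟨x', hx'⟩ : ∃ v, bd (D ∩ A) v ≠ 0 := by
    by_contra hc; push Not at hc; exact hDA0 (funext hc)
  obtain ⟨y', hy', hy0, A', hA', hAb'⟩ := walk_out hx'
  have := hmin A' ⟨(hA'.trans Finset.inter_subset_right).trans hA, x', y', hy'.symm,
    hmemS _ hx', hmemS _ hy0, hAb'⟩
  have l1 := Finset.card_le_card hA'
  have l2 := Finset.card_lt_card hprop
  omega

structure Dec (σ : Sym2 V → Bool) (Z : Finset (Sym2 V)) (P N : Finset (Finset (Sym2 V))) : Prop where
  circ : ∀ C ∈ P ∪ N, Circ C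
  pos : ∀ C ∈ P, sg σ C = 0
  neg : ∀ C ∈ N, sg σ C = 1
  disj : ∀ C ∈ P ∪ N, ∀ C' ∈ P ∪ N, C ≠ C' → Disjoint C C'
  ss : ∀ C ∈ N, ∀ C' ∈ N, C ≠ C' → (VS C ∩ VS C').Subsingleton
  un : (P ∪ N).biUnion id = Z

theorem Dec.sub {σ : Sym2 V → Bool} {Z : Finset (Sym2 V)} {P N : Finset (Finset (Sym2 V))}
    (h : Dec σ Z P N) {C : Finset (Sym2 V)} (hC : C ∈ P ∪ N) : C ⊆ Z := by
  rw [← h.un]; exact Finset.subset_biUnion_of_mem id hC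

theorem dec_exists (σ : Sym2 V → Bool) : ∀ (n : ℕ) (Z : Finset (Sym2 V)), Z.card = n → bd Z = 0 →
    ∃ P N, Dec σ Z P N := by
  intro n
  induction n using Nat.strong_induction_on with | _ n ih =>
  intro Z hn hZ
  rcases Z.eq_empty_or_nonempty with rfl | ⟨e, he⟩
  · exact ⟨∅, ∅, by constructor <;> simp⟩
  have step : ∀ C ⊆ Z, Circ C → ∃ P N, Dec σ (Z \ C) P N := by
    intro C hC hCc
    have h1 := Finset.card_sdiff_add_card_eq_card hC
    have h2 := Finset.card_pos.2 hCc.1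
    exact ih _ (by omega) (Z \ C) rfl (by rw [bd_sdiff hC, hZ, hCc.2.1, zero_add])
  have hdj : ∀ {C D : Finset (Sym2 V)}, D ⊆ Z \ C → Disjoint D C := by
    intro C D h
    exact Finset.disjoint_of_subset_left h Finset.sdiff_disjoint
  by_cases hp : ∃ C ⊆ Z, Circ C ∧ sg σ C = 0
  · obtain ⟨C, hC, hCc, hs⟩ := hp
    obtain ⟨P, N, h⟩ := step C hC hCc
    refine ⟨insert C P, N, ?_, ?_, h.neg, ?_, h.ss, ?_⟩
    · intro D hD
      rw [Finset.insert_union, Finset.mem_insert] at hD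
      rcases hD with rfl | hD
      · exact hCc
      · exact h.circ D hD
    · intro D hD
      rw [Finset.mem_insert] at hD
      rcases hD with rfl | hD
      · exact hs
      · exact h.pos D hD
    · intro D hD D' hD' hne
      rw [Finset.insert_union, Finset.mem_insert] at hD hD'
      rcases hD with rfl | hD <;> rcases hD' with rfl | hD'
      · exact absurd rfl hne
      · exact (hdj (h.sub hD')).symm
      · exact hdj (h.sub hD)
      · exact h.disj D hD D' hD' hne
    · rw [Finset.insert_union, Finset.biUnion_insert, h.un]
      exact Finset.union_sdiff_of_subset hC
  · push Not at hp
    obtain ⟨C, hC, _, hCc⟩ := exists_circ hZ he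
    have hs : sg σ C = 1 := zt1 (hp C hC hCc)
    obtain ⟨P, N, h⟩ := step C hC hCc
    have hPs : ∀ D ∈ P ∪ N, D ⊆ Z := fun D hD => (h.sub hD).trans Finset.sdiff_subset
    have key : ∀ D ∈ N, (VS C ∩ VS D).Subsingleton := by
      intro D hD
      by_contra hcon
      have hD' : D ∈ P ∪ N := Finset.mem_union_right _ hD
      obtain ⟨D0, hD0, hc, hs0⟩ := theta σ hCc (h.circ D hD') hs (hdj (h.sub hD')).symm hcon
      exact hp D0 (hD0.trans (Finset.union_subset hC (hPs D hD'))) hc hs0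
    refine ⟨P, insert C N, ?_, h.pos, ?_, ?_, ?_, ?_⟩
    · intro D hD
      rw [Finset.union_insert, Finset.mem_insert] at hD
      rcases hD with rfl | hD
      · exact hCc
      · exact h.circ D hD
    · intro D hD
      rw [Finset.mem_insert] at hD
      rcases hD with rfl | hD
      · exact hs
      · exact h.neg D hD
    · intro D hD D' hD' hne
      rw [Finset.union_insert, Finset.mem_insert] at hD hD'
      rcases hD with rfl | hD <;> rcases hD' with rfl | hD'
      · exact absurd rfl hne
      · exact (hdj (h.sub hD')).symm
      · exact hdj (h.sub hD)
      · exact h.disj D hD D' hD' hne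
    · intro D hD D' hD' hne
      rw [Finset.mem_insert] at hD hD'
      rcases hD with rfl | hD <;> rcases hD' with rfl | hD'
      · exact absurd rfl hne
      · exact key _ hD'
      · rw [Set.inter_comm]; exact key _ hD
      · exact h.ss D hD D' hD' hne
    · rw [Finset.union_insert, Finset.biUnion_insert, h.un]
      exact Finset.union_sdiff_of_subset hC

theorem dec_exists' (σ : Sym2 V → Bool) {Z : Finset (Sym2 V)} (h : bd Z = 0) :
    ∃ P N, Dec σ Z P N := dec_exists σ _ Z rfl h

theorem Dec.pn {σ : Sym2 V → Bool} {Z : Finset (Sym2 V)} {P N : Finset (Finset (Sym2 V))}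
    (h : Dec σ Z P N) : Disjoint P N := by
  rw [Finset.disjoint_left]
  intro C h1 h2
  have a := h.pos C h1
  have b := h.neg C h2
  rw [a] at b; exact absurd b (by decide)

theorem Dec.sum {M : Type*} [AddCommMonoid M] {σ : Sym2 V → Bool} {Z : Finset (Sym2 V)}
    {P N : Finset (Finset (Sym2 V))} (h : Dec σ Z P N) (f : Sym2 V → M) :
    ∑ e ∈ Z, f e = ∑ C ∈ P, ∑ e ∈ C, f e + ∑ C ∈ N, ∑ e ∈ C, f e := by
  rw [← Finset.sum_union h.pn, ← h.un, Finset.sum_biUnion]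
  · rfl
  · intro C hC C' hC' hne
    exact h.disj C hC C' hC' hne

theorem Dec.card {σ : Sym2 V → Bool} {Z : Finset (Sym2 V)}
    {P N : Finset (Finset (Sym2 V))} (h : Dec σ Z P N) :
    Z.card = ∑ C ∈ P, C.card + ∑ C ∈ N, C.card := by
  have := h.sum (fun _ => (1 : ℕ))
  simpa using this

theorem Dec.sgn {σ : Sym2 V → Bool} {Z : Finset (Sym2 V)}
    {P N : Finset (Finset (Sym2 V))} (h : Dec σ Z P N) :
    sg σ Z = (N.card : ZMod 2) := by
  have h1 := h.sum (fun e => if σ e = true then (1 : ZMod 2) else 0)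
  have h2 : sg σ Z = ∑ C ∈ P, sg σ C + ∑ C ∈ N, sg σ C := h1
  rw [h2, Finset.sum_eq_zero h.pos, Finset.sum_congr rfl h.neg, zero_add]
  simp

end Circs


section Signs
open Classical
variable [Fintype V]

theorem exists_root (K : Finset (Sym2 V)) :
    ∃ r : V → V, (∀ x, conn K x (r x)) ∧ ∀ x y, conn K x y → r x = r y := by
  refine ⟨fun x => @Classical.epsilon V ⟨x⟩ (conn K x), ?_, ?_⟩
  · intro x
    exact Classical.epsilon_spec (p := conn K x) ⟨x, conn_refl K x⟩
  · intro x y h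
    have : conn K x = conn K y := by
      funext z
      exact propext ⟨fun h' => conn_trans (conn_symm h) h', fun h' => conn_trans h h'⟩
    simp only [this]

theorem harary (σ : Sym2 V → Bool) (K : Finset (Sym2 V))
    (h : ∀ Z ⊆ K, bd Z = 0 → sg σ Z = 0) :
    ∃ U : Set V, ∀ e ∈ K, (σ e = true ↔ Crosses U e) := by
  obtain ⟨r, hr, hrr⟩ := exists_root K
  choose A hA hb using hr
  refine ⟨{x | sg σ (A x) = 1}, ?_⟩
  intro e he
  induction e with | _ x y =>
  have hxy : conn K x y := conn_edge he
  have h1 : bd (symmDiff (symmDiff (A x) (A y)) {s(x, y)}) = 0 := by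
    rw [bd_symm, bd_symm, hb, hb, bd_single, hrr x y hxy]
    have e1 := ztf (dl x); have e2 := ztf (dl y); have e3 := ztf (dl (r y))
    calc _ = (dl x + dl x) + (dl y + dl y) + (dl (r y) + dl (r y)) := by abel
      _ = 0 := by rw [e1, e2, e3]; simp
  have h2 := h _ (symm_sub (symm_sub (hA x) (hA y)) (by simpa using he)) h1
  rw [sg_symm, sg_symm] at h2
  have h3 : sg σ {s(x, y)} = if σ s(x, y) = true then 1 else 0 := by rw [sg, Finset.sum_singleton]
  rw [h3] at h2
  rw [crosses_mk]
  simp only [Set.mem_ofPred_eq]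
  rcases zt01 (sg σ (A x)) with hx | hx <;> rcases zt01 (sg σ (A y)) with hy | hy <;>
    rw [hx, hy] at h2 ⊢ <;> by_cases hs : σ s(x, y) = true <;> simp [hs] at h2 ⊢ <;>
    exact absurd h2 (by decide)

/-- minimality under switching -/
def Hmin (σ : Sym2 V → Bool) (K : Finset (Sym2 V)) : Prop :=
  ∀ U : Set V, (K.filter (fun e => σ e = true ∧ Crosses U e)).card ≤
    (K.filter (fun e => σ e = false ∧ Crosses U e)).card

noncomputable def negs (σ : Sym2 V → Bool) (K : Finset (Sym2 V)) : Finset (Sym2 V) :=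
  K.filter (fun e => σ e = true)
noncomputable def poss (σ : Sym2 V → Bool) (K : Finset (Sym2 V)) : Finset (Sym2 V) :=
  K.filter (fun e => σ e = false)

theorem avoid {σ : Sym2 V → Bool} {K : Finset (Sym2 V)} (hm : Hmin σ K)
    (hn : 2 ≤ (negs σ K).card) (g : Sym2 V) :
    ∃ Z ⊆ K.erase g, bd Z = 0 ∧ sg σ Z = 1 := by
  by_contra hcon
  push Not at hcon
  obtain ⟨U, hU⟩ := harary σ (K.erase g) (fun Z hZ hb => by
    by_contra h; exact hcon Z hZ hb (zt1 h))
  have hmU := hm U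
  by_cases hs : σ g = true
  · have h1 : (K.filter (fun e => σ e = false ∧ Crosses U e)) = ∅ := by
      rw [Finset.filter_eq_empty_iff]
      rintro e he ⟨h1, h2⟩
      have hne : e ≠ g := by rintro rfl; simp [hs] at h1
      have := (hU e (Finset.mem_erase.2 ⟨hne, he⟩)).2 h2
      simp [h1] at this
    have h2 : (negs σ K).erase g ⊆ (K.filter (fun e => σ e = true ∧ Crosses U e)) := by
      intro e he
      rw [Finset.mem_erase, negs, Finset.mem_filter] at he
      rw [Finset.mem_filter]
      exact ⟨he.2.1, he.2.2, (hU e (Finset.mem_erase.2 ⟨he.1, he.2.1⟩)).1 he.2.2⟩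
    have h3 := Finset.card_le_card h2
    have h4 := Finset.pred_card_le_card_erase (s := negs σ K) (a := g)
    rw [h1, Finset.card_empty] at hmU
    omega
  · have h1 : (K.filter (fun e => σ e = false ∧ Crosses U e)) ⊆ {g} := by
      intro e he
      rw [Finset.mem_filter] at he
      by_contra hne
      rw [Finset.mem_singleton] at hne
      have := (hU e (Finset.mem_erase.2 ⟨hne, he.1⟩)).2 he.2.2
      simp [he.2.1] at this
    have h2 : negs σ K ⊆ (K.filter (fun e => σ e = true ∧ Crosses U e)) := by
      intro e he
      rw [negs, Finset.mem_filter] at he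
      rw [Finset.mem_filter]
      have hne : e ≠ g := by rintro rfl; exact hs he.2
      exact ⟨he.1, he.2, (hU e (Finset.mem_erase.2 ⟨hne, he.1⟩)).1 he.2⟩
    have h3 := Finset.card_le_card h2
    have h4 := Finset.card_le_card h1
    rw [Finset.card_singleton] at h4
    omega

theorem evencyc {σ : Sym2 V → Bool} {K : Finset (Sym2 V)} (hm : Hmin σ K)
    (hn : 2 ≤ (negs σ K).card) {g : Sym2 V} (hg : cyc K g) :
    ∃ Z ⊆ K, g ∈ Z ∧ bd Z = 0 ∧ sg σ Z = 0 := by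
  obtain ⟨Z, hZ, hgZ, hb⟩ := hg
  rcases zt01 (sg σ Z) with h | h
  · exact ⟨Z, hZ, hgZ, hb, h⟩
  obtain ⟨Z', hZ', hb', hs'⟩ := avoid hm hn g
  refine ⟨symmDiff Z Z', symm_sub hZ (hZ'.trans (Finset.erase_subset _ _)), ?_, ?_, ?_⟩
  · rw [Finset.mem_symmDiff]
    exact Or.inl ⟨hgZ, fun h => by simpa using hZ' h⟩
  · rw [bd_symm, hb, hb', add_zero]
  · rw [sg_symm, h, hs']; decide

theorem dec_neg {σ : Sym2 V → Bool} {Z : Finset (Sym2 V)} (hb : bd Z = 0) (hs : sg σ Z = 1) :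
    ∃ C ⊆ Z, Circ C ∧ sg σ C = 1 := by
  obtain ⟨P, N, h⟩ := dec_exists' σ hb
  have h1 := h.sgn
  rw [hs] at h1
  have : N.Nonempty := by
    rw [Finset.nonempty_iff_ne_empty]; rintro rfl; simp at h1
  obtain ⟨C, hC⟩ := this
  have hC' : C ∈ P ∪ N := Finset.mem_union_right _ hC
  exact ⟨C, h.sub hC', h.circ C hC', h.neg C hC⟩

theorem short_odd {σ : Sym2 V → Bool} {K : Finset (Sym2 V)} (hm : Hmin σ K)
    (hn : 2 ≤ (negs σ K).card) (hc : ∀ e ∈ K, cyc K e) :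
    ∃ C ⊆ K, Circ C ∧ sg σ C = 1 ∧ 2 * C.card ≤ K.card := by
  have h2 : ∀ m : (V → ZMod 2) × ZMod 2, m + m = 0 := by
    rintro ⟨a, b⟩; simp only [Prod.mk_add_mk, ztf, zt]; rfl
  have hsum : ∀ J : Finset (Sym2 V),
      ∑ e ∈ J, (inc e, if σ e = true then (1 : ZMod 2) else 0) = (bd J, sg σ J) := by
    intro J
    ext1
    · rw [Prod.fst_sum]; rfl
    · rw [Prod.snd_sum]; rfl
  have hne : (negs σ K).Nonempty := Finset.card_pos.1 (by omega)
  obtain ⟨g, _⟩ := hne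
  obtain ⟨Z0, hZ0, hb0, hs0⟩ := avoid hm hn g
  obtain ⟨J, hJ, hJs, hJc⟩ := averaging h2
    (fun e => (inc e, if σ e = true then (1 : ZMod 2) else 0)) K K subset_rfl (0, 1)
    ⟨Z0, hZ0.trans (Finset.erase_subset _ _), by rw [hsum, hb0, hs0]⟩ (by
      intro e he
      obtain ⟨Z, h1, h2, h3, h4⟩ := evencyc hm hn (hc e he)
      exact ⟨Z, h1, h2, by rw [hsum, h3, h4]; rfl⟩)
  rw [hsum, Prod.mk.injEq] at hJs
  rw [Finset.inter_eq_left.2 hJ] at hJc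
  obtain ⟨C, hC, h3, h4⟩ := dec_neg hJs.1 hJs.2
  refine ⟨C, hC.trans hJ, h3, h4, ?_⟩
  have := Finset.card_le_card hC
  omega

theorem qpath {K W : Finset (Sym2 V)} (hc : ∀ e ∈ K, cyc K e) (Y Z : Set V) (hW : W ⊆ K)
    (hWY : ∀ e ∈ W, (∀ x ∈ e, x ∈ Y) ∨ (∀ x ∈ e, x ∈ Z))
    (hcon : ∃ y ∈ Y, ∃ z ∈ Z, conn K y z) :
    ∃ y ∈ Y, ∃ z ∈ Z, ∃ A ⊆ K, bd A = dl y + dl z ∧ 2 * A.card + W.card ≤ K.card := by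
  have hWK := Finset.card_le_card hW
  by_cases hYZ : (Y ∩ Z).Nonempty
  · obtain ⟨y, hy⟩ := hYZ
    exact ⟨y, hy.1, y, hy.2, ∅, by simp, by rw [ztf]; simp, by simpa using hWK⟩
  have hdis : ∀ x, x ∈ Y → x ∉ Z := fun x h1 h2 => hYZ ⟨x, h1, h2⟩
  obtain ⟨y0, hy0, z0, hz0, J0, hJ0, hJb⟩ := hcon
  have h2 : ∀ m : ZMod 2 × (V → ZMod 2), m + m = 0 := by
    rintro ⟨a, b⟩; simp only [Prod.mk_add_mk, ztf, zt]; rfl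
  set c : Sym2 V → ZMod 2 × (V → ZMod 2) :=
    fun e => (cr Y e, fun v => if v ∈ Y ∪ Z then 0 else inc e v) with hcdef
  have hsum : ∀ J : Finset (Sym2 V),
      ∑ e ∈ J, c e = (us Y (bd J), fun v => if v ∈ Y ∪ Z then 0 else bd J v) := by
    intro J
    ext1
    · rw [Prod.fst_sum, us_bd]
    · rw [Prod.snd_sum]
      funext v
      rw [Finset.sum_apply]
      simp only [hcdef]
      split_ifs with hv
      · simp
      · rw [bd, Finset.sum_apply]
  have hcW : ∀ e ∈ W, c e = 0 := by
    intro e he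
    simp only [hcdef]
    have hcr : ¬ Crosses Y e := by
      rintro ⟨a, b, rfl, ha, hb⟩
      rcases hWY _ he with h | h
      · exact hb (h b (by simp))
      · exact hdis a ha (h a (by simp))
    have h3 : (fun v => if v ∈ Y ∪ Z then 0 else inc e v) = (0 : V → ZMod 2) := by
      funext v
      split_ifs with hv
      · rfl
      · apply inc_eq_zero
        intro hve
        rcases hWY e he with h | h
        · exact hv (Or.inl (h v hve))
        · exact hv (Or.inr (h v hve))
    rw [h3, cr, if_neg hcr]; rfl
  have hsd : ∀ J : Finset (Sym2 V), ∑ e ∈ J \ W, c e = ∑ e ∈ J, c e := by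
    intro J
    rw [← Finset.sum_inter_add_sum_sdiff J W]
    rw [Finset.sum_eq_zero (s := J ∩ W) (fun e he => hcW e (Finset.mem_inter.1 he).2), zero_add]
  obtain ⟨J, hJ, hJs, hJc⟩ := averaging h2 c (K \ W) (K \ W) subset_rfl (1, 0)
    ⟨J0 \ W, Finset.sdiff_subset_sdiff hJ0 subset_rfl, by
      rw [hsd, hsum, hJb, us_add, us_dl, us_dl, if_pos hy0, if_neg (fun h => hdis _ h hz0)]
      congr 1
      funext v
      split_ifs with hv
      · rfl
      · rw [Pi.add_apply, dl_ne, dl_ne]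
        · rfl
        · rintro rfl; exact hv (Or.inr hz0)
        · rintro rfl; exact hv (Or.inl hy0)⟩ (by
      intro e he
      rw [Finset.mem_sdiff] at he
      obtain ⟨Z', h1, h2, h3⟩ := hc e he.1
      refine ⟨Z' \ W, Finset.sdiff_subset_sdiff h1 subset_rfl, Finset.mem_sdiff.2 ⟨h2, he.2⟩, ?_⟩
      rw [hsd, hsum, h3]
      ext1
      · simp [us]
      · funext v; simp)
  rw [hsum, Prod.mk.injEq] at hJs
  rw [Finset.inter_eq_left.2 hJ] at hJc
  have hcard := Finset.card_sdiff_add_card_eq_card hW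
  set U : Set V := {v | ∃ y ∈ Y, conn J y v} with hU
  have hUn : ∀ e ∈ J, ¬ Crosses U e := by
    rintro e he ⟨a, b, rfl, ⟨y, hy, ha⟩, hb⟩
    exact hb ⟨y, hy, conn_trans ha (conn_edge he)⟩
  have hus := us_bd_nocross hUn
  have hYU : Y ⊆ U := fun y hy => ⟨y, hy, conn_refl J y⟩
  have hsplit : us U (bd J) = us Y (bd J) + us (U \ Y) (bd J) := by
    unfold us
    rw [← Finset.sum_add_distrib]
    apply Finset.sum_congr rfl
    intro v _
    by_cases h1 : v ∈ Y
    · simp [h1, hYU h1]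
    · by_cases h2 : v ∈ U <;> simp [h1, h2]
  rw [hus, hJs.1] at hsplit
  have hne : us (U \ Y) (bd J) ≠ 0 := by
    intro h; rw [h] at hsplit; exact absurd hsplit (by decide)
  obtain ⟨z, hz, hz0'⟩ := us_exists hne
  have hzZ : z ∈ Z := by
    by_contra hzn
    have := congrFun hJs.2 z
    have hzz : z ∉ Y ∪ Z := fun h => h.elim hz.2 hzn
    simp only [hzz, if_false] at this
    exact hz0' this
  obtain ⟨⟨y, hy, A, hA, hAb⟩, _⟩ := hz
  refine ⟨y, hy, z, hzZ, A, (hA.trans hJ).trans Finset.sdiff_subset, hAb, ?_⟩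
  have := Finset.card_le_card hA
  omega

theorem pos_join {σ : Sym2 V → Bool} {E X : Finset (Sym2 V)} (hm : Hmin σ E) (hX : X ⊆ negs σ E) :
    ∃ J ⊆ poss σ E, bd J = bd X ∧
      2 * J.card + ((poss σ E).filter (cyc (poss σ E))).card ≤ 2 * (poss σ E).card := by
  set Q := poss σ E with hQ
  set D := Q.filter (cyc Q) with hD
  obtain ⟨J0, hJ0, hb0⟩ := tjoin' Q (bd X) (by
    intro x
    apply us_bd_nocross
    intro e he hcr
    have h1 := hm (comp Q x)
    have h2 : (E.filter (fun e => σ e = false ∧ Crosses (comp Q x) e)) = ∅ := by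
      rw [Finset.filter_eq_empty_iff]
      rintro f hf ⟨h3, h4⟩
      exact comp_nocross Q x f (Finset.mem_filter.2 ⟨hf, h3⟩) h4
    rw [h2, Finset.card_empty, Nat.le_zero, Finset.card_eq_zero, Finset.filter_eq_empty_iff] at h1
    have h5 := Finset.mem_filter.1 (hX he)
    exact h1 h5.1 ⟨h5.2, hcr⟩)
  obtain ⟨J, hJ, hJs, hJc⟩ := averaging ztf inc Q D (Finset.filter_subset _ _) (bd X)
    ⟨J0, hJ0, hb0⟩ (by
      intro e he
      exact (Finset.mem_filter.1 he).2)
  refine ⟨J, hJ, hJs, ?_⟩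
  have h1 : (J ∩ D).card + (J \ D).card = J.card := Finset.card_inter_add_card_sdiff J D
  have h2 : (J \ D).card ≤ (Q \ D).card :=
    Finset.card_le_card (Finset.sdiff_subset_sdiff hJ subset_rfl)
  have h3 := Finset.card_sdiff_add_card_eq_card (Finset.filter_subset (cyc Q) Q)
  change (Q \ D).card + D.card = Q.card at h3
  omega

theorem pos_bridge {σ : Sym2 V → Bool} {E : Finset (Sym2 V)} (hm : Hmin σ E) {f : Sym2 V}
    (hf : f ∈ poss σ E) (hb : ¬ cyc (poss σ E) f) :
    ¬ cyc E f ∨ ∃ g ∈ negs σ E, ∀ Z ⊆ E, bd Z = 0 → g ∈ Z → f ∈ Z := by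
  induction f with | _ a b =>
  have hcr := side_crosses hf hb
  have honly := side_cross_only (K := poss σ E) (e := s(a, b)) (z := a)
  set U := side (poss σ E) s(a, b) a
  have h1 := hm U
  have h2 : (E.filter (fun e => σ e = false ∧ Crosses U e)) ⊆ {s(a, b)} := by
    intro e he
    rw [Finset.mem_filter] at he
    by_contra hne
    rw [Finset.mem_singleton] at hne
    exact honly e (Finset.mem_filter.2 ⟨he.1, he.2.1⟩) hne he.2.2
  have h3 := Finset.card_le_card h2
  rw [Finset.card_singleton] at h3
  have h4 := h1.trans h3
  rw [Finset.card_le_one] at h4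
  have hpos : ∀ e ∈ E, Crosses U e → σ e ≠ true → e = s(a, b) := by
    intro e he hc hs
    by_contra hne
    exact honly e (Finset.mem_filter.2 ⟨he, by simpa using hs⟩) hne hc
  by_cases hex : ∃ g ∈ E, σ g = true ∧ Crosses U g
  · right
    obtain ⟨g, hg, hgs, hgc⟩ := hex
    refine ⟨g, Finset.mem_filter.2 ⟨hg, hgs⟩, ?_⟩
    intro Z hZ hZb hgZ
    by_contra hfZ
    refine even_cross (K := Z) subset_rfl hZb (f := g) (U := U) ?_ hgc hgZ
    intro e he hne hc
    by_cases hs : σ e = true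
    · exact hne (h4 e (Finset.mem_filter.2 ⟨hZ he, hs, hc⟩) g (Finset.mem_filter.2 ⟨hg, hgs, hgc⟩))
    · exact hfZ (hpos e (hZ he) hc hs ▸ he)
  · left
    push Not at hex
    refine not_cyc_of_cross (U := U) ?_ hcr
    intro e he hne hc
    exact hne (hpos e he hc (fun hs => hex e he hs hc))

end Signs


section CaseA
open Classical
variable [Fintype V]

/-- `S` can be covered by signed circuits of total length at most `n` -/
def Cov (G : SimpleGraph V) (σ : Sym2 V → Bool) (S : Finset (Sym2 V)) (n : ℕ) : Prop :=
  ∃ F : Multiset (Finset (Sym2 V)), (∀ D ∈ F, IsSignedCircuit G σ (D : Set (Sym2 V))) ∧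
    (∀ e ∈ S, ∃ D ∈ F, e ∈ D) ∧ (F.map Finset.card).sum ≤ n

theorem Cov.add {G : SimpleGraph V} {σ : Sym2 V → Bool} {S S' : Finset (Sym2 V)} {n n' : ℕ}
    (h : Cov G σ S n) (h' : Cov G σ S' n') : Cov G σ (S ∪ S') (n + n') := by
  obtain ⟨F, h1, h2, h3⟩ := h
  obtain ⟨F', h1', h2', h3'⟩ := h'
  refine ⟨F + F', ?_, ?_, ?_⟩
  · intro D hD
    rcases Multiset.mem_add.1 hD with hD | hD
    exacts [h1 D hD, h1' D hD]
  · intro e he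
    rcases Finset.mem_union.1 he with he | he
    · obtain ⟨D, hD, hh⟩ := h2 e he
      exact ⟨D, Multiset.mem_add.2 (Or.inl hD), hh⟩
    · obtain ⟨D, hD, hh⟩ := h2' e he
      exact ⟨D, Multiset.mem_add.2 (Or.inr hD), hh⟩
  · rw [Multiset.map_add, Multiset.sum_add]; omega

theorem Cov.mono {G : SimpleGraph V} {σ : Sym2 V → Bool} {S S' : Finset (Sym2 V)} {n n' : ℕ}
    (h : Cov G σ S n) (hS : S' ⊆ S) (hn : n ≤ n') : Cov G σ S' n' := by
  obtain ⟨F, h1, h2, h3⟩ := h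
  exact ⟨F, h1, fun e he => h2 e (hS he), h3.trans hn⟩

theorem Cov.single {G : SimpleGraph V} {σ : Sym2 V → Bool} {D : Finset (Sym2 V)}
    (h : IsSignedCircuit G σ (D : Set (Sym2 V))) : Cov G σ D D.card :=
  ⟨{D}, by simpa using h, by simp, by simp⟩

theorem Cov.finset {G : SimpleGraph V} {σ : Sym2 V → Bool} (P : Finset (Finset (Sym2 V)))
    (h : ∀ D ∈ P, IsSignedCircuit G σ (D : Set (Sym2 V))) :
    Cov G σ (P.biUnion id) (∑ C ∈ P, C.card) :=
  ⟨P.val, h, by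
    intro e he
    rw [Finset.mem_biUnion] at he
    exact he, le_refl _⟩

theorem Dec.cov {G : SimpleGraph V} {σ : Sym2 V → Bool} {Z : Finset (Sym2 V)}
    {P N : Finset (Finset (Sym2 V))} (h : Dec σ Z P N) (hG : ∀ e ∈ Z, e ∈ G.edgeSet) :
    Cov G σ (P.biUnion id) (∑ C ∈ P, C.card) := by
  apply Cov.finset
  intro D hD
  have hD' := Finset.mem_union_left N hD
  exact circ_pos (h.circ D hD') (fun e he => hG e (h.sub hD' he)) (h.pos D hD)

theorem ev_cov {G : SimpleGraph V} {σ : Sym2 V → Bool} {Z : Finset (Sym2 V)}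
    (hG : ∀ e ∈ Z, e ∈ G.edgeSet) (hb : bd Z = 0) (hs : sg σ Z = 0) :
    Cov G σ Z Z.card ∨ ∃ Q₁ Q₂, Q₁ ⊆ Z ∧ Q₂ ⊆ Z ∧ Circ Q₁ ∧ Circ Q₂ ∧ sg σ Q₁ = 1 ∧ sg σ Q₂ = 1 ∧
      Q₁ ≠ Q₂ ∧ Disjoint Q₁ Q₂ ∧ (VS Q₁ ∩ VS Q₂).Subsingleton := by
  obtain ⟨P, N, h⟩ := dec_exists' σ hb
  by_cases hN : N = ∅
  · left
    subst hN
    refine (h.cov hG).mono ?_ ?_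
    · intro e he
      rw [← h.un] at he
      simpa using he
    · rw [h.card]; simp
  · right
    have h1 := h.sgn
    rw [hs] at h1
    have h2 : Even N.card := (ZMod.natCast_eq_zero_iff_even).1 h1.symm
    have h3 : 0 < N.card := Finset.card_pos.2 (Finset.nonempty_iff_ne_empty.2 hN)
    have h4 : 1 < N.card := by
      obtain ⟨k, hk⟩ := h2; omega
    obtain ⟨a, b, ha, hb', hab⟩ := Finset.one_lt_card_iff.1 h4
    have ha' := Finset.mem_union_right P ha
    have hb'' := Finset.mem_union_right P hb'
    exact ⟨a, b, h.sub ha', h.sub hb'', h.circ a ha', h.circ b hb'', h.neg a ha, h.neg b hb',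
      hab, h.disj a ha' b hb'' hab, h.ss a ha b hb' hab⟩

theorem circ_VS_nonempty {C : Finset (Sym2 V)} (hC : Circ C) : ∃ x, x ∈ VS C := by
  obtain ⟨e, he⟩ := hC.1
  induction e with | _ x y => exact ⟨x, _, he, by simp⟩

theorem VS_mono {C D : Finset (Sym2 V)} (h : C ⊆ D) : VS C ⊆ VS D :=
  fun _ ⟨e, he, hx⟩ => ⟨e, h he, hx⟩

/-- case A(a) : a single negative circuit can be covered cheaply -/
theorem caseAa {G : SimpleGraph V} {σ : Sym2 V → Bool} {E N₀ : Finset (Sym2 V)}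
    (hG : ∀ e ∈ E, e ∈ G.edgeSet) (hcon : ∀ x ∈ VS E, ∀ y ∈ VS E, conn E x y)
    (hcyc : ∀ e ∈ E, cyc E e) (hN : N₀ ⊆ E) (hC : Circ N₀) (hs : sg σ N₀ = 1)
    (hpair : ∃ M₁ M₂, M₁ ⊆ E ∧ M₂ ⊆ E ∧ Circ M₁ ∧ Circ M₂ ∧ sg σ M₁ = 1 ∧ sg σ M₂ = 1 ∧
      M₁ ≠ M₂ ∧ Disjoint M₁ M₂) :
    Cov G σ N₀ (N₀.card + E.card) := by
  by_cases hsm : ∃ M ⊆ E, Circ M ∧ sg σ M = 1 ∧ (VS N₀ ∩ VS M).Subsingleton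
  · obtain ⟨M, hM, hMc, hMs, hss⟩ := hsm
    obtain ⟨x0, hx0⟩ := circ_VS_nonempty hC
    obtain ⟨y0, hy0⟩ := circ_VS_nonempty hMc
    obtain ⟨x, hx, y, hy, A, hA, hAb, hAc⟩ := qpath hcyc (VS N₀) (VS M) hM
      (fun e he => Or.inr (fun x hx => ⟨e, he, hx⟩))
      ⟨x0, hx0, y0, hy0, hcon _ (VS_mono hN hx0) _ (VS_mono hM hy0)⟩
    obtain ⟨D, hD, h1, h2, h3, h4⟩ := barbell hG hC hMc hN hM hs hMs hss hA hx hy hAb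
    exact (Cov.single hD).mono h1 (by omega)
  push Not at hsm
  have hsm' : ∀ Q₁ Q₂ : Finset (Sym2 V), Q₁ ⊆ E → Q₂ ⊆ E → Circ Q₁ → Circ Q₂ → sg σ Q₁ = 1 →
      sg σ Q₂ = 1 → (VS Q₁ ∩ VS Q₂).Subsingleton → Q₁ ≠ N₀ ∧ Q₂ ≠ N₀ := by
    intro Q₁ Q₂ h1 h2 h3 h4 h5 h6 h7
    constructor
    · rintro rfl; exact Set.not_subsingleton_iff.2 (hsm Q₂ h2 h4 h6) h7
    · rintro rfl; rw [Set.inter_comm] at h7; exact Set.not_subsingleton_iff.2 (hsm Q₁ h1 h3 h5) h7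
  by_contra hno
  -- no bad pair at all
  have key : ∀ n : ℕ, ∀ M₁ M₂ : Finset (Sym2 V), (M₁ \ N₀).card + (M₂ \ N₀).card ≤ n →
      M₁ ⊆ E → M₂ ⊆ E → Circ M₁ → Circ M₂ → sg σ M₁ = 1 → sg σ M₂ = 1 → Disjoint M₁ M₂ →
      M₁ ≠ N₀ → M₂ ≠ N₀ → False := by
    intro n
    induction n with
    | zero =>
      intro M₁ M₂ hle _ _ h1 _ _ _ _ hne _
      have : M₁ \ N₀ = ∅ := by rw [← Finset.card_eq_zero]; omega
      rw [Finset.sdiff_eq_empty_iff_subset] at this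
      rcases hC.2.2 M₁ this h1.2.1 with h | h
      · exact h1.1.ne_empty h
      · exact hne h
    | succ n ih =>
      intro M₁ M₂ hle hM₁ hM₂ h1 h2 s1 s2 hd hne₁ hne₂
      have hpos : ∀ M : Finset (Sym2 V), Circ M → M ≠ N₀ → 0 < (M \ N₀).card := by
        intro M hM hne
        rw [Finset.card_pos, Finset.nonempty_iff_ne_empty]
        intro h
        rw [Finset.sdiff_eq_empty_iff_subset] at h
        rcases hC.2.2 M h hM.2.1 with h | h
        · exact hM.1.ne_empty h
        · exact hne h
      have hp1 := hpos M₁ h1 hne₁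
      have hp2 := hpos M₂ h2 hne₂
      have step : ∀ M : Finset (Sym2 V), M ⊆ E → Circ M → sg σ M = 1 → (M \ N₀).card ≤ n →
          Cov G σ (symmDiff N₀ M) (symmDiff N₀ M).card := by
        intro M hM hMc hMs hle
        have hZ : symmDiff N₀ M ⊆ E := symm_sub hN hM
        rcases ev_cov (G := G) (σ := σ) (Z := symmDiff N₀ M) (fun e he => hG e (hZ he))
          (by rw [bd_symm, hC.2.1, hMc.2.1, add_zero])
          (by rw [sg_symm, hs, hMs]; decide) with h | ⟨Q₁, Q₂, q1, q2, c1, c2, t1, t2, hq, hqd, hqs⟩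
        · exact h
        · exfalso
          obtain ⟨e1, e2⟩ := hsm' Q₁ Q₂ (q1.trans hZ) (q2.trans hZ) c1 c2 t1 t2 hqs
          refine ih Q₁ Q₂ ?_ (q1.trans hZ) (q2.trans hZ) c1 c2 t1 t2 hqd e1 e2
          have h5 : (Q₁ \ N₀) ∪ (Q₂ \ N₀) ⊆ M \ N₀ := by
            intro e he
            simp only [Finset.mem_union, Finset.mem_sdiff] at he ⊢
            have : e ∈ symmDiff N₀ M := by
              rcases he with he | he
              exacts [q1 he.1, q2 he.1]
            rw [Finset.mem_symmDiff] at this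
            tauto
          have h6 := Finset.card_le_card h5
          rw [Finset.card_union_of_disjoint (hqd.mono Finset.sdiff_subset Finset.sdiff_subset)] at h6
          omega
      apply hno
      refine ((step M₁ hM₁ h1 s1 (by omega)).add (step M₂ hM₂ h2 s2 (by omega))).mono ?_ ?_
      · intro e he
        simp only [Finset.mem_union, Finset.mem_symmDiff]
        have : e ∉ M₁ ∨ e ∉ M₂ := by
          by_contra hh
          push Not at hh
          exact Finset.disjoint_left.1 hd hh.1 hh.2
        tauto
      · have c1 : ∀ M : Finset (Sym2 V), (symmDiff N₀ M).card ≤ N₀.card + (M \ N₀).card := by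
          intro M
          calc (symmDiff N₀ M).card ≤ (N₀ ∪ (M \ N₀)).card := by
                apply Finset.card_le_card
                intro e he
                simp only [Finset.mem_symmDiff, Finset.mem_union, Finset.mem_sdiff] at he ⊢
                tauto
            _ ≤ _ := Finset.card_union_le _ _
        have c2 : (M₁ \ N₀).card + (M₂ \ N₀).card ≤ (E \ N₀).card := by
          rw [← Finset.card_union_of_disjoint (hd.mono Finset.sdiff_subset Finset.sdiff_subset)]
          apply Finset.card_le_card
          intro e he
          simp only [Finset.mem_union, Finset.mem_sdiff] at he ⊢
          rcases he with he | he
          exacts [⟨hM₁ he.1, he.2⟩, ⟨hM₂ he.1, he.2⟩]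
        have c3 := Finset.card_sdiff_add_card_eq_card hN
        have c4 := c1 M₁
        have c5 := c1 M₂
        omega
  have key' : ∀ M₁ M₂ : Finset (Sym2 V),
      M₁ ⊆ E → M₂ ⊆ E → Circ M₁ → Circ M₂ → sg σ M₁ = 1 → sg σ M₂ = 1 → Disjoint M₁ M₂ →
      M₁ ≠ N₀ → M₂ ≠ N₀ → False := fun M₁ M₂ => key _ M₁ M₂ le_rfl
  have hone : ∀ M : Finset (Sym2 V), M ⊆ E → Circ M → sg σ M = 1 → Disjoint N₀ M → False := by
    intro M hM hMc hMs hd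
    have hZ : N₀ ∪ M ⊆ E := Finset.union_subset hN hM
    rcases ev_cov (G := G) (σ := σ) (Z := N₀ ∪ M) (fun e he => hG e (hZ he))
      (by rw [bd_union hd, hC.2.1, hMc.2.1, add_zero])
      (by rw [sg_union σ hd, hs, hMs]; decide) with h | ⟨Q₁, Q₂, q1, q2, c1, c2, t1, t2, hq, hqd, hqs⟩
    · exact hno (h.mono Finset.subset_union_left (by
        have := Finset.card_le_card hZ; omega))
    · obtain ⟨e1, e2⟩ := hsm' Q₁ Q₂ (q1.trans hZ) (q2.trans hZ) c1 c2 t1 t2 hqs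
      exact key' Q₁ Q₂ (q1.trans hZ) (q2.trans hZ) c1 c2 t1 t2 hqd e1 e2
  obtain ⟨M₁, M₂, hM₁, hM₂, h1, h2, s1, s2, hne, hd⟩ := hpair
  by_cases e1 : M₁ = N₀
  · subst e1; exact hone M₂ hM₂ h2 s2 hd
  by_cases e2 : M₂ = N₀
  · subst e2; exact hone M₁ hM₁ h1 s1 hd.symm
  exact key' M₁ M₂ hM₁ hM₂ h1 h2 s1 s2 hd e1 e2

/-- the edges to be covered -/
noncomputable def target (σ : Sym2 V → Bool) (E : Finset (Sym2 V)) : Finset (Sym2 V) :=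
  E.filter (fun e => ¬ (σ e = false ∧ cyc (poss σ E) e))

theorem target_sub {σ : Sym2 V → Bool} {E S : Finset (Sym2 V)} (hm : Hmin σ E)
    (h1 : ∀ g ∈ negs σ E, ∃ Z ⊆ E, bd Z = 0 ∧ g ∈ Z ∧ Z ⊆ S)
    (h2 : ∀ e ∈ E, ¬ cyc E e → e ∈ S) : target σ E ⊆ S := by
  intro f hf
  rw [target, Finset.mem_filter] at hf
  obtain ⟨hfE, hf⟩ := hf
  by_cases hs : σ f = true
  · obtain ⟨Z, _, _, h, h'⟩ := h1 f (Finset.mem_filter.2 ⟨hfE, hs⟩)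
    exact h' h
  · have hs' : σ f = false := by simpa using hs
    have hc : ¬ cyc (poss σ E) f := fun h => hf ⟨hs', h⟩
    rcases pos_bridge hm (Finset.mem_filter.2 ⟨hfE, hs'⟩) hc with h | ⟨g, hg, h⟩
    · exact h2 f hfE h
    · obtain ⟨Z, hZ, hb, hgZ, hZS⟩ := h1 g hg
      exact hZS (h Z hZ hb hgZ)

/-- what we want per component -/
def Good (G : SimpleGraph V) (σ : Sym2 V → Bool) (E : Finset (Sym2 V)) : Prop :=
  ∃ n, Cov G σ (target σ E) n ∧
    2 * n + ((poss σ E).filter (cyc (poss σ E))).card ≤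
      4 * E.card + 2 * (E.filter (fun e => ¬ cyc E e)).card

theorem negs_poss_card (σ : Sym2 V → Bool) (E : Finset (Sym2 V)) :
    (negs σ E).card + (poss σ E).card = E.card := by
  have h := Finset.card_filter_add_card_filter_not (s := E) (fun e => σ e = true)
  simp only [Bool.not_eq_true] at h
  exact h

theorem negs_poss_disj (σ : Sym2 V → Bool) (E : Finset (Sym2 V)) :
    Disjoint (negs σ E) (poss σ E) := by
  rw [Finset.disjoint_left]
  intro e h1 h2
  have a := (Finset.mem_filter.1 h1).2
  have b := (Finset.mem_filter.1 h2).2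
  simp [a] at b

theorem sg_negs {σ : Sym2 V → Bool} {E X J : Finset (Sym2 V)} (hX : X ⊆ negs σ E)
    (hJ : J ⊆ poss σ E) : sg σ (X ∪ J) = (X.card : ZMod 2) := by
  rw [sg_union σ ((negs_poss_disj σ E).mono hX hJ)]
  have h1 : sg σ X = (X.card : ZMod 2) := by
    rw [sg, Finset.sum_congr rfl (g := fun _ => (1 : ZMod 2))]
    · simp
    · intro e he
      rw [if_pos (Finset.mem_filter.1 (hX he)).2]
  have h2 : sg σ J = 0 := by
    rw [sg]
    apply Finset.sum_eq_zero
    intro e he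
    rw [if_neg]
    have := (Finset.mem_filter.1 (hJ he)).2
    simp [this]
  rw [h1, h2, add_zero]

theorem caseA {G : SimpleGraph V} {σ : Sym2 V → Bool} {E J N₀ : Finset (Sym2 V)}
    {P : Finset (Finset (Sym2 V))}
    (hG : ∀ e ∈ E, e ∈ G.edgeSet) (hcon : ∀ x ∈ VS E, ∀ y ∈ VS E, conn E x y)
    (hm : Hmin σ E) (hn1 : (negs σ E).card ≠ 1) (hcyc : ∀ e ∈ E, cyc E e)
    (hJ : J ⊆ poss σ E) (hJb : bd J = bd (negs σ E))
    (hJc : 2 * J.card + ((poss σ E).filter (cyc (poss σ E))).card ≤ 2 * (poss σ E).card)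
    (hdec : Dec σ (negs σ E ∪ J) P {N₀}) : Good G σ E := by
  have hnE : negs σ E ⊆ E := Finset.filter_subset _ _
  have hpE : poss σ E ⊆ E := Finset.filter_subset _ _
  have hHE : negs σ E ∪ J ⊆ E := Finset.union_subset hnE (hJ.trans hpE)
  have hcard := negs_poss_card σ E
  have hdisj := (negs_poss_disj σ E).mono subset_rfl hJ
  have hHb : bd (negs σ E ∪ J) = 0 := by rw [bd_union hdisj, hJb, ztf]
  have hN : N₀ ∈ P ∪ {N₀} := Finset.mem_union_right _ (Finset.mem_singleton_self _)
  have hN0E := (hdec.sub hN).trans hHE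
  by_cases hpair : ∃ M₁ M₂, M₁ ⊆ E ∧ M₂ ⊆ E ∧ Circ M₁ ∧ Circ M₂ ∧ sg σ M₁ = 1 ∧ sg σ M₂ = 1 ∧
      M₁ ≠ M₂ ∧ Disjoint M₁ M₂
  · have h1 := caseAa hG hcon hcyc hN0E (hdec.circ _ hN) (hdec.neg _ (by simp)) hpair
    have h2 := hdec.cov (fun e he => hG e (hHE he))
    have hc := hdec.card
    rw [Finset.sum_singleton, Finset.card_union_of_disjoint hdisj] at hc
    refine ⟨_, (h2.add h1).mono (target_sub hm ?_ ?_) le_rfl, ?_⟩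
    · intro g hg
      refine ⟨_, hHE, hHb, Finset.mem_union_left _ hg, ?_⟩
      have := hdec.un
      rw [Finset.union_biUnion, Finset.singleton_biUnion] at this
      exact this.symm.subset
    · intro e he h; exact absurd (hcyc e he) h
    · omega
  · have hev : ∀ Z ⊆ E, bd Z = 0 → sg σ Z = 0 → Cov G σ Z Z.card := by
      intro Z hZ hb hs
      rcases ev_cov (G := G) (fun e he => hG e (hZ he)) hb hs with
        h | ⟨Q₁, Q₂, q1, q2, c1, c2, t1, t2, hq, hqd, hqs⟩
      · exact h
      · exact absurd ⟨Q₁, Q₂, q1.trans hZ, q2.trans hZ, c1, c2, t1, t2, hq, hqd⟩ hpair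
    have hodd : ((negs σ E).card : ZMod 2) = 1 := by
      rw [← sg_negs subset_rfl hJ, hdec.sgn]; simp
    have hodd' : Odd (negs σ E).card := (ZMod.natCast_eq_one_iff_odd).1 hodd
    have hn2 : 2 ≤ (negs σ E).card := by
      obtain ⟨k, hk⟩ := hodd'; omega
    obtain ⟨e, he⟩ : (negs σ E).Nonempty := Finset.card_pos.1 (by omega)
    have hXs : (negs σ E).erase e ⊆ negs σ E := Finset.erase_subset _ _
    obtain ⟨J', hJ', hJb', hJc'⟩ := pos_join hm hXs
    have hdisj' := (negs_poss_disj σ E).mono hXs hJ'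
    have hX : ((negs σ E).erase e).card + 1 = (negs σ E).card := Finset.card_erase_add_one he
    have hHE' : (negs σ E).erase e ∪ J' ⊆ E :=
      Finset.union_subset (hXs.trans hnE) (hJ'.trans hpE)
    have hHb' : bd ((negs σ E).erase e ∪ J') = 0 := by rw [bd_union hdisj', hJb', ztf]
    have hHs' : sg σ ((negs σ E).erase e ∪ J') = 0 := by
      rw [sg_negs hXs hJ']
      rw [ZMod.natCast_eq_zero_iff_even]
      obtain ⟨k, hk⟩ := hodd'
      exact ⟨k, by omega⟩
    obtain ⟨Z, hZ, heZ, hZb, hZs⟩ := evencyc hm hn2 (hcyc e (hnE he))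
    refine ⟨_, ((hev _ hHE' hHb' hHs').add (hev Z hZ hZb hZs)).mono (target_sub hm ?_ ?_) le_rfl, ?_⟩
    · intro g hg
      by_cases hge : g = e
      · subst hge
        exact ⟨Z, hZ, hZb, heZ, Finset.subset_union_right⟩
      · exact ⟨_, hHE', hHb', Finset.mem_union_left _ (Finset.mem_erase.2 ⟨hge, hg⟩),
          Finset.subset_union_left⟩
    · intro e he h; exact absurd (hcyc e he) h
    · rw [Finset.card_union_of_disjoint hdisj']
      have := Finset.card_le_card hZ
      omega

end CaseA


section NZ

theorem kl2 (a : ZMod 2 × ZMod 2) : a + a = 0 := by revert a; decide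
theorem kl_ex (b : ZMod 2 × ZMod 2) : ∃ a, a ≠ 0 ∧ a ≠ b := by revert b; decide
theorem kl_add_ne {a b : ZMod 2 × ZMod 2} (h : a ≠ b) : b + a ≠ 0 := by
  revert a b; decide

theorem sep_pair {α : Type*} [DecidableEq α] {X : Finset α} (hX : 2 ≤ X.card)
    {S : Set (Finset α)} (hsub : ∀ A ∈ S, A ⊆ X) (hne : ∀ A ∈ S, A.Nonempty)
    (hc : ∀ A ∈ S, X \ A ∈ S)
    (hcf : ∀ A ∈ S, ∀ B ∈ S, Disjoint A B ∨ A ⊆ B ∨ B ⊆ A ∨ A ∪ B = X) :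
    ∃ t ∈ X, ∃ t' ∈ X, t ≠ t' ∧ ∀ B ∈ S, (t ∈ B ↔ t' ∈ B) ∨ B = {t} ∨ B = {t'} ∨
      X \ B = {t} ∨ X \ B = {t'} := by
  have single : ∀ B ∈ S, B.card < 2 → ∀ t t' : α, t ∈ B ∨ t' ∈ B → B = {t} ∨ B = {t'} := by
    intro B hB hlt t t' h
    have : B.card = 1 := by
      have := Finset.card_pos.2 (hne B hB); omega
    obtain ⟨a, rfl⟩ := Finset.card_eq_one.1 this
    simp only [Finset.mem_singleton] at h
    rcases h with rfl | rfl <;> simp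
  by_cases hbig : ∃ n, ∃ A ∈ S, 2 ≤ A.card ∧ A.card = n
  · classical
    obtain ⟨A, hA, hA2, hAn⟩ := Nat.find_spec hbig
    have hmin := fun m => Nat.find_min hbig (m := m)
    rw [← hAn] at hmin
    have hsmall : ∀ B ∈ S, B ⊆ A → B ≠ A → B.card < 2 := by
      intro B hB hBA hne'
      by_contra hh
      exact hmin B.card (Finset.card_lt_card (hBA.ssubset_of_ne hne')) ⟨B, hB, by omega, rfl⟩
    obtain ⟨t, t', ht, ht', htt⟩ := Finset.one_lt_card_iff.1 hA2
    refine ⟨t, hsub A hA ht, t', hsub A hA ht', htt, ?_⟩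
    intro B hB
    by_cases hiff : t ∈ B ↔ t' ∈ B
    · exact Or.inl hiff
    right
    rcases hcf A hA B hB with h | h | h | h
    · exact absurd (by simp [Finset.disjoint_left.1 h ht, Finset.disjoint_left.1 h ht']) hiff
    · exact absurd (by simp [h ht, h ht']) hiff
    · have := single B hB (hsmall B hB h (by rintro rfl; exact hiff (by simp [ht, ht']))) t t'
        (by tauto)
      tauto
    · have h1 : X \ B ⊆ A := by
        intro x hx
        rw [Finset.mem_sdiff, ← h, Finset.mem_union] at hx
        tauto
      have hXB : ∀ x ∈ X, (x ∈ X \ B ↔ x ∉ B) := fun x hx => by simp [hx]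
      have h2 := hXB t (hsub A hA ht)
      have h3 := hXB t' (hsub A hA ht')
      have := single (X \ B) (hc B hB) (hsmall _ (hc B hB) h1 (by
        intro he; rw [he] at h2 h3; exact hiff (by tauto))) t t' (by tauto)
      tauto
  · push Not at hbig
    obtain ⟨t, t', ht, ht', htt⟩ := Finset.one_lt_card_iff.1 hX
    refine ⟨t, ht, t', ht', htt, ?_⟩
    intro B hB
    by_cases hiff : t ∈ B ↔ t' ∈ B
    · exact Or.inl hiff
    right
    have := single B hB (by
      by_contra hh
      exact hbig B.card B hB (by omega) rfl) t t' (by tauto)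
    tauto

theorem nz {α : Type*} [DecidableEq α] : ∀ (n : ℕ) (X : Finset α) (S : Set (Finset α)),
    X.card = n → n ≠ 1 → (∀ A ∈ S, A ⊆ X) → (∀ A ∈ S, A.Nonempty) →
    (∀ A ∈ S, X \ A ∈ S) →
    (∀ A ∈ S, ∀ B ∈ S, Disjoint A B ∨ A ⊆ B ∨ B ⊆ A ∨ A ∪ B = X) →
    ∃ s : α → ZMod 2 × ZMod 2, (∀ t ∈ X, s t ≠ 0) ∧ ∑ t ∈ X, s t = 0 ∧
      ∀ A ∈ S, ∑ t ∈ A, s t ≠ 0 := by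
  intro n
  induction n with
  | zero =>
    intro X S hX _ hsub hne _ _
    have : X = ∅ := Finset.card_eq_zero.1 hX
    subst this
    refine ⟨0, by simp, by simp, ?_⟩
    intro A hA
    exact absurd (Finset.subset_empty.1 (hsub A hA)) (hne A hA).ne_empty
  | succ n ih =>
    intro X S hX hn1 hsub hne hc hcf
    have hX2 : 2 ≤ X.card := by omega
    obtain ⟨t, ht, t', ht', htt, hsep⟩ := sep_pair hX2 hsub hne hc hcf
    by_cases hn : n = 1
    · subst hn
      have hXe : X = {t, t'} := by
        symm
        apply Finset.eq_of_subset_of_card_le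
        · intro x hx
          simp only [Finset.mem_insert, Finset.mem_singleton] at hx
          rcases hx with rfl | rfl <;> assumption
        · rw [Finset.card_pair htt, hX]
      refine ⟨fun _ => (1, 0), fun _ _ => (by decide : ((1, 0) : ZMod 2 × ZMod 2) ≠ 0), ?_, ?_⟩
      · rw [hXe, Finset.sum_pair htt]; decide
      · intro A hA
        have h1 := hne A hA
        have h2 := hne _ (hc A hA)
        have h3 := hsub A hA
        have h4 : A.card = 1 := by
          have e1 := Finset.card_pos.2 h1
          have e2 := Finset.card_pos.2 h2
          have e3 := Finset.card_sdiff_add_card_eq_card h3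
          omega
        obtain ⟨a, rfl⟩ := Finset.card_eq_one.1 h4
        rw [Finset.sum_singleton]; decide
    · set S' : Set (Finset α) := {B' | ∃ B ∈ S, B ≠ {t} ∧ X \ B ≠ {t} ∧ B' = B.erase t} with hS'
      have hne1 : ∀ B ∈ S, B ≠ {t} → (B.erase t).Nonempty := by
        intro B hB hBt
        rw [Finset.nonempty_iff_ne_empty]
        intro he
        rw [Finset.erase_eq_empty_iff] at he
        rcases he with he | he
        · exact (hne B hB).ne_empty he
        · exact hBt he
      obtain ⟨s, hs0, hsX, hsS⟩ := ih (X.erase t) S'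
        (by rw [Finset.card_erase_of_mem ht, hX]; rfl) hn
        (by
          rintro _ ⟨B, hB, _, _, rfl⟩
          exact Finset.erase_subset_erase t (hsub B hB))
        (by
          rintro _ ⟨B, hB, h1, _, rfl⟩
          exact hne1 B hB h1)
        (by
          rintro _ ⟨B, hB, h1, h2, rfl⟩
          refine ⟨X \ B, hc B hB, h2, ?_, ?_⟩
          · rw [Finset.sdiff_sdiff_eq_self (hsub B hB)]; exact h1
          · ext x; simp only [Finset.mem_sdiff, Finset.mem_erase]; tauto)
        (by
          rintro _ ⟨A, hA, _, _, rfl⟩ _ ⟨B, hB, _, _, rfl⟩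
          rcases hcf A hA B hB with h | h | h | h
          · exact Or.inl (h.mono (Finset.erase_subset _ _) (Finset.erase_subset _ _))
          · exact Or.inr (Or.inl (Finset.erase_subset_erase t h))
          · exact Or.inr (Or.inr (Or.inl (Finset.erase_subset_erase t h)))
          · refine Or.inr (Or.inr (Or.inr ?_))
            rw [← h]
            ext x; simp only [Finset.mem_union, Finset.mem_erase]; tauto)
      obtain ⟨a, ha0, hat⟩ := kl_ex (s t')
      have hst' : s t' ≠ 0 := hs0 t' (Finset.mem_erase.2 ⟨htt.symm, ht'⟩)
      set s' : α → ZMod 2 × ZMod 2 := fun x => if x = t then a else if x = t' then s t' + a else s x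
        with hs'
      have e1 : s' t = a := by simp [hs']
      have e2 : s' t' = s t' + a := by simp [hs', htt.symm]
      have e3 : ∀ x, x ≠ t → x ≠ t' → s' x = s x := by intro x h1 h2; simp [hs', h1, h2]
      -- sums
      have both : ∀ B : Finset α, t ∈ B → t' ∈ B → ∑ x ∈ B, s' x = ∑ x ∈ B.erase t, s x := by
        intro B h1 h2
        have h3 : t' ∈ B.erase t := Finset.mem_erase.2 ⟨htt.symm, h2⟩
        rw [← Finset.add_sum_erase _ _ h1, ← Finset.add_sum_erase _ _ h3,
          ← Finset.add_sum_erase (B.erase t) _ h3, e1, e2]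
        rw [Finset.sum_congr rfl (g := s)]
        · have := kl2 a
          calc _ = (a + a) + (s t' + ∑ x ∈ (B.erase t).erase t', s x) := by abel
            _ = _ := by rw [this, zero_add]
        · intro x hx
          simp only [Finset.mem_erase] at hx
          exact e3 x hx.2.1 hx.1
      have neither : ∀ B : Finset α, t ∉ B → t' ∉ B → ∑ x ∈ B, s' x = ∑ x ∈ B.erase t, s x := by
        intro B h1 h2
        rw [Finset.erase_eq_of_notMem h1]
        apply Finset.sum_congr rfl
        intro x hx
        exact e3 x (by rintro rfl; exact h1 hx) (by rintro rfl; exact h2 hx)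
      have hX0 : ∑ x ∈ X, s' x = 0 := by rw [both X ht ht', hsX]
      have hcompl : ∀ B ∈ S, ∑ x ∈ X \ B, s' x ≠ 0 → ∑ x ∈ B, s' x ≠ 0 := by
        intro B hB h h'
        have := Finset.sum_sdiff (f := s') (hsub B hB)
        rw [h', hX0, add_zero] at this
        exact h this
      have f1 : ∑ x ∈ ({t} : Finset α), s' x ≠ 0 := by rw [Finset.sum_singleton, e1]; exact ha0
      have f2 : ∑ x ∈ ({t'} : Finset α), s' x ≠ 0 := by
        rw [Finset.sum_singleton, e2]; exact kl_add_ne hat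
      refine ⟨s', ?_, hX0, ?_⟩
      · intro x hx
        by_cases h1 : x = t
        · subst h1; rw [e1]; exact ha0
        by_cases h2 : x = t'
        · subst h2; rw [e2]; exact kl_add_ne hat
        rw [e3 x h1 h2]; exact hs0 x (Finset.mem_erase.2 ⟨h1, hx⟩)
      · intro B hB
        by_cases g1 : B = {t}
        · rw [g1]; exact f1
        by_cases g2 : X \ B = {t}
        · apply hcompl B hB; rw [g2]; exact f1
        by_cases g3 : B = {t'}
        · rw [g3]; exact f2
        by_cases g4 : X \ B = {t'}
        · apply hcompl B hB; rw [g4]; exact f2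
        have hmem := hsS (B.erase t) ⟨B, hB, g1, g2, rfl⟩
        rcases hsep B hB with h | h | h | h | h
        · by_cases hB' : t ∈ B
          · rw [both B hB' (h.1 hB')]; exact hmem
          · rw [neither B hB' (fun h' => hB' (h.2 h'))]; exact hmem
        all_goals exact absurd h (by assumption)

end NZ


section CaseBEnd
open Classical
variable [Fintype V]

theorem one_join {G : SimpleGraph V} {σ : Sym2 V → Bool} {E : Finset (Sym2 V)}
    (hG : ∀ e ∈ E, e ∈ G.edgeSet) {T : Finset (Finset (Sym2 V))} {p : Finset (Sym2 V) → V}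
    (hX : ∀ t ∈ T, Circ t ∧ sg σ t = 1 ∧ t ⊆ E ∧ p t ∈ VS t)
    (hss : ∀ t ∈ T, ∀ t' ∈ T, t ≠ t' → (VS t ∩ VS t').Subsingleton)
    {J : Finset (Sym2 V)} (hJ : J ⊆ E) (hb : bd J = ∑ t ∈ T, dl (p t)) :
    Cov G σ (T.biUnion id ∪ J.filter (fun e => ¬ cyc E e)) (∑ t ∈ T, t.card + J.card) := by
  obtain ⟨L, hL, hT, hJL, hw⟩ := pairing p _ T J rfl hb
  have hex : ∀ q : Finset (Sym2 V) × Finset (Sym2 V) × Finset (Sym2 V),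
      ∃ D : Finset (Sym2 V), q ∈ L → IsSignedCircuit G σ (D : Set (Sym2 V)) ∧ q.1 ⊆ D ∧ q.2.1 ⊆ D ∧
      D.card ≤ q.1.card + q.2.1.card + q.2.2.card ∧ ∀ e ∈ q.2.2, ¬ cyc E e → e ∈ D := by
    intro q
    by_cases hq : q ∈ L
    · obtain ⟨h1, h2, h3, h4, h5⟩ := hL q hq
      obtain ⟨c1, s1, e1, v1⟩ := hX _ h2
      obtain ⟨c2, s2, e2, v2⟩ := hX _ h3
      obtain ⟨D, hD⟩ := barbell hG c1 c2 e1 e2 s1 s2 (hss _ h2 _ h3 h1) (h4.trans hJ) v1 v2 h5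
      exact ⟨D, fun _ => hD⟩
    · exact ⟨∅, fun h => absurd h hq⟩
  choose D hD using hex
  refine ⟨((L.map D : List _) : Multiset (Finset (Sym2 V))), ?_, ?_, ?_⟩
  · intro C hC
    rw [Multiset.mem_coe, List.mem_map] at hC
    obtain ⟨q, hq, rfl⟩ := hC
    exact (hD q hq).1
  · intro e he
    rw [Finset.mem_union] at he
    rcases he with he | he
    · rw [Finset.mem_biUnion] at he
      obtain ⟨t, ht, het⟩ := he
      obtain ⟨q, hq, h⟩ := hT t ht
      refine ⟨D q, by rw [Multiset.mem_coe, List.mem_map]; exact ⟨q, hq, rfl⟩, ?_⟩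
      rcases h with rfl | rfl
      · exact (hD q hq).2.1 het
      · exact (hD q hq).2.2.1 het
    · rw [Finset.mem_filter] at he
      rcases hJL e he.1 with ⟨q, hq, h⟩ | h
      · exact ⟨D q, by rw [Multiset.mem_coe, List.mem_map]; exact ⟨q, hq, rfl⟩,
          (hD q hq).2.2.2.2 e h he.2⟩
      · obtain ⟨Z, h1, h2, h3⟩ := h
        exact absurd ⟨Z, h1.trans hJ, h2, h3⟩ he.2
  · refine le_trans ?_ (hw Finset.card)
    rw [Multiset.map_coe, Multiset.sum_coe, List.map_map]
    apply List.sum_le_sum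
    intro q hq
    exact (hD q hq).2.2.2.1

theorem comp_iff {K : Finset (Sym2 V)} {r : V → V} (hr : ∀ x, conn K x (r x))
    (hrr : ∀ x y, conn K x y → r x = r y) (x y : V) : conn K x y ↔ r x = r y :=
  ⟨hrr x y, fun h => conn_trans (hr x) (h ▸ conn_symm (hr y))⟩

/-- in a connected set, a vertex set without crossing edges missing one vertex is empty -/
theorem inter_corner {F : Finset (Sym2 V)} {U W : Set V} {e f : Sym2 V}
    (hU : ∀ g ∈ F, g ≠ e → ¬ Crosses U g) (hW : ∀ g ∈ F, g ≠ f → ¬ Crosses W g)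
    (h1 : ∀ x ∈ e, ¬ (x ∈ U ∧ x ∈ W)) (h2 : ∀ x ∈ f, ¬ (x ∈ U ∧ x ∈ W))
    {z y : V} (hz : z ∈ e) (hy : conn F z y) : ¬ (y ∈ U ∧ y ∈ W) := by
  intro hyy
  have := conn_nocross (conn_symm hy) (U := U ∩ W) (by
    rintro g hg ⟨a, b, rfl, ha, hb⟩
    by_cases ge : s(a, b) = e
    · subst ge; exact h1 a (by simp) ha
    by_cases gf : s(a, b) = f
    · subst gf; exact h2 a (by simp) ha
    have c1 := hU _ hg ge
    have c2 := hW _ hg gf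
    rw [crosses_mk] at c1 c2
    have a1 := ha.1
    have a2 := ha.2
    refine hb ⟨?_, ?_⟩
    · by_contra h; exact c1 (Or.inl ⟨a1, h⟩)
    · by_contra h; exact c2 (Or.inl ⟨a2, h⟩)) hyy
  exact h1 z hz this

theorem crosses_compl {U : Set V} {e : Sym2 V} : Crosses Uᶜ e ↔ Crosses U e := by
  induction e with | _ x y =>
  rw [crosses_mk, crosses_mk]
  simp only [Set.mem_compl_iff]
  tauto

theorem corner_choice {U W : Set V} {e f : Sym2 V} (hc : Crosses U e) (hc' : Crosses W f)
    (hd : e ≠ f → ¬ Crosses U f ∧ ¬ Crosses W e) :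
    ((∀ x ∈ e, ¬ (x ∈ U ∧ x ∈ W)) ∧ (∀ x ∈ f, ¬ (x ∈ U ∧ x ∈ W))) ∨
    ((∀ x ∈ e, ¬ (x ∈ U ∧ x ∈ Wᶜ)) ∧ (∀ x ∈ f, ¬ (x ∈ U ∧ x ∈ Wᶜ))) ∨
    ((∀ x ∈ e, ¬ (x ∈ Uᶜ ∧ x ∈ W)) ∧ (∀ x ∈ f, ¬ (x ∈ Uᶜ ∧ x ∈ W))) ∨
    ((∀ x ∈ e, ¬ (x ∈ Uᶜ ∧ x ∈ Wᶜ)) ∧ (∀ x ∈ f, ¬ (x ∈ Uᶜ ∧ x ∈ Wᶜ))) := by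
  by_cases hef : e = f
  · subst hef
    clear hd
    induction e with | _ a b =>
    rw [crosses_mk] at hc hc'
    simp only [Sym2.mem_iff, forall_eq_or_imp, forall_eq, Set.mem_compl_iff]
    by_cases u1 : a ∈ U <;> by_cases u2 : b ∈ U <;> by_cases w1 : a ∈ W <;> by_cases w2 : b ∈ W <;>
      simp [u1, u2, w1, w2] at hc hc' ⊢
  · obtain ⟨d1, d2⟩ := hd hef
    have q1 : (∀ x ∈ f, x ∉ U) ∨ (∀ x ∈ f, x ∉ Uᶜ) := by
      clear hc hc' d2 hd hef
      induction f with | _ c d =>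
      rw [crosses_mk] at d1
      simp only [Sym2.mem_iff, forall_eq_or_imp, forall_eq, Set.mem_compl_iff]
      by_cases u1 : c ∈ U <;> by_cases u2 : d ∈ U <;> simp [u1, u2] at d1 ⊢
    have q2 : (∀ x ∈ e, x ∉ W) ∨ (∀ x ∈ e, x ∉ Wᶜ) := by
      clear hc hc' d1 hd hef
      induction e with | _ c d =>
      rw [crosses_mk] at d2
      simp only [Sym2.mem_iff, forall_eq_or_imp, forall_eq, Set.mem_compl_iff]
      by_cases u1 : c ∈ W <;> by_cases u2 : d ∈ W <;> simp [u1, u2] at d2 ⊢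
    rcases q1 with q1 | q1 <;> rcases q2 with q2 | q2
    · exact Or.inl ⟨fun x hx h => q2 x hx h.2, fun x hx h => q1 x hx h.1⟩
    · exact Or.inr (Or.inl ⟨fun x hx h => q2 x hx h.2, fun x hx h => q1 x hx h.1⟩)
    · exact Or.inr (Or.inr (Or.inl ⟨fun x hx h => q2 x hx h.2, fun x hx h => q1 x hx h.1⟩))
    · exact Or.inr (Or.inr (Or.inr ⟨fun x hx h => q2 x hx h.2, fun x hx h => q1 x hx h.1⟩))

theorem exists_s {F B : Finset (Sym2 V)} (hBF : B ⊆ F) {ι : Type*} {X : Finset ι} {p : ι → V}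
    (h2 : ∀ e ∈ B, ∀ z ∈ e, ∃ t ∈ X, p t ∈ side F e z)
    (h3 : ∀ t ∈ X, ∃ t' ∈ X, t' ≠ t ∧ conn F (p t) (p t'))
    (hcr : ∀ e ∈ B, ∀ z ∈ e, Crosses (side F e z) e) :
    ∃ s : ι → ZMod 2 × ZMod 2, (∀ t ∈ X, s t ≠ 0) ∧
      (∀ x, ∑ t ∈ X.filter (fun t => p t ∈ comp F x), s t = 0) ∧
      ∀ e ∈ B, ∀ z ∈ e, ∑ t ∈ X.filter (fun t => p t ∈ side F e z), s t ≠ 0 := by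
  obtain ⟨r, hr, hrr⟩ := exists_root F
  have hiff := comp_iff hr hrr
  have key : ∀ ρ : V, ∃ s : ι → ZMod 2 × ZMod 2,
      (∀ t ∈ X.filter (fun t => r (p t) = ρ), s t ≠ 0) ∧
      ∑ t ∈ X.filter (fun t => r (p t) = ρ), s t = 0 ∧
      ∀ A ∈ {A : Finset ι | ∃ e ∈ B, ∃ U : Set V, (∀ x ∈ e, r x = ρ) ∧
        (∀ f ∈ F, f ≠ e → ¬ Crosses U f) ∧ Crosses U e ∧
        A = (X.filter (fun t => r (p t) = ρ)).filter (fun t => p t ∈ U)}, ∑ t ∈ A, s t ≠ 0 := by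
    intro ρ
    apply nz _ _ _ rfl
    · intro h
      obtain ⟨t, ht⟩ := Finset.card_eq_one.1 h
      have ht1 : t ∈ X.filter (fun t => r (p t) = ρ) := by rw [ht]; simp
      rw [Finset.mem_filter] at ht1
      obtain ⟨t', ht', hne, hc⟩ := h3 t ht1.1
      have : t' ∈ X.filter (fun t => r (p t) = ρ) := by
        rw [Finset.mem_filter]; exact ⟨ht', (hrr _ _ hc).symm.trans ht1.2⟩
      rw [ht, Finset.mem_singleton] at this
      exact hne this
    · rintro A ⟨e, _, U, _, _, _, rfl⟩
      exact Finset.filter_subset _ _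
    · rintro A ⟨e, he, U, hρ, hn, ⟨x, y, rfl, hx, hy⟩, rfl⟩
      obtain ⟨t, ht, hts⟩ := h2 _ he x (by simp)
      refine ⟨t, ?_⟩
      rw [Finset.mem_filter, Finset.mem_filter]
      refine ⟨⟨ht, ?_⟩, ?_⟩
      · rw [← hρ x (by simp)]
        exact (hrr _ _ (conn_mono (Finset.erase_subset _ _) hts)).symm
      · exact conn_nocross hts (fun f hf => by
          rw [Finset.mem_erase] at hf; exact hn f hf.2 hf.1) hx
    · rintro A ⟨e, he, U, hρ, hn, hc, rfl⟩
      refine ⟨e, he, Uᶜ, hρ, fun f hf hfe h => hn f hf hfe (crosses_compl.1 h),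
        crosses_compl.2 hc, ?_⟩
      ext t
      simp only [Finset.mem_sdiff, Finset.mem_filter, Set.mem_compl_iff]
      tauto
    · rintro A ⟨e, he, U, hρ, hn, hc, rfl⟩ A' ⟨f, hf, W, hρ', hn', hc', rfl⟩
      -- a general emptiness principle
      have emp : ∀ U' W' : Set V, (∀ g ∈ F, g ≠ e → ¬ Crosses U' g) →
          (∀ g ∈ F, g ≠ f → ¬ Crosses W' g) →
          (∀ x ∈ e, ¬ (x ∈ U' ∧ x ∈ W')) → (∀ x ∈ f, ¬ (x ∈ U' ∧ x ∈ W')) →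
          ∀ y, r y = ρ → ¬ (y ∈ U' ∧ y ∈ W') := by
        intro U' W' k1 k2 k3 k4 y hy
        induction e with | _ a b =>
        refine inter_corner k1 k2 k3 k4 (z := a) (by simp) ?_
        rw [hiff, hρ a (by simp), hy]
      have hnc : ∀ g ∈ F, g ≠ e → ¬ Crosses Uᶜ g := fun g hg hge h => hn g hg hge (crosses_compl.1 h)
      have hnc' : ∀ g ∈ F, g ≠ f → ¬ Crosses Wᶜ g :=
        fun g hg hge h => hn' g hg hge (crosses_compl.1 h)
      have hch := corner_choice (U := U) (W := W) (e := e) (f := f) hc hc'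
        (fun hef => ⟨hn f (hBF hf) (Ne.symm hef), hn' e (hBF he) hef⟩)
      rcases hch with ⟨k1, k2⟩ | ⟨k1, k2⟩ | ⟨k1, k2⟩ | ⟨k1, k2⟩
      · left
        rw [Finset.disjoint_left]
        intro t ht ht'
        rw [Finset.mem_filter, Finset.mem_filter] at ht ht'
        exact emp U W hn hn' k1 k2 _ ht.1.2 ⟨ht.2, ht'.2⟩
      · right; left
        intro t ht
        rw [Finset.mem_filter] at ht ⊢
        refine ⟨ht.1, ?_⟩
        by_contra hh
        exact emp U Wᶜ hn hnc' k1 k2 _ (Finset.mem_filter.1 ht.1).2 ⟨ht.2, hh⟩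
      · right; right; left
        intro t ht
        rw [Finset.mem_filter] at ht ⊢
        refine ⟨ht.1, ?_⟩
        by_contra hh
        exact emp Uᶜ W hnc hn' k1 k2 _ (Finset.mem_filter.1 ht.1).2 ⟨hh, ht.2⟩
      · right; right; right
        ext t
        rw [Finset.mem_union]
        constructor
        · rintro (h | h) <;> exact (Finset.mem_filter.1 h).1
        · intro h
          by_contra hh
          push Not at hh
          exact emp Uᶜ Wᶜ hnc hnc' k1 k2 _ (Finset.mem_filter.1 h).2
            ⟨fun hu => hh.1 (Finset.mem_filter.2 ⟨h, hu⟩), fun hu => hh.2 (Finset.mem_filter.2 ⟨h, hu⟩)⟩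
  choose s hs1 hs2 hs3 using key
  refine ⟨fun t => s (r (p t)) t, ?_, ?_, ?_⟩
  · intro t ht
    exact hs1 _ t (Finset.mem_filter.2 ⟨ht, rfl⟩)
  · intro x
    rw [← hs2 (r x)]
    have : X.filter (fun t => p t ∈ comp F x) = X.filter (fun t => r (p t) = r x) := by
      apply Finset.filter_congr
      intro t _
      change conn F x (p t) ↔ _
      rw [hiff]; exact eq_comm
    rw [this]
    apply Finset.sum_congr rfl
    intro t ht
    simp only [(Finset.mem_filter.1 ht).2]
  · intro e he z hz
    have hsame : ∀ x ∈ e, r x = r z := by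
      intro x hx
      induction e with | _ a b =>
      have hab := hrr _ _ (conn_edge (hBF he))
      rw [Sym2.mem_iff] at hx hz
      rcases hx with rfl | rfl <;> rcases hz with rfl | rfl <;> simp [hab]
    have hside : ∀ t, p t ∈ side F e z → r (p t) = r z := fun t ht =>
      (hrr _ _ (conn_mono (Finset.erase_subset _ _) ht)).symm
    have h := hs3 (r z) _ ⟨e, he, side F e z, hsame, side_cross_only, hcr e he z hz, rfl⟩
    have heq : (X.filter (fun t => r (p t) = r z)).filter (fun t => p t ∈ side F e z) =
        X.filter (fun t => p t ∈ side F e z) := by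
      ext t
      simp only [Finset.mem_filter]
      have := hside t
      tauto
    rw [heq] at h
    rw [Finset.sum_congr rfl (g := s (r z))]
    · exact h
    · intro t ht
      simp only [hside t (Finset.mem_filter.1 ht).2]

theorem join_phi {F : Finset (Sym2 V)} {ι : Type*} {X : Finset ι} {p : ι → V}
    (φ : ι → ZMod 2) (h : ∀ x, ∑ t ∈ X.filter (fun t => p t ∈ comp F x), φ t = 0) :
    ∃ J ⊆ F, bd J = ∑ t ∈ X.filter (fun t => φ t = 1), dl (p t) := by
  apply tjoin'
  intro x
  rw [us_sum, ← h x, Finset.sum_filter, Finset.sum_filter]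
  apply Finset.sum_congr rfl
  intro t _
  rw [us_dl]
  rcases zt01 (φ t) with h | h <;> simp [h]

theorem mem_join {F J : Finset (Sym2 V)} {ι : Type*} {X : Finset ι} {p : ι → V}
    {φ : ι → ZMod 2} (hJ : J ⊆ F) (hb : bd J = ∑ t ∈ X.filter (fun t => φ t = 1), dl (p t))
    {e : Sym2 V} {z : V} (hcr : Crosses (side F e z) e)
    (h : ∑ t ∈ X.filter (fun t => p t ∈ side F e z), φ t ≠ 0) : e ∈ J := by
  by_contra hne
  have h1 := us_bd_single (J := J) (fun g hg hge => side_cross_only g (hJ hg) hge) hcr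
  rw [if_neg hne, hb, us_sum] at h1
  apply h
  rw [← h1, Finset.sum_filter, Finset.sum_filter]
  apply Finset.sum_congr rfl
  intro t _
  rw [us_dl]
  rcases zt01 (φ t) with h | h <;> simp [h]

theorem caseB_end {G : SimpleGraph V} {σ : Sym2 V → Bool} {E F : Finset (Sym2 V)}
    (hG : ∀ e ∈ E, e ∈ G.edgeSet) (hF : F ⊆ E) {X : Finset (Finset (Sym2 V))}
    {p : Finset (Sym2 V) → V}
    (hX : ∀ t ∈ X, Circ t ∧ sg σ t = 1 ∧ t ⊆ E ∧ p t ∈ VS t)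
    (hss : ∀ t ∈ X, ∀ t' ∈ X, t ≠ t' → (VS t ∩ VS t').Subsingleton)
    (hB : ∀ e ∈ E, ¬ cyc E e → e ∈ F)
    (h2 : ∀ e ∈ E, ¬ cyc E e → ∀ z ∈ e, ∃ t ∈ X, p t ∈ side F e z)
    (h3 : ∀ t ∈ X, ∃ t' ∈ X, t' ≠ t ∧ conn F (p t) (p t')) :
    ∃ n, Cov G σ (X.biUnion id ∪ E.filter (fun e => ¬ cyc E e)) n ∧
      3 * n ≤ 4 * (∑ t ∈ X, t.card + F.card) := by
  have hcr : ∀ e ∈ E, ¬ cyc E e → ∀ z ∈ e, Crosses (side F e z) e := by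
    intro e he hc z hz
    refine side_crosses' (hB e he hc) ?_ hz
    rintro ⟨Z, a, b, c⟩
    exact hc ⟨Z, a.trans hF, b, c⟩
  obtain ⟨s, hs0, hsc, hsB⟩ := exists_s (F := F) (B := E.filter (fun e => ¬ cyc E e))
    (X := X) (p := p) (by
      intro e he; rw [Finset.mem_filter] at he; exact hB e he.1 he.2) (by
      intro e he; rw [Finset.mem_filter] at he; exact h2 e he.1 he.2) h3 (by
      intro e he; rw [Finset.mem_filter] at he; exact hcr e he.1 he.2)
  have hfst : ∀ S : Finset (Finset (Sym2 V)), ∑ t ∈ S, (s t).1 = (∑ t ∈ S, s t).1 :=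
    fun S => (Prod.fst_sum).symm
  have hsnd : ∀ S : Finset (Finset (Sym2 V)), ∑ t ∈ S, (s t).2 = (∑ t ∈ S, s t).2 :=
    fun S => (Prod.snd_sum).symm
  have hthd : ∀ S : Finset (Finset (Sym2 V)), ∑ t ∈ S, ((s t).1 + (s t).2) =
      (∑ t ∈ S, s t).1 + (∑ t ∈ S, s t).2 := by
    intro S; rw [Finset.sum_add_distrib, hfst, hsnd]
  obtain ⟨J₁, hJ₁, hb₁⟩ := join_phi (F := F) (X := X) (p := p) (fun t => (s t).1) (by
    intro x; rw [hfst, hsc]; rfl)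
  obtain ⟨J₂, hJ₂, hb₂⟩ := join_phi (F := F) (X := X) (p := p) (fun t => (s t).2) (by
    intro x; rw [hsnd, hsc]; rfl)
  have hJ₃ : symmDiff J₁ J₂ ⊆ F := symm_sub hJ₁ hJ₂
  have hb₃ : bd (symmDiff J₁ J₂) =
      ∑ t ∈ X.filter (fun t => (s t).1 + (s t).2 = 1), dl (p t) := by
    rw [bd_symm, hb₁, hb₂, Finset.sum_filter, Finset.sum_filter, Finset.sum_filter,
      ← Finset.sum_add_distrib]
    apply Finset.sum_congr rfl
    intro t _
    rcases zt01 (s t).1 with h | h <;> rcases zt01 (s t).2 with h' | h' <;> simp [h, h', zt, ztf]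
  have hcov : ∀ (φ : Finset (Sym2 V) → ZMod 2) (J : Finset (Sym2 V)), J ⊆ F →
      bd J = ∑ t ∈ X.filter (fun t => φ t = 1), dl (p t) →
      Cov G σ ((X.filter (fun t => φ t = 1)).biUnion id ∪ J.filter (fun e => ¬ cyc E e))
        (∑ t ∈ X.filter (fun t => φ t = 1), t.card + J.card) := by
    intro φ J hJ hb
    exact one_join hG (fun t ht => hX t (Finset.mem_filter.1 ht).1)
      (fun t ht t' ht' => hss t (Finset.mem_filter.1 ht).1 t' (Finset.mem_filter.1 ht').1)
      (hJ.trans hF) hb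
  have c₁ := hcov (fun t => (s t).1) J₁ hJ₁ hb₁
  have c₂ := hcov (fun t => (s t).2) J₂ hJ₂ hb₂
  have c₃ := hcov (fun t => (s t).1 + (s t).2) _ hJ₃ hb₃
  -- bridges: nonvanishing
  have hmem : ∀ (φ ψ : Finset (Sym2 V) → ZMod 2) (J J' : Finset (Sym2 V)), J ⊆ F → J' ⊆ F →
      bd J = ∑ t ∈ X.filter (fun t => φ t = 1), dl (p t) →
      bd J' = ∑ t ∈ X.filter (fun t => ψ t = 1), dl (p t) →
      (∀ S : Finset (Finset (Sym2 V)), ∑ t ∈ S, s t ≠ 0 →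
        ∑ t ∈ S, φ t ≠ 0 ∨ ∑ t ∈ S, ψ t ≠ 0) →
      X.biUnion id ∪ E.filter (fun e => ¬ cyc E e) ⊆
        ((X.filter (fun t => φ t = 1)).biUnion id ∪ J.filter (fun e => ¬ cyc E e)) ∪
        ((X.filter (fun t => ψ t = 1)).biUnion id ∪ J'.filter (fun e => ¬ cyc E e)) := by
    intro φ ψ J J' hJ hJ' hb hb' hnz e he
    rw [Finset.mem_union] at he
    rcases he with he | he
    · rw [Finset.mem_biUnion] at he
      obtain ⟨t, ht, het⟩ := he
      have := hnz {t} (by rw [Finset.sum_singleton]; exact hs0 t ht)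
      rw [Finset.sum_singleton, Finset.sum_singleton] at this
      rw [Finset.mem_union, Finset.mem_union, Finset.mem_union, Finset.mem_biUnion,
        Finset.mem_biUnion]
      rcases this with h | h
      · exact Or.inl (Or.inl ⟨t, Finset.mem_filter.2 ⟨ht, zt1 h⟩, het⟩)
      · exact Or.inr (Or.inl ⟨t, Finset.mem_filter.2 ⟨ht, zt1 h⟩, het⟩)
    · have he' := Finset.mem_filter.1 he
      obtain ⟨z, hz⟩ : ∃ z, z ∈ e := by
        induction e with | _ a b => exact ⟨a, by simp⟩
      have hc := hcr e he'.1 he'.2 z hz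
      rw [Finset.mem_union, Finset.mem_union, Finset.mem_union, Finset.mem_filter,
        Finset.mem_filter]
      rcases hnz _ (hsB e he z hz) with h | h
      · exact Or.inl (Or.inr ⟨mem_join hJ hb hc h, he'.2⟩)
      · exact Or.inr (Or.inr ⟨mem_join hJ' hb' hc h, he'.2⟩)
  have m₁₂ := hmem (fun t => (s t).1) (fun t => (s t).2) _ _ hJ₁ hJ₂ hb₁ hb₂ (by
    intro S hS
    rw [hfst, hsnd]
    by_contra hh
    push Not at hh
    exact hS (Prod.ext hh.1 hh.2))
  have m₁₃ := hmem (fun t => (s t).1) (fun t => (s t).1 + (s t).2) _ _ hJ₁ hJ₃ hb₁ hb₃ (by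
    intro S hS
    rw [hfst, hthd]
    by_contra hh
    push Not at hh
    have h' := hh.2
    rw [hh.1, zero_add] at h'
    exact hS (Prod.ext hh.1 h'))
  have m₂₃ := hmem (fun t => (s t).2) (fun t => (s t).1 + (s t).2) _ _ hJ₂ hJ₃ hb₂ hb₃ (by
    intro S hS
    rw [hsnd, hthd]
    by_contra hh
    push Not at hh
    have h' := hh.2
    rw [hh.1, add_zero] at h'
    exact hS (Prod.ext h' hh.1))
  have hsumT : ∑ t ∈ X.filter (fun t => (s t).1 = 1), t.card +
      ∑ t ∈ X.filter (fun t => (s t).2 = 1), t.card +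
      ∑ t ∈ X.filter (fun t => (s t).1 + (s t).2 = 1), t.card ≤ 2 * ∑ t ∈ X, t.card := by
    rw [Finset.sum_filter, Finset.sum_filter, Finset.sum_filter, ← Finset.sum_add_distrib,
      ← Finset.sum_add_distrib, Finset.mul_sum]
    apply Finset.sum_le_sum
    intro t _
    rcases zt01 (s t).1 with h | h <;> rcases zt01 (s t).2 with h' | h' <;> simp [h, h', zt] <;> omega
  have hsumJ : J₁.card + J₂.card + (symmDiff J₁ J₂).card ≤ 2 * F.card := by
    have e1 : (symmDiff J₁ J₂).card = (J₁ \ J₂).card + (J₂ \ J₁).card := by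
      rw [symmDiff_def, Finset.sup_eq_union, Finset.card_union_of_disjoint disjoint_sdiff_sdiff]
    have e2 := Finset.card_sdiff_add_card J₁ J₂
    have e3 := Finset.card_sdiff_add_card J₂ J₁
    rw [Finset.union_comm] at e3
    have e4 := Finset.card_le_card (Finset.union_subset hJ₁ hJ₂)
    omega
  set a₁ := ∑ t ∈ X.filter (fun t => (s t).1 = 1), t.card
  set a₂ := ∑ t ∈ X.filter (fun t => (s t).2 = 1), t.card
  set a₃ := ∑ t ∈ X.filter (fun t => (s t).1 + (s t).2 = 1), t.card
  rcases le_total (a₁ + J₁.card) (a₂ + J₂.card) with l1 | l1 <;>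
  rcases le_total (a₁ + J₁.card) (a₃ + (symmDiff J₁ J₂).card) with l2 | l2 <;>
  rcases le_total (a₂ + J₂.card) (a₃ + (symmDiff J₁ J₂).card) with l3 | l3
  all_goals first
    | exact ⟨_, (c₁.add c₂).mono m₁₂ le_rfl, by omega⟩
    | exact ⟨_, (c₁.add c₃).mono m₁₃ le_rfl, by omega⟩
    | exact ⟨_, (c₂.add c₃).mono m₂₃ le_rfl, by omega⟩

end CaseBEnd


section Glue
open Classical
variable [Fintype V]

theorem side_not_mem_other {F : Finset (Sym2 V)} {a b : V} (hcr : Crosses (side F s(a, b) b) s(a, b)) :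
    a ∉ side F s(a, b) b := by
  rw [crosses_mk] at hcr
  have hb : b ∈ side F s(a, b) b := mem_comp_self _ _
  intro ha
  tauto

theorem glue_side {F Fn B : Finset (Sym2 V)} (hBF : B ⊆ F) (hFn : ∀ f ∈ Fn, f ∈ F ∧ f ∉ B)
    (hcr : ∀ e ∈ B, ∀ z ∈ e, Crosses (side F e z) e)
    {ι : Type*} {X : Finset ι} {p : ι → V}
    (h1 : ∀ e ∈ B, ∀ z ∈ e, (∃ t ∈ X, conn Fn z (p t)) ∨
      ∃ e' ∈ B, e' ≠ e ∧ ∃ z' ∈ e', conn Fn z z') :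
    ∀ (n : ℕ), ∀ e ∈ B, ∀ z ∈ e, (side F e z).ncard ≤ n → ∃ t ∈ X, p t ∈ side F e z := by
  have hFe : ∀ e ∈ B, Fn ⊆ F.erase e := by
    intro e he f hf
    rw [Finset.mem_erase]
    exact ⟨by rintro rfl; exact (hFn _ hf).2 he, (hFn f hf).1⟩
  intro n
  induction n with
  | zero =>
    intro e he z hz hn
    exfalso
    have h : z ∈ side F e z := mem_comp_self _ _
    have : 0 < (side F e z).ncard := (Set.ncard_pos (Set.toFinite _)).2 ⟨z, h⟩
    omega
  | succ n ih =>
    intro e he z hz hn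
    rcases h1 e he z hz with ⟨t, ht, hc⟩ | ⟨e', he', hne, z', hz', hc⟩
    · exact ⟨t, ht, conn_mono (hFe e he) hc⟩
    · obtain ⟨y', rfl⟩ := Sym2.mem_iff_exists.1 hz'
      have hz'U : z' ∈ side F e z := conn_mono (hFe e he) hc
      have hy'U : y' ∈ side F e z :=
        conn_trans hz'U (conn_edge (Finset.mem_erase.2 ⟨hne, hBF he'⟩))
      have hcr' := hcr _ he' y' (by simp)
      have hz'W : z' ∉ side F s(z', y') y' := side_not_mem_other hcr'
      have hzW : z ∉ side F s(z', y') y' := fun h =>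
        hz'W (conn_trans h (conn_mono (hFe _ he') hc))
      have heW : ∀ x ∈ e, x ∉ side F s(z', y') y' := by
        intro x hx hxW
        exact hzW (not_crosses_mem (side_cross_only e (hBF he) (Ne.symm hne)) hx hz hxW)
      have hsub : side F s(z', y') y' ⊆ side F e z := by
        intro w hw
        by_contra hwU
        have := conn_nocross (conn_symm hw) (U := side F s(z', y') y' \ side F e z) (by
          rintro g hg ⟨a, b, rfl, ha, hb⟩
          rw [Finset.mem_erase] at hg
          have hbW : b ∈ side F s(z', y') y' :=
            not_crosses_mem (side_cross_only _ hg.2 hg.1) (x := a) (by simp) (by simp) ha.1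
          have hbU : b ∈ side F e z := by
            by_contra h; exact hb ⟨hbW, h⟩
          by_cases hge : s(a, b) = e
          · exact heW a (hge ▸ by simp) ha.1
          · exact ha.2 (not_crosses_mem (side_cross_only _ hg.2 hge) (x := b) (by simp) (by simp) hbU))
          ⟨hw, hwU⟩
        exact this.2 hy'U
      have hlt : (side F s(z', y') y').ncard < (side F e z).ncard := by
        apply Set.ncard_lt_ncard _ (Set.toFinite _)
        refine ⟨hsub, fun h => hzW (h (mem_comp_self _ _))⟩
      obtain ⟨t, ht, htW⟩ := ih _ he' y' (by simp) (by omega)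
      exact ⟨t, ht, hsub htW⟩

theorem glue_conn {F Fn B : Finset (Sym2 V)} (hBF : B ⊆ F) (hFn : ∀ f ∈ Fn, f ∈ F ∧ f ∉ B)
    (hcr : ∀ e ∈ B, ∀ z ∈ e, Crosses (side F e z) e)
    {ι : Type*} {X : Finset ι} {p : ι → V}
    (hs : ∀ e ∈ B, ∀ z ∈ e, ∃ t ∈ X, p t ∈ side F e z)
    (h2 : ∀ t ∈ X, (∃ t' ∈ X, t' ≠ t ∧ conn Fn (p t) (p t')) ∨
      ∃ e' ∈ B, ∃ z' ∈ e', conn Fn (p t) z') :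
    ∀ t ∈ X, ∃ t' ∈ X, t' ≠ t ∧ conn F (p t) (p t') := by
  intro t ht
  have hFF : Fn ⊆ F := fun f hf => (hFn f hf).1
  rcases h2 t ht with ⟨t', ht', hne, hc⟩ | ⟨e', he', z', hz', hc⟩
  · exact ⟨t', ht', hne, conn_mono hFF hc⟩
  · obtain ⟨y', rfl⟩ := Sym2.mem_iff_exists.1 hz'
    obtain ⟨t', ht', hts⟩ := hs _ he' y' (by simp)
    have hz'W : z' ∉ side F s(z', y') y' := side_not_mem_other (hcr _ he' y' (by simp))
    refine ⟨t', ht', ?_, ?_⟩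
    · rintro rfl
      apply hz'W
      refine conn_trans hts (conn_mono ?_ hc)
      intro f hf
      rw [Finset.mem_erase]
      exact ⟨by rintro rfl; exact (hFn _ hf).2 he', (hFn f hf).1⟩
    · exact conn_trans (conn_mono hFF hc) (conn_trans (conn_edge (hBF he'))
        (conn_mono (Finset.erase_subset _ _) hts))

end Glue

section LemmaL
open Classical
variable [Fintype V]

theorem sum_bd {ι : Type*} (I : Finset ι) (τ : ι → V → ZMod 2) (H : Finset (Sym2 V))
    (h : ∀ c ∈ I, ∃ A ⊆ H, bd A = τ c) : ∃ A ⊆ H, bd A = ∑ c ∈ I, τ c := by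
  induction I using Finset.induction_on with
  | empty => exact ⟨∅, by simp, by simp⟩
  | insert c I hc ih =>
    obtain ⟨A, hA, hb⟩ := ih (fun c' hc' => h c' (Finset.mem_insert_of_mem hc'))
    obtain ⟨A', hA', hb'⟩ := h c (Finset.mem_insert_self _ _)
    exact ⟨symmDiff A' A, symm_sub hA' hA, by rw [bd_symm, hb, hb', Finset.sum_insert hc]⟩

theorem repos {ι : Type*} {K H : Finset (Sym2 V)} {I' : Finset ι} {Y : ι → Set V}
    {p q : ι → V} (hHK : H ⊆ K) (hcyc : ∀ e ∈ H, cyc H e)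
    (hY : ∀ c ∈ I', ∀ x ∈ Y c, ∀ y ∈ Y c, conn H x y)
    (hp : ∀ c ∈ I', p c ∈ Y c) (hq : ∀ c ∈ I', q c ∈ Y c)
    {J : Finset (Sym2 V)} (hJ : J ⊆ K) (hb : bd J = ∑ c ∈ I', dl (p c)) :
    ∃ J' ⊆ K, bd J' = ∑ c ∈ I', dl (q c) ∧ J' \ H = J \ H ∧
      2 * J'.card ≤ 2 * (J \ H).card + H.card := by
  obtain ⟨A, hA, hAb⟩ := sum_bd I' (fun c => dl (p c) + dl (q c)) H (fun c hc =>
    hY c hc _ (hp c hc) _ (hq c hc))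
  have hJs : bd (J ∩ H) + bd (J \ H) = bd J := by
    rw [← bd_union (Finset.disjoint_sdiff_inter J H).symm, Finset.union_comm,
      Finset.sdiff_union_inter]
  obtain ⟨M, hM, hMb, hMc⟩ := averaging ztf inc H H subset_rfl (∑ c ∈ I', dl (q c) + bd (J \ H))
    ⟨symmDiff (J ∩ H) A, symm_sub Finset.inter_subset_right hA, by
      change bd _ = _
      rw [bd_symm, hAb, Finset.sum_add_distrib, ← hb, ← hJs]
      have e1 := ztf (bd (J ∩ H))
      calc _ = (bd (J ∩ H) + bd (J ∩ H)) + (∑ c ∈ I', dl (q c) + bd (J \ H)) := by abel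
        _ = _ := by rw [e1, zero_add]⟩ hcyc
  rw [Finset.inter_eq_left.2 hM] at hMc
  have hdis : Disjoint (J \ H) M := Finset.sdiff_disjoint.mono_right hM
  refine ⟨(J \ H) ∪ M, Finset.union_subset (Finset.sdiff_subset.trans hJ) (hM.trans hHK), ?_, ?_, ?_⟩
  · change bd M = _ at hMb
    rw [bd_union hdis, hMb]
    have e1 := ztf (bd (J \ H))
    calc _ = (bd (J \ H) + bd (J \ H)) + (∑ c ∈ I', dl (q c)) := by abel
      _ = _ := by rw [e1, zero_add]
  · ext e
    have := @hM e
    simp only [Finset.mem_sdiff, Finset.mem_union]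
    tauto
  · rw [Finset.card_union_of_disjoint hdis]; omega

theorem partner {ι : Type*} {I' : Finset ι} {q : ι → V} {J : Finset (Sym2 V)}
    (hb : bd J = ∑ c ∈ I', dl (q c)) : ∀ c ∈ I', ∃ c' ∈ I', c' ≠ c ∧ conn J (q c) (q c') := by
  intro c hc
  obtain ⟨L, hL, hT, _, _⟩ := pairing q _ I' J rfl hb
  obtain ⟨x, hx, h⟩ := hT c hc
  obtain ⟨h1, h2, h3, h4, h5⟩ := hL x hx
  rcases h with rfl | rfl
  · exact ⟨_, h3, h1.symm, _, h4, h5⟩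
  · exact conn_symm (K := J) ⟨_, h4, h5⟩ |> fun h => ⟨_, h2, h1, h⟩

theorem lemmaL {ι : Type*} {K H : Finset (Sym2 V)} {I : Finset ι} {Y : ι → Set V}
    (hHK : H ⊆ K) (hKc : ∀ e ∈ K, cyc K e) (hcyc : ∀ e ∈ H, cyc H e)
    (hYc : ∀ c ∈ I, ∀ x ∈ Y c, ∀ y ∈ Y c, conn H x y)
    (hYn : ∀ c ∈ I, (Y c).Nonempty)
    (hYK : ∀ c ∈ I, ∀ c' ∈ I, ∀ x ∈ Y c, ∀ y ∈ Y c', conn K x y)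
    (hHY : ∀ e ∈ H, ∃ c ∈ I, ∀ x ∈ e, x ∈ Y c)
    (hI : 2 ≤ I.card) :
    ∃ p : ι → V, ∃ F ⊆ K, (∀ c ∈ I, p c ∈ Y c) ∧
      (∀ c ∈ I, ∃ c' ∈ I, c' ≠ c ∧ conn F (p c) (p c')) ∧
      4 * F.card + H.card ≤ 3 * K.card := by
  obtain ⟨I', hI'I, hI'e, hI'n⟩ : ∃ I' ⊆ I, Even I'.card ∧
      (I' = I ∨ (∃ c₀ ∈ I, I' = I.erase c₀ ∧ I'.Nonempty)) := by
    rcases Nat.even_or_odd I.card with h | h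
    · exact ⟨I, subset_rfl, h, Or.inl rfl⟩
    · obtain ⟨c₀, hc₀⟩ : I.Nonempty := Finset.card_pos.1 (by omega)
      refine ⟨I.erase c₀, Finset.erase_subset _ _, ?_, Or.inr ⟨c₀, hc₀, rfl, ?_⟩⟩
      · rw [Finset.card_erase_of_mem hc₀]; exact Nat.Odd.sub_odd h odd_one
      · rw [← Finset.card_pos, Finset.card_erase_of_mem hc₀]; omega
  have hchoice : ∃ p₀ : ι → V, ∀ c ∈ I, p₀ c ∈ Y c := by
    obtain ⟨c, hc⟩ : I.Nonempty := Finset.card_pos.1 (by omega)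
    obtain ⟨x, _⟩ := hYn c hc
    refine ⟨fun c => if h : (Y c).Nonempty then h.some else x, ?_⟩
    intro c hc
    simp only [hYn c hc, dif_pos]
    exact (hYn c hc).some_mem
  obtain ⟨p₀, hp₀⟩ := hchoice
  -- initial join
  obtain ⟨J₀, hJ₀, hJ₀b⟩ : ∃ J ⊆ K, bd J = ∑ c ∈ I', dl (p₀ c) := by
    apply tjoin'
    intro x
    rw [us_sum]
    simp only [us_dl]
    by_cases hex : ∃ c ∈ I', p₀ c ∈ comp K x
    · obtain ⟨c, hc, hcx⟩ := hex
      rw [Finset.sum_congr rfl (g := fun _ => (1 : ZMod 2))]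
      · rw [Finset.sum_const, nsmul_eq_mul, mul_one, ZMod.natCast_eq_zero_iff_even]
        exact hI'e
      · intro c' hc'
        rw [if_pos]
        exact conn_trans hcx (hYK c (hI'I hc) c' (hI'I hc') _ (hp₀ c (hI'I hc)) _
          (hp₀ c' (hI'I hc')))
    · push Not at hex
      apply Finset.sum_eq_zero
      intro c hc
      rw [if_neg (hex c hc)]
  obtain ⟨J₁, hJ₁, hJ₁b, hJ₁c⟩ := averaging ztf inc K (K \ H) Finset.sdiff_subset _
    ⟨J₀, hJ₀, hJ₀b⟩ (fun e he => hKc e (Finset.mem_sdiff.1 he).1)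
  have hJK : ∀ J ⊆ K, J ∩ (K \ H) = J \ H := by
    intro J hJ
    ext e
    have := @hJ e
    simp only [Finset.mem_inter, Finset.mem_sdiff]
    tauto
  rw [hJK J₁ hJ₁] at hJ₁c
  have hex : ∃ n, ∃ p : ι → V, ∃ J ⊆ K, (∀ c ∈ I, p c ∈ Y c) ∧ bd J = ∑ c ∈ I', dl (p c) ∧
      (J \ H).card = n := ⟨_, p₀, J₁, hJ₁, hp₀, hJ₁b, rfl⟩
  obtain ⟨p, J, hJ, hp, hJb, hJn⟩ := Nat.find_spec hex
  have hmin : ∀ p' : ι → V, ∀ J' ⊆ K, (∀ c ∈ I, p' c ∈ Y c) → bd J' = ∑ c ∈ I', dl (p' c) →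
      (J \ H).card ≤ (J' \ H).card := by
    intro p' J' h1 h2 h3
    rw [hJn]
    exact Nat.find_min' hex ⟨p', J', h1, h2, h3, rfl⟩
  have hR : 2 * (J \ H).card ≤ (K \ H).card := by
    have := hmin p₀ J₁ hJ₁ hp₀ hJ₁b
    omega
  have hKH := Finset.card_sdiff_add_card_eq_card hHK
  have hrep : ∀ q : ι → V, (∀ c ∈ I, q c ∈ Y c) → ∃ J' ⊆ K, bd J' = ∑ c ∈ I', dl (q c) ∧
      J' \ H = J \ H ∧ 2 * J'.card ≤ 2 * (J \ H).card + H.card := fun q hq =>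
    repos hHK hcyc (fun c hc => hYc c (hI'I hc)) (fun c hc => hp c (hI'I hc))
      (fun c hc => hq c (hI'I hc)) hJ hJb
  rcases hI'n with rfl | ⟨c₀, hc₀, hI'eq, hI'ne⟩
  · obtain ⟨J', h1, h2, h3, h4⟩ := hrep p hp
    exact ⟨p, J', h1, hp, partner h2, by omega⟩
  -- odd case
  have hmemI : ∀ c ∈ I, c ≠ c₀ → c ∈ I' := by
    intro c hc hne; rw [hI'eq, Finset.mem_erase]; exact ⟨hne, hc⟩
  have hc₀' : c₀ ∉ I' := by rw [hI'eq]; simp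
  set Z : Set V := VS (J \ H) ∪ {x | ∃ c ∈ I', x ∈ Y c} with hZ
  have hRK : J \ H ⊆ K := Finset.sdiff_subset.trans hJ
  have hdis : Disjoint (J \ H) H := Finset.sdiff_disjoint
  obtain ⟨y, hy, z, hz, Q, hQ, hQb, hQc⟩ := qpath hKc (Y c₀) Z (W := (J \ H) ∪ H)
    (Finset.union_subset hRK hHK) (by
      intro e he
      rw [Finset.mem_union] at he
      rcases he with he | he
      · exact Or.inr (fun x hx => Or.inl ⟨e, he, hx⟩)
      · obtain ⟨c, hc, h⟩ := hHY e he
        by_cases hcc : c = c₀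
        · subst hcc; exact Or.inl h
        · exact Or.inr (fun x hx => Or.inr ⟨c, hmemI c hc hcc, h x hx⟩)) (by
      obtain ⟨c, hc⟩ := hI'ne
      exact ⟨p c₀, hp c₀ hc₀, p c, Or.inr ⟨c, hc, hp c (hI'I hc)⟩,
        hYK c₀ hc₀ c (hI'I hc) _ (hp c₀ hc₀) _ (hp c (hI'I hc))⟩)
  rw [Finset.card_union_of_disjoint hdis] at hQc
  have fin : ∀ q : ι → V, (∀ c ∈ I, q c ∈ Y c) → q c₀ = y → ∀ J' ⊆ K,
      bd J' = ∑ c ∈ I', dl (q c) → J' \ H = J \ H → 2 * J'.card ≤ 2 * (J \ H).card + H.card →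
      (∃ c ∈ I', conn J' z (q c)) →
      ∃ p : ι → V, ∃ F ⊆ K, (∀ c ∈ I, p c ∈ Y c) ∧
      (∀ c ∈ I, ∃ c' ∈ I, c' ≠ c ∧ conn F (p c) (p c')) ∧
      4 * F.card + H.card ≤ 3 * K.card := by
    intro q hq hqy J' h1 h2 h3 h4 ⟨c₁, hc₁, h5⟩
    refine ⟨q, J' ∪ Q, Finset.union_subset h1 hQ, hq, ?_, ?_⟩
    · intro c hc
      by_cases hcc : c = c₀
      · subst hcc
        refine ⟨c₁, hI'I hc₁, by rintro rfl; exact hc₀' hc₁, ?_⟩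
        rw [hqy]
        exact conn_trans ⟨Q, Finset.subset_union_right, hQb⟩
          (conn_mono Finset.subset_union_left h5)
      · obtain ⟨c', hc', hne, h⟩ := partner h2 c (hmemI c hc hcc)
        exact ⟨c', hI'I hc', hne, conn_mono Finset.subset_union_left h⟩
    · have := Finset.card_union_le J' Q
      omega
  have hupd : ∀ q : ι → V, (∀ c ∈ I, q c ∈ Y c) →
      (∀ c ∈ I, Function.update q c₀ y c ∈ Y c) := by
    intro q hq c hc
    by_cases hcc : c = c₀
    · subst hcc; rw [Function.update_self]; exact hy
    · rw [Function.update_of_ne hcc]; exact hq c hc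
  rcases hz with hz | ⟨i, hi, hzi⟩
  · have hq := hupd p hp
    obtain ⟨J', h1, h2, h3, h4⟩ := hrep _ hq
    refine fin _ hq (Function.update_self _ _ _) J' h1 h2 h3 h4 ?_
    by_contra hno
    push Not at hno
    obtain ⟨e, he, hze⟩ := hz
    set U := comp J' z with hU
    have hnc := comp_nocross J' z
    have heJ' : e ∈ J' \ H := by rw [h3]; exact he
    have hb' : bd (J' \ res J' U) = ∑ c ∈ I', dl (Function.update p c₀ y c) := by
      rw [bd_sdiff (res_sub _ _)]
      have : bd (res J' U) = 0 := by
        funext v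
        rw [bd_res hnc]
        split_ifs with hv
        · rw [h2, Finset.sum_apply]
          apply Finset.sum_eq_zero
          intro c hc
          apply dl_ne
          rintro rfl
          exact hno c hc hv
        · rfl
      rw [this, add_zero, h2]
    have := hmin _ (J' \ res J' U) (Finset.sdiff_subset.trans h1) hq hb'
    have hlt : ((J' \ res J' U) \ H).card < (J' \ H).card := by
      apply Finset.card_lt_card
      rw [Finset.ssubset_iff_of_subset (Finset.sdiff_subset_sdiff Finset.sdiff_subset subset_rfl)]
      refine ⟨e, heJ', ?_⟩
      simp only [Finset.mem_sdiff, not_and]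
      intro hh
      exact absurd (Finset.mem_filter.2 ⟨(Finset.mem_sdiff.1 heJ').1, z, hze, mem_comp_self _ _⟩) hh.2
    rw [h3] at hlt
    omega
  · have hq' : ∀ c ∈ I, Function.update p i z c ∈ Y c := by
      intro c hc
      by_cases hcc : c = i
      · subst hcc; rw [Function.update_self]; exact hzi
      · rw [Function.update_of_ne hcc]; exact hp c hc
    have hq := hupd _ hq'
    obtain ⟨J', h1, h2, h3, h4⟩ := hrep _ hq
    refine fin _ hq (Function.update_self _ _ _) J' h1 h2 h3 h4 ⟨i, hi, ?_⟩
    rw [Function.update_of_ne (by rintro rfl; exact hc₀' hi), Function.update_self]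
    exact conn_refl _ _

end LemmaL


section Loc
open Classical
variable [Fintype V]

theorem loc {σ : Sym2 V → Bool} {K B : Finset (Sym2 V)} {L : Set V} {N : Finset (Finset (Sym2 V))}
    (ρ : V) (hKc : ∀ e ∈ K, cyc K e) (hKL : ∀ x ∈ L, ∀ y ∈ L, conn K x y)
    (hKin : ∀ e ∈ K, ∀ x ∈ e, x ∈ L)
    (hBend : ∀ e ∈ B, ∀ x ∈ e, ∀ y ∈ e, x ∈ L → y ∈ L → x = y)
    (hN : ∀ t ∈ N, Circ t ∧ t ⊆ K) (hdisj : ∀ t ∈ N, ∀ t' ∈ N, t ≠ t' → Disjoint t t')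
    (hne : N.card = 1 → ∃ e ∈ B, ∃ x ∈ e, x ∈ L)
    (hsoft : ∀ e ∈ B, ∀ v ∈ e, v ∈ L → (∀ e' ∈ B, ∀ v' ∈ e', v' ∈ L → e' = e) → N = ∅ →
      ∃ C ⊆ K, Circ C ∧ sg σ C = 1 ∧ 2 * C.card ≤ K.card) :
    ∃ (S : Finset (Finset (Sym2 V))) (F : Finset (Sym2 V)) (p : Finset (Sym2 V) → V),
      F ⊆ K ∧ (∀ t ∈ S, Circ t ∧ sg σ t = 1 ∧ t ⊆ K) ∧ (S.Nonempty → N = ∅) ∧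
      (∀ t ∈ S, ∀ t' ∈ S, t = t') ∧ (∀ t ∈ N ∪ S, p t ∈ VS t) ∧
      (∀ e ∈ B, ∀ z ∈ e, z ∈ L → (∃ t ∈ N ∪ S, conn F z (p t)) ∨
        ∃ e' ∈ B, e' ≠ e ∧ ∃ z' ∈ e', conn F z z') ∧
      (∀ t ∈ N ∪ S, (∃ t' ∈ N ∪ S, t' ≠ t ∧ conn F (p t) (p t')) ∨
        ∃ e' ∈ B, ∃ z' ∈ e', conn F (p t) z') ∧
      4 * F.card + ∑ t ∈ N, t.card + 4 * ∑ t ∈ S, t.card ≤ 3 * K.card := by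
  set HB : Finset (Sym2 V × V) := (B ×ˢ Finset.univ).filter (fun q => q.2 ∈ q.1 ∧ q.2 ∈ L) with hHB
  have mHB : ∀ e v, (e, v) ∈ HB ↔ e ∈ B ∧ v ∈ e ∧ v ∈ L := by
    intro e v; simp [hHB]
  set I : Finset (Finset (Sym2 V) ⊕ (Sym2 V × V)) := N.disjSum HB with hI
  have hIc : I.card = N.card + HB.card := Finset.card_disjSum _ _
  by_cases h2 : 2 ≤ I.card
  · set Y : Finset (Sym2 V) ⊕ (Sym2 V × V) → Set V := Sum.elim VS (fun q => {q.2}) with hY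
    have hVL : ∀ t ∈ N, ∀ x ∈ VS t, x ∈ L := by
      rintro t ht x ⟨e, he, hx⟩
      exact hKin e ((hN t ht).2 he) x hx
    have hYL : ∀ c ∈ I, ∀ x ∈ Y c, x ∈ L := by
      rintro (t | ⟨e, v⟩) hc x hx
      · rw [hI, Finset.inl_mem_disjSum] at hc
        exact hVL t hc x hx
      · rw [hI, Finset.inr_mem_disjSum, mHB] at hc
        have : x = v := hx
        rw [this]; exact hc.2.2
    obtain ⟨p, F, hFK, hp, hcn, hFc⟩ := lemmaL (K := K) (H := N.biUnion id) (I := I) (Y := Y)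
      (by intro e he
          obtain ⟨t, ht, he⟩ := Finset.mem_biUnion.1 he
          exact (hN t ht).2 he)
      hKc
      (by intro e he
          obtain ⟨t, ht, he⟩ := Finset.mem_biUnion.1 he
          exact ⟨t, Finset.subset_biUnion_of_mem id ht, he, (hN t ht).1.2.1⟩)
      (by rintro (t | ⟨e, v⟩) hc x hx y hy
          · rw [hI, Finset.inl_mem_disjSum] at hc
            exact conn_mono (Finset.subset_biUnion_of_mem id hc) (circ_conn (hN t hc).1 hx hy)
          · have h1 : x = v := hx
            have h2 : y = v := hy
            rw [h1, h2]; exact conn_refl _ _)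
      (by rintro (t | ⟨e, v⟩) hc
          · rw [hI, Finset.inl_mem_disjSum] at hc
            exact circ_VS_nonempty (hN t hc).1
          · exact ⟨v, rfl⟩)
      (by intro c hc c' hc' x hx y hy
          exact hKL _ (hYL c hc x hx) _ (hYL c' hc' y hy))
      (by intro e he
          obtain ⟨t, ht, he⟩ := Finset.mem_biUnion.1 he
          exact ⟨Sum.inl t, by rw [hI, Finset.inl_mem_disjSum]; exact ht, fun x hx => ⟨e, he, hx⟩⟩)
      h2
    refine ⟨∅, F, fun t => p (Sum.inl t), hFK, by simp, by simp, by simp, ?_, ?_, ?_, ?_⟩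
    · intro t ht
      rw [Finset.union_empty] at ht
      exact hp (Sum.inl t) (by rw [hI, Finset.inl_mem_disjSum]; exact ht)
    · intro e he z hz hzL
      have hc : (Sum.inr (e, z) : Finset (Sym2 V) ⊕ (Sym2 V × V)) ∈ I := by
        rw [hI, Finset.inr_mem_disjSum, mHB]; exact ⟨he, hz, hzL⟩
      have hpc : p (Sum.inr (e, z)) = z := hp _ hc
      obtain ⟨c', hc', hcc, hcon⟩ := hcn _ hc
      rw [hpc] at hcon
      rcases c' with t | ⟨e', z'⟩
      · left
        rw [hI, Finset.inl_mem_disjSum] at hc'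
        exact ⟨t, Finset.mem_union_left _ hc', hcon⟩
      · right
        have hpc' : p (Sum.inr (e', z')) = z' := hp _ hc'
        rw [hpc'] at hcon
        rw [hI, Finset.inr_mem_disjSum, mHB] at hc'
        refine ⟨e', hc'.1, ?_, z', hc'.2.1, hcon⟩
        rintro rfl
        apply hcc
        rw [hBend e' he z hz z' hc'.2.1 hzL hc'.2.2]
    · intro t ht
      rw [Finset.union_empty] at ht ⊢
      obtain ⟨c', hc', hcc, hcon⟩ := hcn (Sum.inl t) (by rw [hI, Finset.inl_mem_disjSum]; exact ht)
      rcases c' with t' | ⟨e', z'⟩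
      · left
        rw [hI, Finset.inl_mem_disjSum] at hc'
        exact ⟨t', hc', fun h => hcc (by rw [h]), hcon⟩
      · right
        have hpc' : p (Sum.inr (e', z')) = z' := hp _ hc'
        rw [hpc'] at hcon
        rw [hI, Finset.inr_mem_disjSum, mHB] at hc'
        exact ⟨e', hc'.1, z', hc'.2.1, hcon⟩
    · have hbu : (N.biUnion id).card = ∑ t ∈ N, t.card := Finset.card_biUnion hdisj
      rw [hbu] at hFc
      simpa using hFc
  · have hHB1 : HB.card = 0 ∨ HB.card = 1 := by omega
    rcases hHB1 with h0 | h1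
    · have hno : ∀ e ∈ B, ∀ x ∈ e, x ∉ L := by
        intro e he x hx hxL
        have := (mHB e x).2 ⟨he, hx, hxL⟩
        rw [Finset.card_eq_zero.1 h0] at this
        simp at this
      have hN0 : N = ∅ := by
        rw [← Finset.card_eq_zero]
        by_contra hc
        obtain ⟨e, he, x, hx, hxL⟩ := hne (by omega)
        exact hno e he x hx hxL
      refine ⟨∅, ∅, fun _ => ρ, by simp, by simp, by simp, by simp, by simp [hN0], ?_, by simp [hN0], by simp [hN0]⟩
      intro e he z hz hzL
      exact absurd hzL (hno e he z hz)
    · have hN0 : N = ∅ := by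
        rw [← Finset.card_eq_zero]; omega
      obtain ⟨⟨e, v⟩, hev⟩ := Finset.card_eq_one.1 h1
      have hm : (e, v) ∈ HB := by rw [hev]; simp
      rw [mHB] at hm
      have huniq : ∀ e' ∈ B, ∀ v' ∈ e', v' ∈ L → e' = e ∧ v' = v := by
        intro e' he' v' hv' hL'
        have := (mHB e' v').2 ⟨he', hv', hL'⟩
        rw [hev] at this
        simpa using this
      obtain ⟨C, hCK, hC, hCs, hCc⟩ := hsoft e hm.1 v hm.2.1 hm.2.2
        (fun e' he' v' hv' hL' => (huniq e' he' v' hv' hL').1) hN0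
      obtain ⟨y0, hy0⟩ := circ_VS_nonempty hC
      have hy0L : y0 ∈ L := by
        obtain ⟨f, hf, hx⟩ := hy0
        exact hKin f (hCK hf) _ hx
      obtain ⟨y, hy, z, hz, A, hA, hAb, hAc⟩ := qpath hKc (VS C) {v} hCK
        (fun e he => Or.inl (fun x hx => ⟨e, he, hx⟩)) ⟨y0, hy0, v, rfl, hKL _ hy0L _ hm.2.2⟩
      have hzv : z = v := hz
      subst hzv
      have hcon : conn A y z := ⟨A, subset_rfl, hAb⟩
      refine ⟨{C}, A, fun _ => y, hA, ?_, fun _ => hN0, by simp, ?_, ?_, ?_, ?_⟩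
      · simp only [Finset.mem_singleton]
        rintro t rfl
        exact ⟨hC, hCs, hCK⟩
      · simp only [hN0, Finset.empty_union, Finset.mem_singleton]
        rintro t rfl
        exact hy
      · intro e' he' z' hz' hL'
        left
        obtain ⟨rfl, rfl⟩ := huniq e' he' z' hz' hL'
        exact ⟨C, by simp, conn_symm hcon⟩
      · intro t ht
        right
        exact ⟨e, hm.1, z, hm.2.1, hcon⟩
      · simp only [hN0, Finset.sum_empty, Finset.sum_singleton]
        omega

end Loc


section Soft
open Classical
variable [Fintype V]

theorem soft_hmin {σ : Sym2 V → Bool} {E K : Finset (Sym2 V)} {L : Set V} {e0 : Sym2 V} {v : V}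
    (hm : Hmin σ E) (hKE : K ⊆ E) (hKin : ∀ e ∈ K, ∀ x ∈ e, x ∈ L)
    (hKmem : ∀ e ∈ E, e ≠ e0 → ∀ x ∈ e, x ∈ L → e ∈ K)
    (hend : ∀ x ∈ e0, x ∈ L → x = v) : Hmin σ K := by
  have key : ∀ U : Set V, ∃ U' : Set V, ∀ e ∈ E, (Crosses U' e ↔ e ∈ K ∧ Crosses U e) := by
    intro U
    refine ⟨{x | x ∈ L ∧ (x ∈ U ↔ v ∉ U)}, ?_⟩
    intro e he
    by_cases heK : e ∈ K
    · induction e with | _ a b =>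
      have ha := hKin _ heK a (by simp)
      have hb := hKin _ heK b (by simp)
      rw [crosses_mk, crosses_mk]
      simp only [Set.mem_ofPred_eq]
      tauto
    · simp only [heK, false_and, iff_false]
      rintro ⟨a, b, rfl, ha, hb⟩
      by_cases h0 : s(a, b) = e0
      · have hav : a = v := hend a (by rw [← h0]; simp) ha.1
        have := ha.2
        rw [hav] at this
        tauto
      · exact heK (hKmem _ he h0 a (by simp) ha.1)
  intro U
  obtain ⟨U', hU'⟩ := key U
  have h := hm U'
  have e1 : ∀ c : Bool, (K.filter (fun e => σ e = c ∧ Crosses U e)) =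
      E.filter (fun e => σ e = c ∧ Crosses U' e) := by
    intro c
    ext e
    simp only [Finset.mem_filter]
    constructor
    · rintro ⟨h1, h2, h3⟩
      exact ⟨hKE h1, h2, (hU' e (hKE h1)).2 ⟨h1, h3⟩⟩
    · rintro ⟨h1, h2, h3⟩
      have := (hU' e h1).1 h3
      exact ⟨this.1, h2, this.2⟩
  rw [e1, e1]; exact h

theorem soft {σ : Sym2 V → Bool} {E J K : Finset (Sym2 V)} {P N : Finset (Finset (Sym2 V))}
    {L : Set V} {e0 : Sym2 V} {v : V}
    (hm : Hmin σ E) (hKE : K ⊆ E) (hKin : ∀ e ∈ K, ∀ x ∈ e, x ∈ L)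
    (hKmem : ∀ e ∈ E, e ≠ e0 → ∀ x ∈ e, x ∈ L → e ∈ K)
    (hend : ∀ x ∈ e0, x ∈ L → x = v) (hKc : ∀ e ∈ K, cyc K e)
    (he0 : e0 ∈ E) (hb0 : ¬ cyc E e0) (hv : v ∈ e0) (hvL : v ∈ L)
    (hJ : J ⊆ poss σ E) (hdec : Dec σ (negs σ E ∪ J) P N)
    (hNL : ∀ t ∈ N, ∀ x ∈ VS t, x ∉ L)
    (hbr : ∃ f ∈ E, σ f = true ∧ ∀ x ∈ f, x ∈ side E e0 v) :
    ∃ C ⊆ K, Circ C ∧ sg σ C = 1 ∧ 2 * C.card ≤ K.card := by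
  apply short_odd (soft_hmin hm hKE hKin hKmem hend) _ hKc
  have hHE : negs σ E ∪ J ⊆ E :=
    Finset.union_subset (Finset.filter_subset _ _) (hJ.trans (Finset.filter_subset _ _))
  have hnc : ∀ e ∈ E, e ≠ e0 → ¬ Crosses L e := by
    rintro e he hne ⟨a, b, rfl, ha, hb⟩
    exact hb (hKin _ (hKmem _ he hne a (by simp) ha) b (by simp))
  have hside : ∀ x ∈ side E e0 v, x ∈ L := by
    intro x hx
    exact conn_nocross (K := E.erase e0) hx
      (fun e he => hnc e (Finset.mem_of_mem_erase he) (Finset.ne_of_mem_erase he)) hvL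
  obtain ⟨f, hfE, hfs, hfx⟩ := hbr
  have hf0 : f ≠ e0 := by
    rintro rfl
    obtain ⟨a, b, h, ha, hb⟩ := side_crosses' he0 hb0 hv
    exact hb (hfx b (by rw [h]; simp))
  have hfK : f ∈ negs σ K := by
    refine Finset.mem_filter.2 ⟨?_, hfs⟩
    induction f with | _ a b =>
    exact hKmem _ hfE hf0 a (by simp) (hside a (hfx a (by simp)))
  have hpos : 0 < (negs σ K).card := Finset.card_pos.2 ⟨f, hfK⟩
  have hsum := hdec.sum (fun e => if e ∈ K ∧ σ e = true then (1 : ZMod 2) else 0)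
  have h1 : ∑ e ∈ negs σ E ∪ J, (if e ∈ K ∧ σ e = true then (1 : ZMod 2) else 0)
      = ((negs σ K).card : ZMod 2) := by
    rw [Finset.sum_ite, Finset.sum_const_zero, add_zero, Finset.sum_const, nsmul_eq_mul, mul_one]
    congr 2
    ext e
    simp only [Finset.mem_filter, Finset.mem_union, negs]
    constructor
    · rintro ⟨_, h⟩; exact h
    · rintro h; exact ⟨Or.inl ⟨hKE h.1, h.2⟩, h⟩
  have hP : ∑ C ∈ P, ∑ e ∈ C, (if e ∈ K ∧ σ e = true then (1 : ZMod 2) else 0) = 0 := by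
    apply Finset.sum_eq_zero
    intro C hC
    have hC' := Finset.mem_union_left N hC
    have hCi := hdec.circ C hC'
    have hCE : C ⊆ E := (hdec.sub hC').trans hHE
    have hCe : ∀ e ∈ C, e ≠ e0 := by
      rintro e he rfl
      exact hb0 ⟨C, hCE, he, hCi.2.1⟩
    by_cases hx : ∃ x ∈ VS C, x ∈ L
    · obtain ⟨x, hxC, hxL⟩ := hx
      have hall : ∀ e ∈ C, e ∈ K := by
        intro e he
        induction e with | _ a b =>
        exact hKmem _ (hCE he) (hCe _ he) a (by simp)
          (circ_nocross hCi (fun e he => hnc e (hCE he) (hCe e he)) hxC ⟨_, he, by simp⟩ hxL)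
      refine Eq.trans (b := sg σ C) ?_ (hdec.pos C hC)
      rw [sg]
      apply Finset.sum_congr rfl
      intro e he
      simp [hall e he]
    · apply Finset.sum_eq_zero
      intro e he
      rw [if_neg]
      rintro ⟨heK, _⟩
      apply hx
      induction e with | _ a b =>
      exact ⟨a, ⟨_, he, by simp⟩, hKin _ heK a (by simp)⟩
  have hN : ∑ C ∈ N, ∑ e ∈ C, (if e ∈ K ∧ σ e = true then (1 : ZMod 2) else 0) = 0 := by
    apply Finset.sum_eq_zero
    intro C hC
    apply Finset.sum_eq_zero
    intro e he
    rw [if_neg]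
    rintro ⟨heK, _⟩
    induction e with | _ a b =>
    exact hNL C hC a ⟨_, he, by simp⟩ (hKin _ heK a (by simp))
  rw [h1, hP, hN, add_zero, ZMod.natCast_eq_zero_iff_even] at hsum
  obtain ⟨k, hk⟩ := hsum
  omega

end Soft


section CaseB
open Classical
variable [Fintype V]

theorem res_bd0 {Z : Finset (Sym2 V)} {U : Set V} (hZ : bd Z = 0) (hU : ∀ e ∈ Z, ¬ Crosses U e) :
    bd (res Z U) = 0 := by
  funext v; rw [bd_res hU, hZ]; simp

theorem res_conn {A : Finset (Sym2 V)} {U : Set V} {x y : V} (hA : bd A = dl x + dl y)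
    (hU : ∀ e ∈ A, ¬ Crosses U e) (hx : x ∈ U) (hy : y ∈ U) : bd (res A U) = dl x + dl y := by
  funext v
  rw [bd_res hU, hA]
  split_ifs with h
  · rfl
  · rw [Pi.add_apply, dl_ne (by rintro rfl; exact h hx), dl_ne (by rintro rfl; exact h hy), add_zero]

theorem caseB [Nonempty V] {G : SimpleGraph V} {σ : Sym2 V → Bool} {E J : Finset (Sym2 V)}
    {P N : Finset (Finset (Sym2 V))}
    (hG : ∀ e ∈ E, e ∈ G.edgeSet) (hcon : ∀ x ∈ VS E, ∀ y ∈ VS E, conn E x y)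
    (hm : Hmin σ E)
    (hbr : ∀ e ∈ E, ¬ cyc E e → ∀ z ∈ e, ∃ f ∈ E, σ f = true ∧ ∀ x ∈ f, x ∈ side E e z)
    (hJ : J ⊆ poss σ E) (hdec : Dec σ (negs σ E ∪ J) P N)
    (hcase : N.card = 1 → ∃ e ∈ E, ¬ cyc E e) :
    ∃ n, Cov G σ (N.biUnion id ∪ E.filter (fun e => ¬ cyc E e)) n ∧
      n ≤ ∑ t ∈ N, t.card + E.card + (E.filter (fun e => ¬ cyc E e)).card := by
  set B := E.filter (fun e => ¬ cyc E e) with hB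
  set Enb := E.filter (fun e => cyc E e) with hEnb
  have hHE : negs σ E ∪ J ⊆ E :=
    Finset.union_subset (Finset.filter_subset _ _) (hJ.trans (Finset.filter_subset _ _))
  have mB : ∀ e, e ∈ B ↔ e ∈ E ∧ ¬ cyc E e := fun e => Finset.mem_filter
  have mEnb : ∀ e, e ∈ Enb ↔ e ∈ E ∧ cyc E e := fun e => Finset.mem_filter
  have hcardE : Enb.card + B.card = E.card := Finset.card_filter_add_card_filter_not _
  have hEnbE : Enb ⊆ E := Finset.filter_subset _ _
  have hBE : B ⊆ E := Finset.filter_subset _ _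
  have hEB : ∀ e ∈ E, e ∉ B → e ∈ Enb := by
    intro e he h
    rw [mB] at h
    rw [mEnb]
    exact ⟨he, by by_contra hc; exact h ⟨he, hc⟩⟩
  obtain ⟨r, hr, hrr⟩ := exists_root Enb
  set L : V → Set V := fun ρ => {x | r x = ρ} with hL
  set K : V → Finset (Sym2 V) := fun ρ => res Enb (L ρ) with hK
  have hredge : ∀ e ∈ Enb, ∀ x ∈ e, ∀ y ∈ e, r x = r y := by
    intro e he x hx y hy
    by_cases hxy : x = y
    · rw [hxy]
    · have : e = s(x, y) := (Sym2.mem_and_mem_iff hxy).1 ⟨hx, hy⟩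
      exact hrr x y (conn_edge (this ▸ he))
  have hnc : ∀ ρ, ∀ e ∈ Enb, ¬ Crosses (L ρ) e := by
    rintro ρ e he ⟨a, b, rfl, ha, hb⟩
    apply hb
    have := hredge _ he a (by simp) b (by simp)
    exact this.symm.trans ha
  have mK : ∀ ρ e, e ∈ K ρ ↔ e ∈ Enb ∧ ∃ x ∈ e, r x = ρ := fun ρ e => Finset.mem_filter
  have hKEnb : ∀ ρ, K ρ ⊆ Enb := fun ρ => res_sub _ _
  have hKin : ∀ ρ, ∀ e ∈ K ρ, ∀ x ∈ e, x ∈ L ρ := by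
    intro ρ e he x hx
    obtain ⟨h1, y, hy, h2⟩ := (mK ρ e).1 he
    exact (hredge e h1 x hx y hy).trans h2
  have hZ : ∀ Z ⊆ E, bd Z = 0 → Z ⊆ Enb := by
    intro Z hZ hb e he
    exact (mEnb e).2 ⟨hZ he, Z, hZ, he, hb⟩
  have hKc : ∀ ρ, ∀ e ∈ K ρ, cyc (K ρ) e := by
    intro ρ e he
    obtain ⟨h1, h2⟩ := (mK ρ e).1 he
    obtain ⟨Z, hZE, heZ, hb⟩ := ((mEnb e).1 h1).2
    have hZ' := hZ Z hZE hb
    refine ⟨res Z (L ρ), ?_, Finset.mem_filter.2 ⟨heZ, h2⟩, res_bd0 hb (fun e he => hnc ρ e (hZ' he))⟩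
    intro f hf
    obtain ⟨h3, h4⟩ := Finset.mem_filter.1 hf
    exact (mK ρ f).2 ⟨hZ' h3, h4⟩
  have hKL : ∀ ρ, ∀ x ∈ L ρ, ∀ y ∈ L ρ, conn (K ρ) x y := by
    intro ρ x hx y hy
    obtain ⟨A, hA, hb⟩ := (comp_iff hr hrr x y).2 (hx.trans hy.symm : r x = r y)
    refine ⟨res A (L ρ), ?_, res_conn hb (fun e he => hnc ρ e (hA he)) hx hy⟩
    intro f hf
    obtain ⟨h3, h4⟩ := Finset.mem_filter.1 hf
    exact (mK ρ f).2 ⟨hA h3, h4⟩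
  have hBend' : ∀ e ∈ B, ∀ x ∈ e, ∀ y ∈ e, r x = r y → x = y := by
    intro e he x hx y hy hxy
    by_contra hne
    have h : e = s(x, y) := (Sym2.mem_and_mem_iff hne).1 ⟨hx, hy⟩
    subst h
    refine ((mB _).1 he).2 (cyc_of_conn ((mB _).1 he).1 (conn_mono ?_ ((comp_iff hr hrr x y).2 hxy)))
    intro f hf
    refine Finset.mem_erase.2 ⟨?_, hEnbE hf⟩
    rintro rfl
    exact ((mB _).1 he).2 ((mEnb _).1 hf).2
  set rt : Finset (Sym2 V) → V := fun t => r (Classical.epsilon (fun x => x ∈ VS t)) with hrt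
  have hrt1 : ∀ t, Circ t → t ⊆ Enb → ∀ x ∈ VS t, r x = rt t := by
    intro t ht htE x hx
    apply hrr
    exact conn_mono htE (circ_conn ht hx (Classical.epsilon_spec (p := fun x => x ∈ VS t) ⟨x, hx⟩))
  have hNc : ∀ t ∈ N, Circ t := fun t ht => hdec.circ t (Finset.mem_union_right _ ht)
  have hNE : ∀ t ∈ N, t ⊆ Enb := fun t ht =>
    hZ t ((hdec.sub (Finset.mem_union_right _ ht)).trans hHE) (hNc t ht).2.1
  set Nr : V → Finset (Finset (Sym2 V)) := fun ρ => N.filter (fun t => rt t = ρ) with hNr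
  have mNr : ∀ ρ t, t ∈ Nr ρ ↔ t ∈ N ∧ rt t = ρ := fun ρ t => Finset.mem_filter
  have hloc := fun ρ => loc (σ := σ) (K := K ρ) (B := B) (L := L ρ) (N := Nr ρ) ρ (hKc ρ) (hKL ρ)
    (hKin ρ) (fun e he x hx y hy h1 h2 => hBend' e he x hx y hy (h1.trans h2.symm))
    (by intro t ht
        obtain ⟨h1, h2⟩ := (mNr ρ t).1 ht
        refine ⟨hNc t h1, ?_⟩
        intro e he
        refine (mK ρ e).2 ⟨hNE t h1 he, ?_⟩
        induction e with | _ a b =>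
        exact ⟨a, by simp, (hrt1 t (hNc t h1) (hNE t h1) a ⟨_, he, by simp⟩).trans h2⟩)
    (by intro t ht t' ht' hne
        exact hdec.disj t (Finset.mem_union_right _ ((mNr ρ t).1 ht).1) t'
          (Finset.mem_union_right _ ((mNr ρ t').1 ht').1) hne)
    (by intro h1
        by_contra hno
        push Not at hno
        obtain ⟨t, ht⟩ := Finset.card_eq_one.1 h1
        have ht' : t ∈ Nr ρ := by rw [ht]; simp
        obtain ⟨htN, htr⟩ := (mNr ρ t).1 ht'
        obtain ⟨x, hx⟩ := circ_VS_nonempty (hNc t htN)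
        have hxL : x ∈ L ρ := (hrt1 t (hNc t htN) (hNE t htN) x hx).trans htr
        have hxE : x ∈ VS E := VS_mono ((hNE t htN).trans hEnbE) hx
        have hall : ∀ y ∈ VS E, y ∈ L ρ := by
          intro y hy
          refine conn_nocross (hcon x hxE y hy) ?_ hxL
          intro e he hcr
          by_cases heB : e ∈ B
          · obtain ⟨a, b, rfl, ha, hb⟩ := hcr
            exact hno _ heB a (by simp) ha
          · exact hnc ρ e (hEB e he heB) hcr
        have hNN : Nr ρ = N := by
          apply Finset.filter_true_of_mem
          intro t' ht'
          obtain ⟨y, hy⟩ := circ_VS_nonempty (hNc t' ht')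
          rw [← hrt1 t' (hNc t' ht') (hNE t' ht') y hy]
          exact hall y (VS_mono ((hNE t' ht').trans hEnbE) hy)
        obtain ⟨e, he, hec⟩ := hcase (by rw [← hNN]; exact h1)
        have heB := (mB e).2 ⟨he, hec⟩
        induction e with | _ a b =>
        exact hno _ heB a (by simp) (hall a ⟨_, he, by simp⟩))
    (by intro e he v hv hvL huniq hN0
        refine soft hm ((hKEnb ρ).trans hEnbE) (hKin ρ) (e0 := e) (v := v) ?_ ?_ (hKc ρ) (hBE he)
          ((mB e).1 he).2 hv hvL hJ hdec ?_ (hbr e (hBE he) ((mB e).1 he).2 v hv)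
        · intro e' he' hne x hx hxL
          exact (mK ρ e').2 ⟨hEB e' he' (fun h => hne (huniq e' h x hx hxL)), x, hx, hxL⟩
        · intro x hx hxL
          exact hBend' e he x hx v hv (hxL.trans hvL.symm)
        · intro t ht x hx hxL
          have : t ∈ Nr ρ := (mNr ρ t).2 ⟨ht, (hrt1 t (hNc t ht) (hNE t ht) x hx).symm.trans hxL⟩
          rw [hN0] at this
          simp at this)
  choose S F p hFK hS hSN hSS hp h1 h2 hcard using hloc
  have hSrt : ∀ ρ, ∀ t ∈ S ρ, rt t = ρ := by
    intro ρ t ht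
    obtain ⟨hc, _, hk⟩ := hS ρ t ht
    obtain ⟨x, hx⟩ := circ_VS_nonempty hc
    rw [← hrt1 t hc (hk.trans (hKEnb ρ)) x hx]
    obtain ⟨e, he, hxe⟩ := hx
    exact hKin ρ e (hk he) x hxe
  set X := N ∪ Finset.univ.biUnion S with hX
  have mX : ∀ t, t ∈ X → t ∈ Nr (rt t) ∪ S (rt t) := by
    intro t ht
    rcases Finset.mem_union.1 ht with h | h
    · exact Finset.mem_union_left _ ((mNr _ _).2 ⟨h, rfl⟩)
    · obtain ⟨ρ, _, h⟩ := Finset.mem_biUnion.1 h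
      rw [hSrt ρ t h]
      exact Finset.mem_union_right _ h
  have mX' : ∀ ρ t, t ∈ Nr ρ ∪ S ρ → t ∈ X ∧ rt t = ρ := by
    intro ρ t ht
    rcases Finset.mem_union.1 ht with h | h
    · exact ⟨Finset.mem_union_left _ ((mNr _ _).1 h).1, ((mNr _ _).1 h).2⟩
    · exact ⟨Finset.mem_union_right _ (Finset.mem_biUnion.2 ⟨ρ, Finset.mem_univ _, h⟩), hSrt ρ t h⟩
  have hXX : ∀ t ∈ X, Circ t ∧ sg σ t = 1 ∧ t ⊆ Enb := by
    intro t ht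
    rcases Finset.mem_union.1 ht with h | h
    · exact ⟨hNc t h, hdec.neg t h, hNE t h⟩
    · obtain ⟨ρ, _, h⟩ := Finset.mem_biUnion.1 h
      exact ⟨(hS ρ t h).1, (hS ρ t h).2.1, (hS ρ t h).2.2.trans (hKEnb ρ)⟩
  set q : Finset (Sym2 V) → V := fun t => p (rt t) t with hq
  set Fn := Finset.univ.biUnion F with hFn
  have hFFn : ∀ ρ, F ρ ⊆ Fn := fun ρ => Finset.subset_biUnion_of_mem F (Finset.mem_univ ρ)
  have hFnEnb : Fn ⊆ Enb := by
    intro f hf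
    obtain ⟨ρ, _, hf⟩ := Finset.mem_biUnion.1 hf
    exact hKEnb ρ (hFK ρ hf)
  have hFE : B ∪ Fn ⊆ E := Finset.union_subset hBE (hFnEnb.trans hEnbE)
  have g0 : ∀ f ∈ Fn, f ∈ B ∪ Fn ∧ f ∉ B := fun f hf =>
    ⟨Finset.mem_union_right _ hf, fun h => ((mB f).1 h).2 ((mEnb f).1 (hFnEnb hf)).2⟩
  have hcr : ∀ e ∈ B, ∀ z ∈ e, Crosses (side (B ∪ Fn) e z) e := by
    intro e he z hz
    refine side_crosses' (Finset.mem_union_left _ he) ?_ hz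
    rintro ⟨Z, hZF, heZ, hb⟩
    exact ((mB e).1 he).2 ⟨Z, hZF.trans hFE, heZ, hb⟩
  have gs := glue_side (F := B ∪ Fn) (Fn := Fn) (B := B) (X := X) (p := q)
    Finset.subset_union_left g0 hcr (by
      intro e he z hz
      rcases h1 (r z) e he z hz rfl with ⟨t, ht, hc⟩ | ⟨e', he', hne, z', hz', hc⟩
      · left
        obtain ⟨htX, hrho⟩ := mX' _ _ ht
        refine ⟨t, htX, ?_⟩
        simp only [hq, hrho]
        exact conn_mono (hFFn _) hc
      · right
        exact ⟨e', he', hne, z', hz', conn_mono (hFFn _) hc⟩)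
  have gs' : ∀ e ∈ B, ∀ z ∈ e, ∃ t ∈ X, q t ∈ side (B ∪ Fn) e z := fun e he z hz =>
    gs _ e he z hz le_rfl
  have gc := glue_conn (F := B ∪ Fn) (Fn := Fn) (B := B) (X := X) (p := q)
    Finset.subset_union_left g0 hcr gs' (by
      intro t ht
      rcases h2 (rt t) t (mX t ht) with ⟨t', ht', hne, hc⟩ | ⟨e', he', z', hz', hc⟩
      · left
        obtain ⟨htX, hrho⟩ := mX' _ _ ht'
        refine ⟨t', htX, hne, ?_⟩
        simp only [hq, hrho]
        exact conn_mono (hFFn _) hc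
      · right
        exact ⟨e', he', z', hz', conn_mono (hFFn _) hc⟩)
  obtain ⟨n, hcov, hn⟩ := caseB_end (G := G) (σ := σ) (E := E) (F := B ∪ Fn) hG hFE (X := X) (p := q)
    (by intro t ht
        obtain ⟨a, b, c⟩ := hXX t ht
        exact ⟨a, b, c.trans hEnbE, hp _ t (mX t ht)⟩)
    (by intro t ht t' ht' hne
        by_cases hrr' : rt t = rt t'
        · have m1 := mX t ht
          have m2 := mX t' ht'
          rw [← hrr'] at m2
          by_cases hSe : (S (rt t)).Nonempty
          · rw [hSN _ hSe, Finset.empty_union] at m1 m2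
            exact absurd (hSS _ t m1 t' m2) hne
          · rw [Finset.not_nonempty_iff_eq_empty] at hSe
            rw [hSe, Finset.union_empty] at m1 m2
            exact hdec.ss t ((mNr _ _).1 m1).1 t' ((mNr _ _).1 m2).1 hne
        · intro x hx
          exfalso
          apply hrr'
          obtain ⟨a, _, c⟩ := hXX t ht
          obtain ⟨a', _, c'⟩ := hXX t' ht'
          rw [← hrt1 t a c x hx.1, hrt1 t' a' c' x hx.2])
    (by intro e he hc
        exact Finset.mem_union_left _ ((mB e).2 ⟨he, hc⟩))
    (by intro e he hc
        exact gs' e ((mB e).2 ⟨he, hc⟩))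
    gc
  refine ⟨n, hcov.mono ?_ le_rfl, ?_⟩
  · apply Finset.union_subset_union _ subset_rfl
    exact Finset.biUnion_subset_biUnion_of_subset_left _ Finset.subset_union_left
  · have s1 : ∑ t ∈ X, t.card ≤ ∑ t ∈ N, t.card + ∑ ρ, ∑ t ∈ S ρ, t.card := by
      have a1 := Finset.sum_union_inter (s₁ := N) (s₂ := Finset.univ.biUnion S) (f := fun t => t.card)
      have a2 : ∑ t ∈ Finset.univ.biUnion S, t.card = ∑ ρ, ∑ t ∈ S ρ, t.card := by
        apply Finset.sum_biUnion
        intro ρ _ ρ' _ hne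
        refine Finset.disjoint_left.2 ?_
        intro t ht ht'
        exact hne ((hSrt ρ t ht).symm.trans (hSrt ρ' t ht'))
      rw [← hX] at a1
      omega
    have s2 : (B ∪ Fn).card ≤ B.card + ∑ ρ, (F ρ).card :=
      (Finset.card_union_le _ _).trans (Nat.add_le_add_left Finset.card_biUnion_le _)
    have s3 : ∑ ρ, (K ρ).card ≤ Enb.card := by
      rw [← Finset.card_biUnion]
      · apply Finset.card_le_card
        rw [Finset.biUnion_subset]
        intro ρ _
        exact hKEnb ρ
      · intro ρ _ ρ' _ hne
        refine Finset.disjoint_left.2 ?_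
        intro e he he'
        apply hne
        obtain ⟨_, x, hx, hxr⟩ := (mK ρ e).1 he
        rw [← hxr]
        exact hKin ρ' e he' x hx
    have s4 : ∑ ρ, ∑ t ∈ Nr ρ, t.card = ∑ t ∈ N, t.card := Finset.sum_fiberwise N rt _
    have s5 := Finset.sum_le_sum (s := Finset.univ) (fun ρ _ => hcard ρ)
    rw [Finset.sum_add_distrib, Finset.sum_add_distrib, ← Finset.mul_sum, ← Finset.mul_sum,
      ← Finset.mul_sum, s4] at s5
    omega

theorem core {G : SimpleGraph V} {σ : Sym2 V → Bool} {E : Finset (Sym2 V)}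
    (hG : ∀ e ∈ E, e ∈ G.edgeSet) (hcon : ∀ x ∈ VS E, ∀ y ∈ VS E, conn E x y)
    (hm : Hmin σ E) (hn1 : (negs σ E).card ≠ 1)
    (hbr : ∀ e ∈ E, ¬ cyc E e → ∀ z ∈ e, ∃ f ∈ E, σ f = true ∧ ∀ x ∈ f, x ∈ side E e z) :
    Good G σ E := by
  obtain ⟨J, hJ, hJb, hJc⟩ := pos_join hm (subset_refl (negs σ E))
  have hnE : negs σ E ⊆ E := Finset.filter_subset _ _
  have hpE : poss σ E ⊆ E := Finset.filter_subset _ _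
  have hHE : negs σ E ∪ J ⊆ E := Finset.union_subset hnE (hJ.trans hpE)
  have hcard := negs_poss_card σ E
  have hdisj := (negs_poss_disj σ E).mono subset_rfl hJ
  have hHb : bd (negs σ E ∪ J) = 0 := by rw [bd_union hdisj, hJb, ztf]
  obtain ⟨P, N, hdec⟩ := dec_exists' σ hHb
  by_cases hA : N.card = 1 ∧ ∀ e ∈ E, cyc E e
  · obtain ⟨N₀, rfl⟩ := Finset.card_eq_one.1 hA.1
    exact caseA hG hcon hm hn1 hA.2 hJ hJb hJc hdec
  rcases isEmpty_or_nonempty V with hV | hV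
  · have hE : E = ∅ := by
      rw [Finset.eq_empty_iff_forall_notMem]
      intro e _
      induction e with | _ a b => exact hV.elim a
    subst hE
    exact ⟨0, ⟨0, by simp, by simp [target], by simp⟩, by simp [poss]⟩
  obtain ⟨n, hcov, hn⟩ := caseB hG hcon hm hbr hJ hdec (by
    intro h
    by_contra hc
    push Not at hc
    exact hA ⟨h, hc⟩)
  have hcovP := hdec.cov (fun e he => hG e (hHE he))
  refine ⟨_, (hcovP.add hcov).mono (target_sub hm ?_ ?_) le_rfl, ?_⟩
  · intro g hg
    refine ⟨_, hHE, hHb, Finset.mem_union_left _ hg, ?_⟩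
    rw [← hdec.un, Finset.union_biUnion]
    intro x hx
    simp only [Finset.mem_union] at hx ⊢
    tauto
  · intro e he hc
    exact Finset.mem_union_right _ (Finset.mem_union_right _ (Finset.mem_filter.2 ⟨he, hc⟩))
  · have hc := hdec.card
    rw [Finset.card_union_of_disjoint hdisj] at hc
    omega

end CaseB


section Red
open Classical
variable [Fintype V]

theorem conn_reach {H : SimpleGraph V} {K : Finset (Sym2 V)} (hKH : ∀ e ∈ K, e ∈ H.edgeSet) {x y : V}
    (h : conn K x y) : H.Reachable x y := by
  obtain ⟨A, hA, hb⟩ := h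
  obtain ⟨w, _⟩ := walk_of_bd H _ A x y rfl (fun e he => hKH e (hA he)) hb
  exact ⟨w⟩

theorem reach_conn {H : SimpleGraph V} {K : Finset (Sym2 V)} {W : Set V}
    (hW : ∀ e ∈ H.edgeSet, ∀ x ∈ e, x ∈ W → e ∈ K) (hKW : ∀ e ∈ H.edgeSet, e ∈ K → ∀ x ∈ e, x ∈ W)
    {x y : V} (hx : x ∈ W) (h : H.Reachable x y) : conn K x y := by
  obtain ⟨w⟩ := h
  induction w with
  | nil => exact conn_refl _ _
  | @cons a b c hadj w ih =>
    have he : s(a, b) ∈ H.edgeSet := hadj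
    have hK := hW _ he a (by simp) hx
    exact conn_trans (conn_edge hK) (ih (hKW _ he hK b (by simp)))

theorem bridge_iff {H : SimpleGraph V} {K : Finset (Sym2 V)} {W : Set V}
    (hKH : ∀ e ∈ K, e ∈ H.edgeSet)
    (hW : ∀ e ∈ H.edgeSet, ∀ x ∈ e, x ∈ W → e ∈ K) (hKW : ∀ e ∈ K, ∀ x ∈ e, x ∈ W)
    {e : Sym2 V} (he : e ∈ K) : H.IsBridge e ↔ ¬ cyc K e := by
  induction e with | _ u v =>
  rw [isBridge_iff, not_iff_not]
  constructor
  · intro h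
    refine cyc_of_conn he (reach_conn (W := W) ?_ ?_ (hKW _ he u (by simp)) h)
    · intro f hf x hx hxW
      rw [edgeSet_deleteEdges] at hf
      exact Finset.mem_erase.2 ⟨hf.2, hW f hf.1 x hx hxW⟩
    · intro f _ hf x hx
      exact hKW f (Finset.mem_of_mem_erase hf) x hx
  · intro h
    have hc : conn (K.erase s(u, v)) u v := by
      by_contra hc
      exact not_cyc_of_cross (side_cross_only (z := u)) ⟨u, v, rfl, mem_comp_self _ _, hc⟩ h
    refine conn_reach ?_ hc
    intro f hf
    rw [edgeSet_deleteEdges]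
    exact ⟨hKH f (Finset.mem_of_mem_erase hf), Finset.ne_of_mem_erase hf⟩

theorem sw_card (σ : Sym2 V → Bool) (E : Finset (Sym2 V)) (U : Set V) :
    (E.filter (fun e => switchSign σ U e = true)).card +
      (E.filter (fun e => σ e = true ∧ Crosses U e)).card =
    (negs σ E).card + (E.filter (fun e => σ e = false ∧ Crosses U e)).card := by
  simp only [negs, Finset.card_filter, ← Finset.sum_add_distrib]
  apply Finset.sum_congr rfl
  intro e _
  simp only [switchSign]
  by_cases h : Crosses U e <;> rcases Bool.eq_false_or_eq_true (σ e) with hs | hs <;> simp [h, hs]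

theorem sw_empty (σ : Sym2 V → Bool) : switchSign σ ∅ = σ := by
  funext e
  rw [switchSign, if_neg]
  rintro ⟨x, y, _, h, _⟩
  exact h

theorem comp_good {G : SimpleGraph V} {σ : Sym2 V → Bool}
    (hfa : FlowAdmissible G σ) (hmin : (negEdgeSet G σ).ncard = negativeness G σ) (x0 : V)
    {E : Finset (Sym2 V)} (hE : ∀ e, e ∈ E ↔ e ∈ G.edgeSet ∧ ∀ y ∈ e, G.Reachable x0 y) :
    Good G σ E := by
  have hEG : ∀ e ∈ E, e ∈ G.edgeSet := fun e he => ((hE e).1 he).1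
  set W : Set V := {y | G.Reachable x0 y} with hWdef
  have hEW : ∀ e ∈ E, ∀ x ∈ e, x ∈ W := fun e he => ((hE e).1 he).2
  have hWE : ∀ e ∈ G.edgeSet, ∀ x ∈ e, x ∈ W → e ∈ E := by
    intro e he x hx hxW
    refine (hE e).2 ⟨he, ?_⟩
    obtain ⟨y, rfl⟩ := Sym2.mem_iff_exists.1 hx
    intro z hz
    have hadj : G.Adj x y := he
    rcases Sym2.mem_iff.1 hz with rfl | rfl
    · exact hxW
    · exact Reachable.trans hxW hadj.reachable
  have hcon : ∀ x ∈ VS E, ∀ y ∈ VS E, conn E x y := by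
    rintro x ⟨e, he, hx⟩ y ⟨f, hf, hy⟩
    refine reach_conn hWE (fun e _ he => hEW e he) (hEW e he x hx) ?_
    exact (Reachable.symm (hEW e he x hx)).trans (hEW f hf y hy)
  have hm : Hmin σ E := by
    intro U
    set A : Finset (Sym2 V) := G.edgeSet.toFinset with hA
    have h1 : (negs σ A).card ≤ (A.filter (fun e => switchSign σ (U ∩ W) e = true)).card := by
      have e1 : negEdgeSet G σ = ↑(negs σ A) := by
        ext e; simp [negEdgeSet, negs, hA]
      rw [e1, Set.ncard_coe_finset] at hmin
      rw [hmin, negativeness, negOn]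
      apply Nat.sInf_le
      refine ⟨U ∩ W, ?_⟩
      rw [← Set.ncard_coe_finset]
      congr 1
      ext e
      simp [hA]
    have h2 := sw_card σ A (U ∩ W)
    have h3 : ∀ c : Bool, E.filter (fun e => σ e = c ∧ Crosses U e) =
        A.filter (fun e => σ e = c ∧ Crosses (U ∩ W) e) := by
      intro c
      ext e
      simp only [Finset.mem_filter, hA, Set.mem_toFinset]
      constructor
      · rintro ⟨he, hc, a, b, rfl, ha, hb⟩
        exact ⟨hEG _ he, hc, a, b, rfl, ⟨ha, hEW _ he a (by simp)⟩, fun h => hb h.1⟩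
      · rintro ⟨he, hc, a, b, rfl, ha, hb⟩
        have heE := hWE _ he a (by simp) ha.2
        exact ⟨heE, hc, a, b, rfl, ha.1, fun h => hb ⟨h, hEW _ heE b (by simp)⟩⟩
    rw [h3, h3]
    omega
  have hset : ∀ U : Set V, {e | e ∈ G.edgeSet ∧ (∀ x ∈ e, x ∈ W) ∧ switchSign σ U e = true} =
      ((E.filter (fun e => switchSign σ U e = true) : Finset (Sym2 V)) : Set (Sym2 V)) := by
    intro U
    ext e
    simp only [Finset.coe_filter, hE]
    exact ⟨fun h => ⟨⟨h.1, h.2.1⟩, h.2.2⟩, fun h => ⟨h.1.1, h.1.2, h.2⟩⟩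
  have hn1 : (negs σ E).card ≠ 1 := by
    have h := (hfa x0).1
    have heq : negOn G σ {y | G.Reachable x0 y} = (negs σ E).card := by
      apply le_antisymm
      · apply Nat.sInf_le
        refine ⟨∅, ?_⟩
        rw [hset, Set.ncard_coe_finset, sw_empty]; rfl
      · apply le_csInf
        · exact ⟨_, ∅, rfl⟩
        · rintro n ⟨U, rfl⟩
          rw [hset, Set.ncard_coe_finset]
          have a := hm U
          have b := sw_card σ E U
          omega
    rw [heq] at h
    exact h
  refine core hEG hcon hm hn1 ?_
  intro e he hc z hz
  have hb := (bridge_iff hEG hWE hEW he).2 hc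
  have hnb := (hfa x0).2 e (hEG e he) hb (hEW e he) z hz
  by_contra hno
  push Not at hno
  apply hnb
  rw [BalancedOn, ← Nat.le_zero]
  apply Nat.sInf_le
  refine ⟨∅, ?_⟩
  symm
  rw [Set.ncard_eq_zero, Set.eq_empty_iff_forall_notMem]
  rintro f ⟨hf, hfx, hfs⟩
  rw [sw_empty] at hfs
  have hzW := hEW e he z hz
  have hfW : ∀ x ∈ f, x ∈ W := fun x hx =>
    Reachable.trans hzW ((hfx x hx).mono (deleteEdges_le _))
  obtain ⟨x, hx, hxn⟩ := hno f ((hE f).2 ⟨hf, hfW⟩) hfs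
  apply hxn
  refine reach_conn (H := G.deleteEdges {e}) (W := W) ?_ ?_ hzW (hfx x hx)
  · intro g hg y hy hyW
    rw [edgeSet_deleteEdges] at hg
    exact Finset.mem_erase.2 ⟨hg.2, hWE g hg.1 y hy hyW⟩
  · intro g _ hg y hy
    exact hEW g (Finset.mem_of_mem_erase hg) y hy

theorem final (G : SimpleGraph V) (σ : Sym2 V → Bool)
    (hfa : FlowAdmissible G σ) (hmin : (negEdgeSet G σ).ncard = negativeness G σ) :
    ∃ 𝓕 : Multiset (Set (Sym2 V)),
      (∀ C ∈ 𝓕, IsSignedCircuit G σ C) ∧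
      (∀ e ∈ G.edgeSet \ nonBridgeEdges (gplus G σ), ∃ C ∈ 𝓕, e ∈ C) ∧
      2 * circuitLength 𝓕 + (nonBridgeEdges (gplus G σ)).ncard
        ≤ 4 * G.edgeSet.ncard + 2 * {e : Sym2 V | G.IsBridge e}.ncard := by
  let _ : Fintype G.ConnectedComponent := Fintype.ofFinite _
  set E : G.ConnectedComponent → Finset (Sym2 V) := fun c =>
    Finset.univ.filter (fun e => e ∈ G.edgeSet ∧ ∀ y ∈ e, G.connectedComponentMk y = c) with hEdef
  have mE : ∀ c e, e ∈ E c ↔ e ∈ G.edgeSet ∧ ∀ y ∈ e, G.connectedComponentMk y = c := by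
    intro c e; simp [hEdef]
  have hrep : ∀ c : G.ConnectedComponent, ∃ x, G.connectedComponentMk x = c := by
    intro c; induction c using ConnectedComponent.ind with | _ v => exact ⟨v, rfl⟩
  have hgood : ∀ c, Good G σ (E c) := by
    intro c
    obtain ⟨x, hx⟩ := hrep c
    apply comp_good hfa hmin x
    intro e
    rw [mE]
    apply and_congr_right
    intro _
    apply forall₂_congr
    intro y _
    rw [← hx, ConnectedComponent.eq]
    exact ⟨Reachable.symm, Reachable.symm⟩
  have hEW : ∀ e ∈ G.edgeSet, ∀ x ∈ e, ∀ y ∈ e, G.connectedComponentMk y = G.connectedComponentMk x := by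
    intro e he x hx y hy
    by_cases hxy : x = y
    · rw [hxy]
    · have : e = s(x, y) := (Sym2.mem_and_mem_iff hxy).1 ⟨hx, hy⟩
      rw [this] at he
      have hadj : G.Adj x y := he
      exact ConnectedComponent.eq.2 hadj.symm.reachable
  have hWE : ∀ c, ∀ e ∈ G.edgeSet, ∀ x ∈ e, x ∈ {x | G.connectedComponentMk x = c} → e ∈ E c := by
    intro c e he x hx hxc
    exact (mE c e).2 ⟨he, fun y hy => (hEW e he x hx y hy).trans hxc⟩
  have hmem : ∀ e ∈ G.edgeSet, ∃ c, e ∈ E c := by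
    intro e he
    induction e with | _ a b =>
    exact ⟨_, hWE _ _ he a (by simp) rfl⟩
  have hdis : ∀ c c' e, e ∈ E c → e ∈ E c' → c = c' := by
    intro c c' e h h'
    induction e with | _ a b =>
    rw [← ((mE _ _).1 h).2 a (by simp), ← ((mE _ _).1 h').2 a (by simp)]
  have hbrG : ∀ c, ∀ e ∈ E c, (G.IsBridge e ↔ ¬ cyc (E c) e) := fun c e he =>
    bridge_iff (W := {x | G.connectedComponentMk x = c}) (fun e he => ((mE c e).1 he).1) (hWE c)
      (fun e he => ((mE c e).1 he).2) he
  have mgp : ∀ e, e ∈ (gplus G σ).edgeSet ↔ e ∈ G.edgeSet ∧ σ e = false := by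
    intro e
    rw [gplus, edgeSet_deleteEdges, Set.mem_sdiff, Set.mem_ofPred_eq, Bool.not_eq_true]
  have mposs : ∀ c e, e ∈ poss σ (E c) ↔ e ∈ E c ∧ σ e = false := fun c e => Finset.mem_filter
  have hbrP : ∀ c, ∀ e ∈ poss σ (E c), ((gplus G σ).IsBridge e ↔ ¬ cyc (poss σ (E c)) e) := fun c e he =>
    bridge_iff (W := {x | G.connectedComponentMk x = c})
      (fun e he => (mgp e).2 ⟨((mE c e).1 ((mposs c e).1 he).1).1, ((mposs c e).1 he).2⟩)
      (fun e he x hx hxc => (mposs c e).2 ⟨hWE c e ((mgp e).1 he).1 x hx hxc, ((mgp e).1 he).2⟩)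
      (fun e he => ((mE c e).1 ((mposs c e).1 he).1).2) he
  choose n hcov hn using hgood
  choose F hF1 hF2 hF3 using hcov
  refine ⟨∑ c, (F c).map (fun D : Finset (Sym2 V) => (D : Set (Sym2 V))), ?_, ?_, ?_⟩
  · intro C hC
    obtain ⟨c, _, hC⟩ := Multiset.mem_sum.1 hC
    obtain ⟨D, hD, rfl⟩ := Multiset.mem_map.1 hC
    exact hF1 c D hD
  · rintro e ⟨he, hnb⟩
    obtain ⟨c, hc⟩ := hmem e he
    have ht : e ∈ target σ (E c) := by
      refine Finset.mem_filter.2 ⟨hc, ?_⟩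
      rintro ⟨hs, hcyc⟩
      apply hnb
      refine ⟨(mgp e).2 ⟨he, hs⟩, ?_⟩
      rw [hbrP c e ((mposs c e).2 ⟨hc, hs⟩)]
      exact not_not.2 hcyc
    obtain ⟨D, hD, heD⟩ := hF2 c e ht
    exact ⟨D, Multiset.mem_sum.2 ⟨c, Finset.mem_univ _, Multiset.mem_map_of_mem _ hD⟩, heD⟩
  · have hlen : circuitLength (∑ c, (F c).map (fun D : Finset (Sym2 V) => (D : Set (Sym2 V)))) ≤ ∑ c, n c := by
      have : circuitLength (∑ c, (F c).map (fun D : Finset (Sym2 V) => (D : Set (Sym2 V)))) =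
          ∑ c, ((F c).map Finset.card).sum := by
        rw [circuitLength]
        have h1 := map_sum (Multiset.mapAddMonoidHom (Set.ncard (α := Sym2 V)))
          (fun c => (F c).map (fun D : Finset (Sym2 V) => (D : Set (Sym2 V)))) Finset.univ
        have h2 := map_sum (Multiset.sumAddMonoidHom (M := ℕ))
          (fun c => ((F c).map (fun D : Finset (Sym2 V) => (D : Set (Sym2 V)))).map Set.ncard) Finset.univ
        simp only [Multiset.coe_mapAddMonoidHom] at h1
        simp only [Multiset.coe_sumAddMonoidHom] at h2
        rw [h1, h2]
        apply Finset.sum_congr rfl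
        intro c _
        rw [Multiset.map_map]
        congr 1
        apply Multiset.map_congr rfl
        intro D _
        simp [Set.ncard_coe_finset]
      rw [this]
      exact Finset.sum_le_sum (fun c _ => hF3 c)
    have hsumE : ∑ c, (E c).card ≤ G.edgeSet.ncard := by
      rw [← Finset.card_biUnion, ← Set.ncard_coe_finset]
      · apply Set.ncard_le_ncard
        · intro e he
          obtain ⟨c, _, he⟩ := Finset.mem_biUnion.1 (Finset.mem_coe.1 he)
          exact ((mE c e).1 he).1
        · exact Set.toFinite _
      · intro c _ c' _ hne
        exact Finset.disjoint_left.2 (fun e h h' => hne (hdis c c' e h h'))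
    have hsumB : ∑ c, ((E c).filter (fun e => ¬ cyc (E c) e)).card ≤ {e : Sym2 V | G.IsBridge e}.ncard := by
      rw [← Finset.card_biUnion, ← Set.ncard_coe_finset]
      · apply Set.ncard_le_ncard
        · intro e he
          obtain ⟨c, _, he⟩ := Finset.mem_biUnion.1 (Finset.mem_coe.1 he)
          obtain ⟨h1, h2⟩ := Finset.mem_filter.1 he
          exact (hbrG c e h1).2 h2
        · exact Set.toFinite _
      · intro c _ c' _ hne
        exact Finset.disjoint_left.2 (fun e h h' =>
          hne (hdis c c' e (Finset.mem_filter.1 h).1 (Finset.mem_filter.1 h').1))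
    have hsumP : (nonBridgeEdges (gplus G σ)).ncard ≤
        ∑ c, ((poss σ (E c)).filter (cyc (poss σ (E c)))).card := by
      refine le_trans ?_ Finset.card_biUnion_le
      rw [← Set.ncard_coe_finset]
      apply Set.ncard_le_ncard
      · rintro e ⟨he, hb⟩
        obtain ⟨h1, h2⟩ := (mgp e).1 he
        obtain ⟨c, hc⟩ := hmem e h1
        have hp := (mposs c e).2 ⟨hc, h2⟩
        rw [hbrP c e hp, not_not] at hb
        exact Finset.mem_coe.2 (Finset.mem_biUnion.2 ⟨c, Finset.mem_univ _, Finset.mem_filter.2 ⟨hp, hb⟩⟩)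
      · exact Set.toFinite _
    have s5 := Finset.sum_le_sum (s := Finset.univ) (fun c _ => hn c)
    rw [Finset.sum_add_distrib, Finset.sum_add_distrib, ← Finset.mul_sum, ← Finset.mul_sum,
      ← Finset.mul_sum] at s5
    omega

end Red

/-- covering the complement of `Ĝ⁺` in a flow-admissible signed graph. -/
theorem stmt8 {V : Type*} [Fintype V] (G : SimpleGraph V) (σ : Sym2 V → Bool)
    (hfa : FlowAdmissible G σ) (hmin : (negEdgeSet G σ).ncard = negativeness G σ) :
    ∃ 𝓕 : Multiset (Set (Sym2 V)),
      (∀ C ∈ 𝓕, IsSignedCircuit G σ C) ∧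
      (∀ e ∈ G.edgeSet \ nonBridgeEdges (gplus G σ), ∃ C ∈ 𝓕, e ∈ C) ∧
      2 * circuitLength 𝓕 + (nonBridgeEdges (gplus G σ)).ncard
        ≤ 4 * G.edgeSet.ncard + 2 * {e : Sym2 V | G.IsBridge e}.ncard := by
  exact final G σ hfa hmin
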